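/- arXiv:math/0607153 — 2 statements merged into one kernel-verified Lean document; each statement's English description precedes it below -/
import Mathlib

section
/- Assume p ≥ 3 and q ≥ 1. Let Ω, Ω' ⊂ M₀ be open and connected and let f : Ω → Ω' be a smooth diffeomorphism satisfying the Cauchy–Riemann system ĝ_{f(z)}(Df(z)U, Df(z)V) = u(z)^{-2} ĝ_z(U, V) for all z ∈ Ω, all U, V ∈ ℝ^{p+q}, and some function u : Ω → (0,∞). Then there exist A ∈ O(p), B ∈ O(q), b' ∈ ℝ^q, t > 0, b ∈ ℝ^q and s ∈ {0, −2} such that f(z) = Γ(δ_{t‖(x, y−b)‖^s}(x, y−b)) for all z = (x,y) ∈ Ω, where Γ(x,y) = (Ax, By + b'). -/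
noncomputable section

open scoped RealInnerProductSpace

/-- Points/tangent vectors of `M = ℝ^p × ℝ^q` with Euclidean norms on the factors. -/
abbrev GVec (p q : ℕ) := EuclideanSpace ℝ (Fin p) × EuclideanSpace ℝ (Fin q)

/-- The set `M₀ = (ℝ^p \ {0}) × ℝ^q`. -/
def GM0 (p q : ℕ) : Set (GVec p q) := {z | z.1 ≠ 0}

/-- Homogeneous norm `‖(x,y)‖ = (|x|^{2(α+1)} + |y|²)^{1/(2(α+1))}`. -/
def homNorm (α : ℝ) (p q : ℕ) (z : GVec p q) : ℝ :=
  (‖z.1‖ ^ (2 * (α + 1)) + ‖z.2‖ ^ 2) ^ (1 / (2 * (α + 1)))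

/-- Anisotropic dilation `δ_t(x,y) = (t x, t^{α+1} y)`. -/
def gdil (α : ℝ) (p q : ℕ) (t : ℝ) (z : GVec p q) : GVec p q :=
  (t • z.1, (t ^ (α + 1)) • z.2)

/-- Grushin inversion `Φ(z) = δ_{‖z‖^{-2}} z = (x/‖z‖², y/‖z‖^{2(α+1)})`. -/
def ginv (α : ℝ) (p q : ℕ) (z : GVec p q) : GVec p q :=
  ((homNorm α p q z ^ (-(2:ℝ))) • z.1, (homNorm α p q z ^ (-(2 * (α + 1)))) • z.2)

/-- The Riemannian metric `g = (α+1)²|x|^{2α}|dx|² + |dy|²` (depends on the point through `x`). -/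
def gMet (α : ℝ) (p q : ℕ) (x : EuclideanSpace ℝ (Fin p)) (U V : GVec p q) : ℝ :=
  (α + 1) ^ 2 * ‖x‖ ^ (2 * α) * ⟪U.1, V.1⟫ + ⟪U.2, V.2⟫

/-- The Riemannian metric `ĝ = |dx|² + |dy|²/((α+1)²|x|^{2α})`. -/
def ghat (α : ℝ) (p q : ℕ) (x : EuclideanSpace ℝ (Fin p)) (U V : GVec p q) : ℝ :=
  ⟪U.1, V.1⟫ + ⟪U.2, V.2⟫ / ((α + 1) ^ 2 * ‖x‖ ^ (2 * α))

/-- Contraction `Γ(U,V)^k = Γ^k_{ij}U^iV^j` of the Christoffel symbols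
`Γ^k_{ij} = α|x|^{-2}(δ_{ik}x_j + δ_{jk}x_i − δ_{ij}x_k)` (x-indices; all other symbols zero). -/
def gammaMap (α : ℝ) (p q : ℕ) (x : EuclideanSpace ℝ (Fin p)) (U V : GVec p q) : GVec p q :=
  ((α * ‖x‖ ^ (-(2:ℝ))) • (⟪x, V.1⟫ • U.1 + ⟪x, U.1⟫ • V.1 - ⟪U.1, V.1⟫ • x), 0)

/-- Covariant derivative `∇_U V` of a vector field `V` along the constant direction `U`, at `z`. -/
def covDeriv (α : ℝ) (p q : ℕ) (V : GVec p q → GVec p q) (z : GVec p q) (U : GVec p q) :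
    GVec p q :=
  fderiv ℝ V z U + gammaMap α p q z.1 U (V z)

/-- Curvature operator `R(X,Y)Z = ∇_X ∇_Y Z − ∇_Y ∇_X Z` on constant (hence commuting) vector
fields `X, Y, Z`, evaluated at `z`. -/
def curvOp (α : ℝ) (p q : ℕ) (z : GVec p q) (X Y Z : GVec p q) : GVec p q :=
  covDeriv α p q (fun w => gammaMap α p q w.1 Y Z) z X
    - covDeriv α p q (fun w => gammaMap α p q w.1 X Z) z Y

/-- Riemann curvature tensor `R(U,V,X,Y) = g(U, R(X,Y)V)`. -/
def riem (α : ℝ) (p q : ℕ) (z : GVec p q) (U V X Y : GVec p q) : ℝ :=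
  gMet α p q z.1 U (curvOp α p q z X Y V)

/-- Ricci tensor `Ric(X,Y) = trace (V ↦ R(V,Y)X)`. -/
def ricci (α : ℝ) (p q : ℕ) (z : GVec p q) (X Y : GVec p q) : ℝ :=
  (∑ i : Fin p, (curvOp α p q z (EuclideanSpace.single i 1, 0) Y X).1 i)
    + ∑ l : Fin q, (curvOp α p q z (0, EuclideanSpace.single l 1) Y X).2 l

/-- Scalar curvature: the `g`-trace of the Ricci tensor. -/
def scal (α : ℝ) (p q : ℕ) (z : GVec p q) : ℝ :=
  ((α + 1) ^ 2 * ‖z.1‖ ^ (2 * α))⁻¹ *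
      (∑ i : Fin p, ricci α p q z (EuclideanSpace.single i 1, 0) (EuclideanSpace.single i 1, 0))
    + ∑ l : Fin q, ricci α p q z (0, EuclideanSpace.single l 1) (0, EuclideanSpace.single l 1)

/-- The Weyl tensor
`W = R + (1/(n−2)) Ric ⊙ g − (Scal/(2(n−1)(n−2))) g ⊙ g`, where
`(h ⊙ s)(X₁,X₂,X₃,X₄) = h(X₁,X₄)s(X₂,X₃) + h(X₂,X₃)s(X₁,X₄) − h(X₁,X₃)s(X₂,X₄) − h(X₂,X₄)s(X₁,X₃)`
and `n = p + q`. -/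
def weyl (α : ℝ) (p q : ℕ) (z : GVec p q) (X₁ X₂ X₃ X₄ : GVec p q) : ℝ :=
  riem α p q z X₁ X₂ X₃ X₄
    + ((p + q : ℝ) - 2)⁻¹ *
        (ricci α p q z X₁ X₄ * gMet α p q z.1 X₂ X₃ + ricci α p q z X₂ X₃ * gMet α p q z.1 X₁ X₄
          - ricci α p q z X₁ X₃ * gMet α p q z.1 X₂ X₄
          - ricci α p q z X₂ X₄ * gMet α p q z.1 X₁ X₃)
    - scal α p q z / (2 * ((p + q : ℝ) - 1) * ((p + q : ℝ) - 2)) *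
        (gMet α p q z.1 X₁ X₄ * gMet α p q z.1 X₂ X₃ + gMet α p q z.1 X₂ X₃ * gMet α p q z.1 X₁ X₄
          - gMet α p q z.1 X₁ X₃ * gMet α p q z.1 X₂ X₄
          - gMet α p q z.1 X₂ X₄ * gMet α p q z.1 X₁ X₃)

/-- Vertical subspace `T_z S = {(v,0) : ⟨v,x⟩ = 0}`. -/
def TSp (p q : ℕ) (z : GVec p q) : Set (GVec p q) := {U | U.2 = 0 ∧ ⟪U.1, z.1⟫ = 0}

/-- Horizontal subspace `T_z H = {(t x, w) : t ∈ ℝ, w ∈ ℝ^q}`. -/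
def THp (p q : ℕ) (z : GVec p q) : Set (GVec p q) := {U | ∃ t : ℝ, U.1 = t • z.1}

/-- `g`-orthogonal projection of `U` onto the vertical subspace `T_z S`. -/
def projS (p q : ℕ) (z : GVec p q) (U : GVec p q) : GVec p q :=
  (U.1 - (⟪U.1, z.1⟫ / ‖z.1‖ ^ 2) • z.1, 0)

/-- Control (Carnot–Carathéodory) distance of the Grushin vector fields
`X_j = ∂_{x_j}`, `Y_λ = (α+1)|x|^α ∂_{y_λ}`: the infimum of `∫₀ᵀ √(|a|²+|b|²)` over absolutely
continuous admissible paths `γ̇ = Σ aⱼ Xⱼ(γ) + Σ b_λ Y_λ(γ)` joining the two points. -/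
def grushinDist (α : ℝ) (p q : ℕ) (z z' : GVec p q) : ℝ :=
  sInf { L : ℝ |
    ∃ (T : ℝ) (γ : ℝ → GVec p q) (a : ℝ → EuclideanSpace ℝ (Fin p))
      (b : ℝ → EuclideanSpace ℝ (Fin q)),
      0 ≤ T ∧ γ 0 = z ∧ γ T = z' ∧
      (∀ t ∈ Set.Icc (0:ℝ) T,
        γ t = (z.1 + ∫ s in (0:ℝ)..t, a s,
               z.2 + ∫ s in (0:ℝ)..t, ((α + 1) * ‖(γ s).1‖ ^ α) • b s)) ∧
      L = ∫ t in (0:ℝ)..T, Real.sqrt (‖a t‖ ^ 2 + ‖b t‖ ^ 2) }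

section SecondDerivative

variable {V E : Type*} [NormedAddCommGroup V] [NormedSpace ℝ V] [NormedAddCommGroup E]
  [NormedSpace ℝ E]

/-- The second derivative of `Φ` at `z` in the directions `U`, `W`. -/
def secondDeriv (Φ : V → E) (z U W : V) : E :=
  fderiv ℝ (fun w => fderiv ℝ Φ w W) z U

theorem ContDiffAt.fderiv_apply_const {Φ : V → E} {z : V} {m n : WithTop ℕ∞}
    (h : ContDiffAt ℝ n Φ z) (hmn : m + 1 ≤ n) (W : V) :
    ContDiffAt ℝ m (fun w => fderiv ℝ Φ w W) z :=
  (h.fderiv_right hmn).clm_apply contDiffAt_const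

theorem secondDeriv_eq_fderiv_fderiv {Φ : V → E} {z : V} (h : ContDiffAt ℝ 2 Φ z) (U W : V) :
    secondDeriv Φ z U W = fderiv ℝ (fderiv ℝ Φ) z U W := by
  have h1 : DifferentiableAt ℝ (fderiv ℝ Φ) z :=
    (h.fderiv_right (m := 1) (by norm_num)).differentiableAt (by norm_num)
  unfold secondDeriv
  rw [fderiv_clm_apply h1 (differentiableAt_const W)]
  simp

theorem secondDeriv_comm {Φ : V → E} {z : V} (h : ContDiffAt ℝ 2 Φ z) (U W : V) :
    secondDeriv Φ z U W = secondDeriv Φ z W U := by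
  rw [secondDeriv_eq_fderiv_fderiv h, secondDeriv_eq_fderiv_fderiv h]
  exact (h.isSymmSndFDerivAt (by simp)) U W

theorem secondDeriv_clm {F : Type*} [NormedAddCommGroup F] [NormedSpace ℝ F] {Φ : V → E} {z : V}
    (L : E →L[ℝ] F) (h : ContDiffAt ℝ 2 Φ z) (U W : V) :
    secondDeriv (fun w => L (Φ w)) z U W = L (secondDeriv Φ z U W) := by
  unfold secondDeriv
  have h1 : (fun w => fderiv ℝ (fun w => L (Φ w)) w W) =ᶠ[nhds z]
      fun w => L (fderiv ℝ Φ w W) := by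
    filter_upwards [h.eventually (by simp)] with w hw
    have := (L.hasFDerivAt.comp w (hw.differentiableAt (by norm_num)).hasFDerivAt).fderiv
    simp only [Function.comp_def] at this
    rw [this]; rfl
  rw [h1.fderiv_eq]
  have h2 : DifferentiableAt ℝ (fun w => fderiv ℝ Φ w W) z :=
    (h.fderiv_apply_const (m := 1) (by norm_num) W).differentiableAt (by norm_num)
  have := (L.hasFDerivAt.comp z h2.hasFDerivAt).fderiv
  simp only [Function.comp_def] at this
  rw [this]; rfl

theorem fderiv_bilin_apply (B : E →L[ℝ] E →L[ℝ] ℝ) {f g : V → E} {z : V}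
    (hf : DifferentiableAt ℝ f z) (hg : DifferentiableAt ℝ g z) (U : V) :
    fderiv ℝ (fun w => B (f w) (g w)) z U = B (fderiv ℝ f z U) (g z) + B (f z) (fderiv ℝ g z U) := by
  have h := (B.hasFDerivAt_of_bilinear hf.hasFDerivAt hg.hasFDerivAt).fderiv
  rw [h]
  simp [add_comm]

/-- Koszul's formula for the metric induced by a map into a pseudo-Euclidean space. -/
theorem two_mul_bilin_secondDeriv (B : E →L[ℝ] E →L[ℝ] ℝ) (hB : ∀ a b, B a b = B b a)
    {Φ : V → E} {z : V} (h : ContDiffAt ℝ 2 Φ z) (U W T : V) :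
    2 * B (secondDeriv Φ z U W) (fderiv ℝ Φ z T) =
      fderiv ℝ (fun w => B (fderiv ℝ Φ w W) (fderiv ℝ Φ w T)) z U
      + fderiv ℝ (fun w => B (fderiv ℝ Φ w U) (fderiv ℝ Φ w T)) z W
      - fderiv ℝ (fun w => B (fderiv ℝ Φ w U) (fderiv ℝ Φ w W)) z T := by
  have hd : ∀ W : V, DifferentiableAt ℝ (fun w => fderiv ℝ Φ w W) z := fun W =>
    (h.fderiv_apply_const (m := 1) (by norm_num) W).differentiableAt (by norm_num)
  rw [fderiv_bilin_apply B (hd _) (hd _), fderiv_bilin_apply B (hd _) (hd _),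
    fderiv_bilin_apply B (hd _) (hd _)]
  change _ = B (secondDeriv Φ z U W) _ + B _ (secondDeriv Φ z U T)
    + (B (secondDeriv Φ z W U) _ + B _ (secondDeriv Φ z W T))
    - (B (secondDeriv Φ z T U) _ + B _ (secondDeriv Φ z T W))
  rw [secondDeriv_comm h W U, secondDeriv_comm h T U, secondDeriv_comm h T W,
    hB (fderiv ℝ Φ z W), hB (fderiv ℝ Φ z U) (secondDeriv Φ z W T)]
  ring

theorem ContDiffAt.secondDeriv_apply {Φ : V → E} {z : V} (h : ContDiffAt ℝ 3 Φ z) (U W : V) :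
    ContDiffAt ℝ 1 (fun w => secondDeriv Φ w U W) z :=
  (h.fderiv_apply_const (m := 2) (by norm_num) W).fderiv_apply_const (m := 1) (by norm_num) U

/-- Gauss' equation for a map into a pseudo-Euclidean space. -/
theorem bilin_secondDeriv_sub (B : E →L[ℝ] E →L[ℝ] ℝ)
    {Φ : V → E} {z : V} (h : ContDiffAt ℝ 3 Φ z) (X Y Z W : V) :
    B (secondDeriv Φ z X Z) (secondDeriv Φ z Y W) - B (secondDeriv Φ z Y Z) (secondDeriv Φ z X W) =
      fderiv ℝ (fun w => B (secondDeriv Φ w X Z) (fderiv ℝ Φ w W)) z Y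
      - fderiv ℝ (fun w => B (secondDeriv Φ w Y Z) (fderiv ℝ Φ w W)) z X := by
  have hd : ∀ W : V, DifferentiableAt ℝ (fun w => fderiv ℝ Φ w W) z := fun W =>
    (h.fderiv_apply_const (m := 1) (by norm_num) W).differentiableAt (by norm_num)
  have hd2 : ∀ U W : V, DifferentiableAt ℝ (fun w => secondDeriv Φ w U W) z := fun U W =>
    (h.secondDeriv_apply U W).differentiableAt (by norm_num)
  rw [fderiv_bilin_apply B (hd2 _ _) (hd _), fderiv_bilin_apply B (hd2 _ _) (hd _)]
  have := secondDeriv_comm (h.fderiv_apply_const (m := 2) (by norm_num) Z) X Y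
  change _ = B (secondDeriv (fun w => fderiv ℝ Φ w Z) z Y X) _ + B _ (secondDeriv Φ z Y W)
    - (B (secondDeriv (fun w => fderiv ℝ Φ w Z) z X Y) _ + B _ (secondDeriv Φ z X W))
  rw [this]
  ring

end SecondDerivative

section Isometric

variable {V E E' : Type*} [NormedAddCommGroup V] [NormedSpace ℝ V] [NormedAddCommGroup E]
  [NormedSpace ℝ E] [NormedAddCommGroup E'] [NormedSpace ℝ E']

variable (B : E →L[ℝ] E →L[ℝ] ℝ) (B' : E' →L[ℝ] E' →L[ℝ] ℝ)

theorem bilin_secondDeriv_eq_of_isometric (hB : ∀ a b, B a b = B b a)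
    (hB' : ∀ a b, B' a b = B' b a) {Ω : Set V} (hΩ : IsOpen Ω) {Φ : V → E} {Ψ : V → E'}
    (hΦ : ∀ z ∈ Ω, ContDiffAt ℝ 3 Φ z) (hΨ : ∀ z ∈ Ω, ContDiffAt ℝ 3 Ψ z)
    (hiso : ∀ z ∈ Ω, ∀ U W, B (fderiv ℝ Φ z U) (fderiv ℝ Φ z W)
      = B' (fderiv ℝ Ψ z U) (fderiv ℝ Ψ z W)) {z : V} (hz : z ∈ Ω) (U W T : V) :
    B (secondDeriv Φ z U W) (fderiv ℝ Φ z T) = B' (secondDeriv Ψ z U W) (fderiv ℝ Ψ z T) := by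
  have key : ∀ U W : V, (fun w => B (fderiv ℝ Φ w U) (fderiv ℝ Φ w W)) =ᶠ[nhds z]
      fun w => B' (fderiv ℝ Ψ w U) (fderiv ℝ Ψ w W) := fun U W => by
    filter_upwards [hΩ.mem_nhds hz] with w hw using hiso w hw U W
  have h1 := two_mul_bilin_secondDeriv B hB ((hΦ z hz).of_le (by norm_num)) U W T
  have h2 := two_mul_bilin_secondDeriv B' hB' ((hΨ z hz).of_le (by norm_num)) U W T
  rw [(key _ _).fderiv_eq, (key _ _).fderiv_eq, (key _ _).fderiv_eq, ← h2] at h1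
  linarith

theorem bilin_secondDeriv_sub_eq_of_isometric (hB : ∀ a b, B a b = B b a)
    (hB' : ∀ a b, B' a b = B' b a) {Ω : Set V} (hΩ : IsOpen Ω) {Φ : V → E} {Ψ : V → E'}
    (hΦ : ∀ z ∈ Ω, ContDiffAt ℝ 3 Φ z) (hΨ : ∀ z ∈ Ω, ContDiffAt ℝ 3 Ψ z)
    (hiso : ∀ z ∈ Ω, ∀ U W, B (fderiv ℝ Φ z U) (fderiv ℝ Φ z W)
      = B' (fderiv ℝ Ψ z U) (fderiv ℝ Ψ z W)) {z : V} (hz : z ∈ Ω) (X Y Z W : V) :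
    B (secondDeriv Φ z X Z) (secondDeriv Φ z Y W) - B (secondDeriv Φ z Y Z) (secondDeriv Φ z X W) =
    B' (secondDeriv Ψ z X Z) (secondDeriv Ψ z Y W)
      - B' (secondDeriv Ψ z Y Z) (secondDeriv Ψ z X W) := by
  have key : ∀ U W T : V, (fun w => B (secondDeriv Φ w U W) (fderiv ℝ Φ w T)) =ᶠ[nhds z]
      fun w => B' (secondDeriv Ψ w U W) (fderiv ℝ Ψ w T) := fun U W T => by
    filter_upwards [hΩ.mem_nhds hz] with w hw using
      bilin_secondDeriv_eq_of_isometric B B' hB hB' hΩ hΦ hΨ hiso hw U W T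
  rw [bilin_secondDeriv_sub B (hΦ z hz), bilin_secondDeriv_sub B' (hΨ z hz),
    (key _ _ _).fderiv_eq, (key _ _ _).fderiv_eq]

/-- Gauss' equation for the second fundamental forms of two isometric maps. -/
theorem gauss_of_isometric (hB : ∀ a b, B a b = B b a)
    (hB' : ∀ a b, B' a b = B' b a) {Ω : Set V} (hΩ : IsOpen Ω) {Φ : V → E} {Ψ : V → E'}
    (hΦ : ∀ z ∈ Ω, ContDiffAt ℝ 3 Φ z) (hΨ : ∀ z ∈ Ω, ContDiffAt ℝ 3 Ψ z)
    (hiso : ∀ z ∈ Ω, ∀ U W, B (fderiv ℝ Φ z U) (fderiv ℝ Φ z W)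
      = B' (fderiv ℝ Ψ z U) (fderiv ℝ Ψ z W)) {z : V} (hz : z ∈ Ω)
    (G : V → V → V) (hG : ∀ U W T, B' (fderiv ℝ Ψ z (G U W)) (fderiv ℝ Ψ z T)
      = B' (secondDeriv Ψ z U W) (fderiv ℝ Ψ z T)) :
    (∀ U W T, B (secondDeriv Φ z U W - fderiv ℝ Φ z (G U W)) (fderiv ℝ Φ z T) = 0) ∧
    (∀ U W T, B' (secondDeriv Ψ z U W - fderiv ℝ Ψ z (G U W)) (fderiv ℝ Ψ z T) = 0) ∧
    ∀ X Y Z W, B (secondDeriv Φ z X Z - fderiv ℝ Φ z (G X Z))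
        (secondDeriv Φ z Y W - fderiv ℝ Φ z (G Y W))
      - B (secondDeriv Φ z Y Z - fderiv ℝ Φ z (G Y Z))
        (secondDeriv Φ z X W - fderiv ℝ Φ z (G X W)) =
      B' (secondDeriv Ψ z X Z - fderiv ℝ Ψ z (G X Z))
        (secondDeriv Ψ z Y W - fderiv ℝ Ψ z (G Y W))
      - B' (secondDeriv Ψ z Y Z - fderiv ℝ Ψ z (G Y Z))
        (secondDeriv Ψ z X W - fderiv ℝ Ψ z (G X W)) := by
  have ha := fun U W T =>
    bilin_secondDeriv_eq_of_isometric B B' hB hB' hΩ hΦ hΨ hiso hz U W T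
  have hn : ∀ U W T, B (secondDeriv Φ z U W - fderiv ℝ Φ z (G U W)) (fderiv ℝ Φ z T) = 0 := by
    intro U W T
    rw [map_sub, sub_apply, ha, hiso z hz, hG, sub_self]
  have hn' : ∀ U W T, B' (secondDeriv Ψ z U W - fderiv ℝ Ψ z (G U W)) (fderiv ℝ Ψ z T) = 0 := by
    intro U W T
    rw [map_sub, sub_apply, hG, sub_self]
  refine ⟨hn, hn', fun X Y Z W => ?_⟩
  have hb := bilin_secondDeriv_sub_eq_of_isometric B B' hB hB' hΩ hΦ hΨ hiso hz X Y Z W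
  have e : ∀ U W T R, B (secondDeriv Φ z U W - fderiv ℝ Φ z (G U W))
      (secondDeriv Φ z T R - fderiv ℝ Φ z (G T R)) = B (secondDeriv Φ z U W) (secondDeriv Φ z T R)
        - B' (fderiv ℝ Ψ z (G U W)) (fderiv ℝ Ψ z (G T R)) := by
    intro U W T R
    rw [map_sub (B _), hn, sub_zero, map_sub, sub_apply,
      hB (fderiv ℝ Φ z (G U W)), ha, ← hG, hB' (fderiv ℝ Ψ z (G T R))]
  have e' : ∀ U W T R, B' (secondDeriv Ψ z U W - fderiv ℝ Ψ z (G U W))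
      (secondDeriv Ψ z T R - fderiv ℝ Ψ z (G T R)) = B' (secondDeriv Ψ z U W) (secondDeriv Ψ z T R)
        - B' (fderiv ℝ Ψ z (G U W)) (fderiv ℝ Ψ z (G T R)) := by
    intro U W T R
    rw [map_sub (B' _), hn', sub_zero, map_sub, sub_apply,
      hB' (fderiv ℝ Ψ z (G U W)), hB' (fderiv ℝ Ψ z (G U W)), hG]
  rw [e, e, e', e']
  linarith

end Isometric

/-- Two maps satisfying the same linear second order system differ by a constant linear map. -/
theorem exists_linear_of_secondDeriv_eq {V E : Type*} [NormedAddCommGroup V] [NormedSpace ℝ V]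
    [NormedAddCommGroup E] [NormedSpace ℝ E] (B : E →L[ℝ] E →L[ℝ] ℝ) (hB : ∀ a b, B a b = B b a)
    {Ω : Set V} (hΩ : IsOpen Ω) (hc : IsConnected Ω) {X F : V → E}
    (hX : ∀ z ∈ Ω, ContDiffAt ℝ 3 X z) (hF : ∀ z ∈ Ω, ContDiffAt ℝ 3 F z)
    (ε : ℝ) (hε : ε * ε = 1) (hXX : ∀ z ∈ Ω, B (X z) (X z) = ε) (hFF : ∀ z ∈ Ω, B (F z) (F z) = ε)
    (hiso : ∀ z ∈ Ω, ∀ U W, B (fderiv ℝ F z U) (fderiv ℝ F z W)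
      = B (fderiv ℝ X z U) (fderiv ℝ X z W))
    (hker : ∀ z ∈ Ω, ∀ U, fderiv ℝ X z U = 0 → fderiv ℝ F z U = 0)
    (J : V → E →ₗ[ℝ] V) (hJd : ∀ w, ∀ z ∈ Ω, DifferentiableAt ℝ (fun z => J z w) z)
    (hJ : ∀ z ∈ Ω, ∀ w, fderiv ℝ X z (J z w) = w - (ε * B w (X z)) • X z)
    (G : V → V → V → V) (κ : V → V → V → ℝ)
    (hXd : ∀ z ∈ Ω, ∀ U W, secondDeriv X z U W = fderiv ℝ X z (G z U W) + κ z U W • X z)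
    (hFd : ∀ z ∈ Ω, ∀ U W, secondDeriv F z U W = fderiv ℝ F z (G z U W) + κ z U W • F z) :
    ∃ M : E →ₗ[ℝ] E, (∀ w w', B (M w) (M w') = B w w') ∧ ∀ z ∈ Ω, F z = M (X z) := by
  have horth : ∀ Y : V → E, (∀ z ∈ Ω, ContDiffAt ℝ 3 Y z) → (∀ z ∈ Ω, B (Y z) (Y z) = ε) →
      ∀ z ∈ Ω, ∀ U, B (Y z) (fderiv ℝ Y z U) = 0 := by
    intro Y hY hYY z hz U
    have hd := (hY z hz).differentiableAt (by norm_num)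
    have h1 := fderiv_bilin_apply B hd hd U
    have h2 : (fun w => B (Y w) (Y w)) =ᶠ[nhds z] fun _ => ε := by
      filter_upwards [hΩ.mem_nhds hz] with w hw using hYY w hw
    rw [h2.fderiv_eq, hB (fderiv ℝ Y z U)] at h1
    simp at h1
    linarith
  let N : V → E → E := fun z w => (ε * B w (X z)) • F z + fderiv ℝ F z (J z w)
  have hε0 : ε ≠ 0 := by rintro rfl; simp at hε
  have hconst : ∀ w, ∃ a, ∀ z ∈ Ω, N z w = a := by
    intro w
    have hdX := fun z hz => (hX z hz).differentiableAt (n := 3) (by norm_num)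
    have hdF := fun z hz => (hF z hz).differentiableAt (n := 3) (by norm_num)
    have hd1 : ∀ Y : V → E, (∀ z ∈ Ω, ContDiffAt ℝ 3 Y z) → ∀ z ∈ Ω,
        HasFDerivAt (fun z => (ε * B w (X z)) • Y z + fderiv ℝ Y z (J z w))
          ((ε * B w (X z)) • fderiv ℝ Y z + (ε • (B w).comp (fderiv ℝ X z)).smulRight (Y z)
          + ((fderiv ℝ Y z).comp (fderiv ℝ (fun z => J z w) z)
            + (fderiv ℝ (fderiv ℝ Y) z).flip (J z w))) z := by
      intro Y hY z hz
      have a1 : HasFDerivAt (fun z => ε * B w (X z)) (ε • (B w).comp (fderiv ℝ X z)) z :=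
        ((B w).hasFDerivAt.comp z (hdX z hz).hasFDerivAt).const_mul ε
      have a2 := a1.smul ((hY z hz).differentiableAt (by norm_num)).hasFDerivAt
      have a3 : DifferentiableAt ℝ (fderiv ℝ Y) z :=
        ((hY z hz).fderiv_right (m := 1) (by norm_num)).differentiableAt (by norm_num)
      exact a2.add (a3.hasFDerivAt.clm_apply (hJd w z hz).hasFDerivAt)
    have hzero : ∀ z ∈ Ω, fderiv ℝ (fun z => N z w) z = 0 := by
      intro z hz
      ext U
      have hN := (hd1 F hF z hz).fderiv
      have hX0 := (hd1 X hX z hz).fderiv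
      have hc0 : (fun z => (ε * B w (X z)) • X z + fderiv ℝ X z (J z w)) =ᶠ[nhds z]
          fun _ => w := by
        filter_upwards [hΩ.mem_nhds hz] with y hy
        rw [hJ y hy]; abel
      rw [hc0.fderiv_eq] at hX0
      have h0 := congrArg (fun L : V →L[ℝ] E => L U) hX0
      change _ = (0 : E)
      rw [show (fun z => N z w) = fun z => (ε * B w (X z)) • F z + fderiv ℝ F z (J z w) from rfl,
        hN]
      simp only [Pi.zero_apply, zero_apply,
        add_apply, smul_apply,
        ContinuousLinearMap.comp_apply, ContinuousLinearMap.smulRight_apply,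
        ContinuousLinearMap.flip_apply, fderiv_fun_const] at h0 ⊢
      rw [← secondDeriv_eq_fderiv_fderiv ((hX z hz).of_le (by norm_num)), hXd z hz] at h0
      rw [← secondDeriv_eq_fderiv_fderiv ((hF z hz).of_le (by norm_num)), hFd z hz]
      set D := fderiv ℝ (fun z => J z w) z U
      have h0' : 0 = ((ε • B w (fderiv ℝ X z U)) + κ z U (J z w)) • X z
          + fderiv ℝ X z ((ε * B w (X z)) • U + D + G z U (J z w)) := by
        rw [h0]; simp only [map_add, map_smul, add_smul]; abel
      have h1 := congrArg (B (X z)) h0'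
      simp only [map_zero, map_add (B (X z)), map_smul (B (X z)), hXX z hz, horth X hX hXX z hz, smul_eq_mul,
        add_zero] at h1
      have h2 : ε • B w (fderiv ℝ X z U) + κ z U (J z w) = 0 := by
        rcases mul_eq_zero.1 h1.symm with h | h
        · simpa using h
        · exact absurd h hε0
      rw [h2, zero_smul, zero_add] at h0'
      have h3 := hker z hz _ h0'.symm
      have h4 : (ε * B w (X z)) • (fderiv ℝ F z) U + (ε • B w ((fderiv ℝ X z) U)) • F z +
          ((fderiv ℝ F z) D + ((fderiv ℝ F z) (G z U ((J z) w)) + κ z U ((J z) w) • F z)) =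
          ((ε • B w (fderiv ℝ X z U)) + κ z U (J z w)) • F z
          + fderiv ℝ F z ((ε * B w (X z)) • U + D + G z U (J z w)) := by
        simp only [map_add, map_smul, add_smul]; abel
      rw [h4, h2, h3]; simp
    have hdiff : DifferentiableOn ℝ (fun z => N z w) Ω := fun z hz =>
      (hd1 F hF z hz).differentiableAt.differentiableWithinAt
    exact hΩ.exists_is_const_of_fderiv_eq_zero hc.isPreconnected hdiff hzero
  obtain ⟨z₀, hz₀⟩ := hc.nonempty
  have hN : ∀ z ∈ Ω, ∀ w, N z w = N z₀ w := by
    intro z hz w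
    obtain ⟨a, ha⟩ := hconst w
    rw [ha z hz, ha z₀ hz₀]
  refine ⟨⟨⟨N z₀, ?_⟩, ?_⟩, ?_, ?_⟩
  · intro w w'
    simp only [N, map_add, add_apply, mul_add, add_smul]
    abel
  · intro a w
    simp only [N, map_smul, smul_apply, smul_eq_mul, RingHom.id_apply,
      smul_add, smul_smul]
    congr 2
    ring
  · intro w w'
    change B (N z₀ w) (N z₀ w') = _
    simp only [N, map_add, map_smul, add_apply, smul_apply,
      hFF z₀ hz₀, horth F hF hFF z₀ hz₀, hB _ (F z₀), hiso z₀ hz₀, hJ z₀ hz₀, map_sub,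
      sub_apply, hB _ (X z₀), hXX z₀ hz₀, smul_eq_mul]
    linear_combination (2 * ε * B (X z₀) w * B (X z₀) w') * hε
  · intro z hz
    change F z = N z₀ (X z)
    rw [← hN z hz]
    have : fderiv ℝ X z (J z (X z)) = 0 := by
      rw [hJ z hz, hXX z hz, hε, one_smul, sub_self]
    simp only [N, hXX z hz, hε, one_smul, hker z hz _ this, add_zero]

section Embeddings

/-- The space `ℝ^q × ℝ × ℝ` carrying the Lorentzian form `lorentzForm`. -/
abbrev LVec (q : ℕ) := EuclideanSpace ℝ (Fin q) × ℝ × ℝ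

/-- The Lorentzian form `⟨v, v'⟩ - (a b' + b a') / 2` on triples `(v, a, b)`. -/
def lorentzForm (q : ℕ) : LVec q →L[ℝ] LVec q →L[ℝ] ℝ :=
  let π₁ := ContinuousLinearMap.fst ℝ (EuclideanSpace ℝ (Fin q)) (ℝ × ℝ)
  let π₂ := (ContinuousLinearMap.fst ℝ ℝ ℝ).comp
    (ContinuousLinearMap.snd ℝ (EuclideanSpace ℝ (Fin q)) (ℝ × ℝ))
  let π₃ := (ContinuousLinearMap.snd ℝ ℝ ℝ).comp
    (ContinuousLinearMap.snd ℝ (EuclideanSpace ℝ (Fin q)) (ℝ × ℝ))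
  (innerSL ℝ).bilinearComp π₁ π₁ - (1 / 2 : ℝ) • ((innerSL ℝ).bilinearComp π₂ π₃
    + (innerSL ℝ).bilinearComp π₃ π₂)

theorem lorentzForm_apply {q : ℕ} (v w : LVec q) :
    lorentzForm q v w = ⟪v.1, w.1⟫ - (v.2.1 * w.2.2 + v.2.2 * w.2.1) / 2 := by
  simp [lorentzForm]
  ring

theorem lorentzForm_comm {q : ℕ} (v w : LVec q) : lorentzForm q v w = lorentzForm q w v := by
  rw [lorentzForm_apply, lorentzForm_apply, real_inner_comm]; ring

theorem eq_zero_of_lorentzForm_eq_zero {q : ℕ} {v : LVec q} (h : ∀ w, lorentzForm q v w = 0) :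
    v = 0 := by
  have h1 := h (v.1, 0, 0)
  have h2 := h (0, 1, 0)
  have h3 := h (0, 0, 1)
  simp [lorentzForm_apply] at h1 h2 h3
  ext1
  · exact h1
  · ext1
    · exact h3
    · exact h2

/-- The ambient pseudo-Euclidean space `ℝ^p × (ℝ^q × ℝ × ℝ) × ℝ`. -/
abbrev AVec (p q : ℕ) := EuclideanSpace ℝ (Fin p) × LVec q × ℝ

/-- The form `⟨v, v'⟩ + lorentzForm q w w' - s s'` on triples `(v, w, s)`. -/
def ambientForm (p q : ℕ) : AVec p q →L[ℝ] AVec p q →L[ℝ] ℝ :=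
  let π₁ := ContinuousLinearMap.fst ℝ (EuclideanSpace ℝ (Fin p)) (LVec q × ℝ)
  let π₂ := (ContinuousLinearMap.fst ℝ (LVec q) ℝ).comp
    (ContinuousLinearMap.snd ℝ (EuclideanSpace ℝ (Fin p)) (LVec q × ℝ))
  let π₃ := (ContinuousLinearMap.snd ℝ (LVec q) ℝ).comp
    (ContinuousLinearMap.snd ℝ (EuclideanSpace ℝ (Fin p)) (LVec q × ℝ))
  let b : AVec p q →L[ℝ] AVec p q →L[ℝ] ℝ := (innerSL ℝ).bilinearComp π₁ π₁
  let b' : AVec p q →L[ℝ] AVec p q →L[ℝ] ℝ := (innerSL ℝ).bilinearComp π₃ π₃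
  b + (lorentzForm q).bilinearComp π₂ π₂ - b'

theorem ambientForm_apply {p q : ℕ} (v w : AVec p q) :
    ambientForm p q v w = ⟪v.1, w.1⟫ + lorentzForm q v.2.1 w.2.1 - v.2.2 * w.2.2 := by
  change ⟪v.1, w.1⟫ + lorentzForm q v.2.1 w.2.1 - ⟪v.2.2, w.2.2⟫ = _
  rw [real_inner_eq_re_inner ℝ v.2.2]
  simp [mul_comm]

theorem ambientForm_comm {p q : ℕ} (v w : AVec p q) :
    ambientForm p q v w = ambientForm p q w v := by
  rw [ambientForm_apply, ambientForm_apply, real_inner_comm, lorentzForm_comm]; ring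

/-- The component `x / |x|` of the map of `M₀` to sphere times hyperbolic space. -/
def sphPart {p q : ℕ} (z : GVec p q) : EuclideanSpace ℝ (Fin p) := ‖z.1‖⁻¹ • z.1

/-- The component of `M₀` in the hyperboloid, with upper half space coordinates `(|x|^β, y)`. -/
def hypPart (β : ℝ) {p q : ℕ} (z : GVec p q) : LVec q :=
  ((‖z.1‖ ^ β)⁻¹ • z.2, (‖z.1‖ ^ β)⁻¹, ‖z.1‖ ^ β + (‖z.1‖ ^ β)⁻¹ * ‖z.2‖ ^ 2)

variable {p q : ℕ} {β : ℝ} {z : GVec p q}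

theorem norm_fst_pos (hz : z ∈ GM0 p q) : 0 < ‖z.1‖ := norm_pos_iff.2 hz

theorem contDiffAt_sphPart {n : WithTop ℕ∞} (hz : z ∈ GM0 p q) :
    ContDiffAt ℝ n (sphPart (p := p) (q := q)) z := by
  have h1 : ContDiffAt ℝ n (fun z : GVec p q => ‖z.1‖) z := contDiffAt_fst.norm ℝ hz
  exact (h1.inv (norm_fst_pos hz).ne').smul contDiffAt_fst

theorem contDiffAt_hypPart {n : WithTop ℕ∞} (hz : z ∈ GM0 p q) :
    ContDiffAt ℝ n (hypPart β (p := p) (q := q)) z := by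
  have h1 : ContDiffAt ℝ n (fun z : GVec p q => ‖z.1‖) z := contDiffAt_fst.norm ℝ hz
  have h2 : ContDiffAt ℝ n (fun z : GVec p q => ‖z.1‖ ^ β) z :=
    h1.rpow_const_of_ne (norm_fst_pos hz).ne'
  have h3 := h2.inv (Real.rpow_pos_of_pos (norm_fst_pos hz) β).ne'
  have h4 : ContDiffAt ℝ n (fun z : GVec p q => ‖z.2‖ ^ 2) z := contDiffAt_snd.norm_sq ℝ
  exact (h3.smul contDiffAt_snd).prodMk (h3.prodMk (h2.add (h3.mul h4)))

theorem fderiv_norm_fst (hz : z ∈ GM0 p q) (U : GVec p q) :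
    fderiv ℝ (fun z : GVec p q => ‖z.1‖) z U = ‖z.1‖⁻¹ * ⟪z.1, U.1⟫ := by
  have h0 := norm_fst_pos hz
  have h1 : DifferentiableAt ℝ (fun z : GVec p q => ‖z.1‖) z :=
    (contDiffAt_fst.norm ℝ hz (n := 1)).differentiableAt (by norm_num)
  have h2 : HasFDerivAt (fun z : GVec p q => ‖z.1‖ ^ 2) _ z := hasFDerivAt_fst.norm_sq
  have h3 := h1.hasFDerivAt.pow 2
  have := congrArg (fun L : GVec p q →L[ℝ] ℝ => L U) (h2.unique h3)
  simp at this
  field_simp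
  linarith

theorem fderiv_sphPart (hz : z ∈ GM0 p q) (U : GVec p q) :
    fderiv ℝ sphPart z U = ‖z.1‖⁻¹ • (U.1 - (⟪z.1, U.1⟫ / ‖z.1‖ ^ 2) • z.1) := by
  have h0 := norm_fst_pos hz
  have h1 : DifferentiableAt ℝ (fun z : GVec p q => ‖z.1‖) z :=
    (contDiffAt_fst.norm ℝ hz (n := 1)).differentiableAt (by norm_num)
  have h2 := ((hasDerivAt_inv h0.ne').comp_hasFDerivAt z h1.hasFDerivAt).smul (hasFDerivAt_fst (𝕜 := ℝ) (p := z))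
  have h3 : HasFDerivAt (sphPart (p := p) (q := q)) _ z := h2
  rw [h3.fderiv]
  simp [fderiv_norm_fst hz, smul_smul, sub_eq_add_neg]
  congr 1
  field_simp

theorem fderiv_norm_fst_rpow (hz : z ∈ GM0 p q) (β : ℝ) (U : GVec p q) :
    fderiv ℝ (fun z : GVec p q => ‖z.1‖ ^ β) z U
      = ‖z.1‖ ^ β * (β * ⟪z.1, U.1⟫ / ‖z.1‖ ^ 2) := by
  have h0 := norm_fst_pos hz
  have h1 : DifferentiableAt ℝ (fun z : GVec p q => ‖z.1‖) z :=
    (contDiffAt_fst.norm ℝ hz (n := 1)).differentiableAt (by norm_num)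
  rw [(h1.hasFDerivAt.rpow_const (Or.inl h0.ne')).fderiv]
  simp [fderiv_norm_fst hz, Real.rpow_sub_one h0.ne']
  field_simp

theorem fderiv_hypPart (hz : z ∈ GM0 p q) (U : GVec p q) :
    fderiv ℝ (hypPart β) z U = ((‖z.1‖ ^ β)⁻¹ • (U.2 - (β * ⟪z.1, U.1⟫ / ‖z.1‖ ^ 2) • z.2),
      -((‖z.1‖ ^ β)⁻¹ * (β * ⟪z.1, U.1⟫ / ‖z.1‖ ^ 2)),
      ‖z.1‖ ^ β * (β * ⟪z.1, U.1⟫ / ‖z.1‖ ^ 2)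
        + (‖z.1‖ ^ β)⁻¹ * (2 * ⟪z.2, U.2⟫ - (β * ⟪z.1, U.1⟫ / ‖z.1‖ ^ 2) * ‖z.2‖ ^ 2)) := by
  have h0 := norm_fst_pos hz
  have hρ := Real.rpow_pos_of_pos h0 β
  have h1 : ContDiffAt ℝ 1 (fun z : GVec p q => ‖z.1‖) z := contDiffAt_fst.norm ℝ hz
  have h2 : HasFDerivAt (fun z : GVec p q => ‖z.1‖ ^ β) _ z :=
    ((h1.rpow_const_of_ne h0.ne').differentiableAt (by norm_num)).hasFDerivAt
  have h3 := (hasDerivAt_inv hρ.ne').comp_hasFDerivAt z h2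
  have h4 : HasFDerivAt (fun z : GVec p q => ‖z.2‖ ^ 2) _ z := hasFDerivAt_snd.norm_sq
  have h5 := (h3.smul (hasFDerivAt_snd (𝕜 := ℝ) (p := z))).prodMk (h3.prodMk (h2.add (h3.mul h4)))
  have h6 : HasFDerivAt (hypPart β (p := p) (q := q)) _ z := h5
  rw [h6.fderiv]
  simp [fderiv_norm_fst_rpow hz]
  refine ⟨?_, ?_, ?_⟩
  · rw [smul_sub, smul_smul, sub_eq_add_neg]
    congr 2
    congr 1
    field_simp
  · field_simp
  · field_simp
    ring

end Embeddings

section Metrics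

variable {p q : ℕ} {β : ℝ} {z : GVec p q}

/-- The product metric of the sphere of radius `β` and hyperbolic space, transported to `M₀`. -/
def prodMetric (β : ℝ) (z U W : GVec p q) : ℝ :=
  β ^ 2 / ‖z.1‖ ^ 2 * ⟪U.1, W.1⟫ + ((‖z.1‖ ^ β)⁻¹) ^ 2 * ⟪U.2, W.2⟫

/-- The spherical part of `prodMetric`. -/
def sphMetric (β : ℝ) (z U W : GVec p q) : ℝ :=
  β ^ 2 / ‖z.1‖ ^ 2 * (⟪U.1, W.1⟫ - ⟪z.1, U.1⟫ * ⟪z.1, W.1⟫ / ‖z.1‖ ^ 2)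

/-- The hyperbolic part of `prodMetric`. -/
def hypMetric (β : ℝ) (z U W : GVec p q) : ℝ :=
  (β * ⟪z.1, U.1⟫ / ‖z.1‖ ^ 2) * (β * ⟪z.1, W.1⟫ / ‖z.1‖ ^ 2)
    + ((‖z.1‖ ^ β)⁻¹) ^ 2 * ⟪U.2, W.2⟫

theorem sphMetric_add_hypMetric (hz : z ∈ GM0 p q) (U W : GVec p q) :
    sphMetric β z U W + hypMetric β z U W = prodMetric β z U W := by
  have h0 := norm_fst_pos hz
  simp only [sphMetric, hypMetric, prodMetric]
  field_simp
  ring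

theorem inner_sphPart_self (hz : z ∈ GM0 p q) : ⟪sphPart z, sphPart z⟫ = 1 := by
  have h0 := norm_fst_pos hz
  rw [sphPart, real_inner_smul_left, real_inner_smul_right, real_inner_self_eq_norm_sq]
  field_simp

theorem lorentzForm_hypPart_self (hz : z ∈ GM0 p q) :
    lorentzForm q (hypPart β z) (hypPart β z) = -1 := by
  have hρ := Real.rpow_pos_of_pos (norm_fst_pos hz) β
  rw [lorentzForm_apply]
  simp only [hypPart]
  rw [real_inner_smul_left, real_inner_smul_right, real_inner_self_eq_norm_sq]
  field_simp
  ring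

theorem sq_mul_inner_fderiv_sphPart (hz : z ∈ GM0 p q) (U W : GVec p q) :
    β ^ 2 * ⟪fderiv ℝ sphPart z U, fderiv ℝ sphPart z W⟫ = sphMetric β z U W := by
  have h0 := norm_fst_pos hz
  rw [fderiv_sphPart hz, fderiv_sphPart hz, sphMetric]
  simp only [real_inner_smul_left, real_inner_smul_right, inner_sub_left, inner_sub_right,
    real_inner_self_eq_norm_sq, real_inner_comm z.1]
  field_simp
  ring

theorem lorentzForm_fderiv_hypPart (hz : z ∈ GM0 p q) (U W : GVec p q) :
    lorentzForm q (fderiv ℝ (hypPart β) z U) (fderiv ℝ (hypPart β) z W) = hypMetric β z U W := by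
  have hρ := Real.rpow_pos_of_pos (norm_fst_pos hz) β
  rw [fderiv_hypPart hz, fderiv_hypPart hz, hypMetric, lorentzForm_apply]
  generalize β * ⟪z.1, U.1⟫ / ‖z.1‖ ^ 2 = s
  generalize β * ⟪z.1, W.1⟫ / ‖z.1‖ ^ 2 = t
  simp only [real_inner_smul_left, real_inner_smul_right, inner_sub_left, inner_sub_right,
    real_inner_self_eq_norm_sq, real_inner_comm z.2]
  field_simp
  ring

/-- Lift of a vector to a tangent vector annihilated by the derivative of `hypPart`. -/
def sphLift (z : GVec p q) : EuclideanSpace ℝ (Fin p) →ₗ[ℝ] GVec p q where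
  toFun w := (‖z.1‖ • w - (‖z.1‖⁻¹ * ⟪z.1, w⟫) • z.1, 0)
  map_add' v w := by
    ext1
    · simp only [inner_add_right, Prod.fst_add]; module
    · simp
  map_smul' t w := by
    ext1
    · simp only [inner_smul_right, Prod.smul_fst, RingHom.id_apply]; module
    · simp

theorem inner_fst_sphLift (hz : z ∈ GM0 p q) (w : EuclideanSpace ℝ (Fin p)) :
    ⟪z.1, (sphLift z w).1⟫ = 0 := by
  have h0 := norm_fst_pos hz
  simp only [sphLift, LinearMap.coe_mk, AddHom.coe_mk, inner_sub_right, real_inner_smul_right,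
    real_inner_self_eq_norm_sq]
  field_simp
  ring

theorem fderiv_sphPart_sphLift (hz : z ∈ GM0 p q) (w : EuclideanSpace ℝ (Fin p)) :
    fderiv ℝ sphPart z (sphLift z w) = w - ⟪w, sphPart z⟫ • sphPart z := by
  have h0 := norm_fst_pos hz
  rw [fderiv_sphPart hz, inner_fst_sphLift hz]
  simp only [sphLift, LinearMap.coe_mk, AddHom.coe_mk, sphPart, real_inner_smul_right,
    zero_div, zero_smul, sub_zero, smul_sub, smul_smul, real_inner_comm z.1]
  rw [inv_mul_cancel₀ h0.ne', one_smul]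
  congr 2
  ring

theorem fderiv_hypPart_sphLift (hz : z ∈ GM0 p q) (w : EuclideanSpace ℝ (Fin p)) :
    fderiv ℝ (hypPart β) z (sphLift z w) = 0 := by
  rw [fderiv_hypPart hz, inner_fst_sphLift hz]
  simp [sphLift]

theorem differentiableAt_sphLift (hz : z ∈ GM0 p q) (w : EuclideanSpace ℝ (Fin p)) :
    DifferentiableAt ℝ (fun z : GVec p q => sphLift z w) z := by
  have h1 : DifferentiableAt ℝ (fun z : GVec p q => ‖z.1‖) z :=
    (contDiffAt_fst.norm ℝ hz (n := 1)).differentiableAt (by norm_num)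
  have h2 : DifferentiableAt ℝ (fun z : GVec p q => ⟪z.1, w⟫) z :=
    differentiableAt_fst.inner ℝ (differentiableAt_const w)
  have h3 := h1.inv (norm_fst_pos hz).ne'
  exact ((h1.smul_const w).sub ((h3.mul h2).smul differentiableAt_fst)).prodMk
    (differentiableAt_const 0)

/-- Lift of a vector to a tangent vector annihilated by the derivative of `sphPart`. -/
def hypLift (β : ℝ) (z : GVec p q) : LVec q →ₗ[ℝ] GVec p q where
  toFun w := ((((w.2.2 * (‖z.1‖ ^ β)⁻¹ - w.2.1 * (‖z.1‖ ^ β - (‖z.1‖ ^ β)⁻¹ * ‖z.2‖ ^ 2)) / 2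
      - (‖z.1‖ ^ β)⁻¹ * ⟪z.2, w.1⟫) / β) • z.1, ‖z.1‖ ^ β • (w.1 - w.2.1 • z.2))
  map_add' v w := by
    ext1
    · simp only [inner_add_right, Prod.fst_add, Prod.snd_add]; module
    · simp only [Prod.fst_add, Prod.snd_add]; module
  map_smul' t w := by
    ext1
    · simp only [inner_smul_right, Prod.smul_fst, Prod.smul_snd, RingHom.id_apply, smul_eq_mul]
      module
    · simp only [Prod.smul_fst, Prod.smul_snd, RingHom.id_apply, smul_eq_mul]
      module

theorem fderiv_sphPart_hypLift (hz : z ∈ GM0 p q) (w : LVec q) :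
    fderiv ℝ sphPart z (hypLift β z w) = 0 := by
  have h0 := norm_fst_pos hz
  rw [fderiv_sphPart hz]
  simp only [hypLift, LinearMap.coe_mk, AddHom.coe_mk, real_inner_smul_right,
    real_inner_self_eq_norm_sq]
  rw [mul_div_assoc, div_self (by positivity), mul_one, sub_self, smul_zero]

theorem fderiv_hypPart_hypLift (hβ : β ≠ 0) (hz : z ∈ GM0 p q) (w : LVec q) :
    fderiv ℝ (hypPart β) z (hypLift β z w) = w + lorentzForm q w (hypPart β z) • hypPart β z := by
  have h0 := norm_fst_pos hz
  have hρ := Real.rpow_pos_of_pos (norm_fst_pos hz) β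
  rw [fderiv_hypPart hz, lorentzForm_apply]
  simp only [hypLift, LinearMap.coe_mk, AddHom.coe_mk, hypPart, real_inner_smul_right,
    real_inner_self_eq_norm_sq, real_inner_comm z.2]
  have e : ∀ c : ℝ, β * (c / β * ‖z.1‖ ^ 2) / ‖z.1‖ ^ 2 = c := fun c => by field_simp
  rw [e]
  ext1
  · simp only [Prod.fst_add, Prod.smul_fst]
    match_scalars <;> field_simp
    ring
  · simp only [Prod.snd_add, Prod.smul_mk, smul_eq_mul, inner_sub_right,
      real_inner_smul_right, real_inner_self_eq_norm_sq]
    ext1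
    · simp only [Prod.fst_add]
      field_simp
      ring
    · simp only [Prod.snd_add]
      field_simp
      ring

theorem differentiableAt_hypLift (hz : z ∈ GM0 p q) (w : LVec q) :
    DifferentiableAt ℝ (fun z : GVec p q => hypLift β z w) z := by
  have h1 : ContDiffAt ℝ 1 (fun z : GVec p q => ‖z.1‖) z := contDiffAt_fst.norm ℝ hz
  have h2 : DifferentiableAt ℝ (fun z : GVec p q => ‖z.1‖ ^ β) z :=
    (h1.rpow_const_of_ne (norm_fst_pos hz).ne').differentiableAt (by norm_num)
  have h3 := h2.inv (Real.rpow_pos_of_pos (norm_fst_pos hz) β).ne'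
  have h4 : DifferentiableAt ℝ (fun z : GVec p q => ‖z.2‖ ^ 2) z :=
    differentiableAt_snd.norm_sq ℝ
  have h5 : DifferentiableAt ℝ (fun z : GVec p q => ⟪z.2, w.1⟫) z :=
    differentiableAt_snd.inner ℝ (differentiableAt_const w.1)
  have h6 : DifferentiableAt ℝ (fun z : GVec p q => ((w.2.2 * (‖z.1‖ ^ β)⁻¹
      - w.2.1 * (‖z.1‖ ^ β - (‖z.1‖ ^ β)⁻¹ * ‖z.2‖ ^ 2)) / 2
      - (‖z.1‖ ^ β)⁻¹ * ⟪z.2, w.1⟫) / β) z := by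
    simp only [div_eq_mul_inv _ β, div_eq_mul_inv _ (2 : ℝ)]
    exact ((((h3.const_mul w.2.2).sub ((h2.sub (h3.mul h4)).const_mul w.2.1)).mul_const _).sub
      (h3.mul h5)).mul_const _
  exact (h6.smul differentiableAt_fst).prodMk
    (h2.smul ((differentiableAt_const w.1).sub (differentiableAt_snd.const_smul w.2.1)))

theorem exists_prodMetric_eq (hβ : β ≠ 0) (hz : z ∈ GM0 p q) (l : GVec p q →L[ℝ] ℝ) :
    ∃ G, ∀ T, prodMetric β z G T = l T := by
  have h0 := norm_fst_pos hz
  have hρ := Real.rpow_pos_of_pos (norm_fst_pos hz) β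
  refine ⟨((β ^ 2 / ‖z.1‖ ^ 2)⁻¹ • (InnerProductSpace.toDual ℝ _).symm
      (l.comp (ContinuousLinearMap.inl ℝ _ _)), (((‖z.1‖ ^ β)⁻¹) ^ 2)⁻¹ •
      (InnerProductSpace.toDual ℝ _).symm (l.comp (ContinuousLinearMap.inr ℝ _ _))), fun T => ?_⟩
  simp only [prodMetric, real_inner_smul_left, InnerProductSpace.toDual_symm_apply]
  rw [mul_inv_cancel_left₀ (by positivity), mul_inv_cancel_left₀ (by positivity)]
  simp [← map_add]

theorem prodMetric_self_pos (hβ : β ≠ 0) (hz : z ∈ GM0 p q) {U : GVec p q} (hU : U ≠ 0) :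
    0 < prodMetric β z U U := by
  have h0 := norm_fst_pos hz
  have hρ := Real.rpow_pos_of_pos (norm_fst_pos hz) β
  simp only [prodMetric, real_inner_self_eq_norm_sq]
  by_cases h1 : U.1 = 0
  · have h2 : U.2 ≠ 0 := fun h2 => hU (Prod.ext h1 h2)
    have := norm_pos_iff.2 h2
    positivity
  · have := norm_pos_iff.2 h1
    positivity

theorem normal_components (hβ : β ≠ 0) (hz : z ∈ GM0 p q) (w₁ : EuclideanSpace ℝ (Fin p))
    (w₂ : LVec q) (h : ∀ T, β * ⟪w₁, fderiv ℝ sphPart z T⟫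
      + lorentzForm q w₂ (fderiv ℝ (hypPart β) z T) = 0) :
    w₁ = ⟪w₁, sphPart z⟫ • sphPart z ∧ w₂ = -lorentzForm q w₂ (hypPart β z) • hypPart β z := by
  constructor
  · have h1 := h (sphLift z w₁)
    rw [fderiv_hypPart_sphLift hz, map_zero, add_zero] at h1
    have h2 := (mul_eq_zero.1 h1).resolve_left hβ
    rw [fderiv_sphPart_sphLift hz] at h2
    rw [← sub_eq_zero, ← inner_self_eq_zero (𝕜 := ℝ), inner_sub_left, h2, inner_smul_left]
    rw [inner_sub_right, real_inner_smul_right, inner_sphPart_self hz,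
      real_inner_comm w₁ (sphPart z)]
    simp
  · rw [neg_smul, eq_neg_iff_add_eq_zero]
    apply eq_zero_of_lorentzForm_eq_zero
    intro w
    have h1 := h (hypLift β z w)
    rw [fderiv_sphPart_hypLift hz, inner_zero_right, mul_zero, zero_add,
      fderiv_hypPart_hypLift hβ hz, map_add, map_smul, smul_eq_mul] at h1
    rw [map_add, map_smul, add_apply, smul_apply, smul_eq_mul, lorentzForm_comm (hypPart β z)]
    linarith

end Metrics

section ConeEmbedding

variable {p q : ℕ} {β : ℝ} {z : GVec p q}

/-- The embedding of `M₀` as a section of the light cone of `ambientForm`. -/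
def coneEmb (β c : ℝ) (z : GVec p q) : AVec p q := (β • sphPart z, hypPart β z, c)

/-- The unit normal field of `coneEmb` inside the light cone. -/
def coneNormal (β c : ℝ) (z : GVec p q) : AVec p q := (c • sphPart z, 0, β)

theorem contDiffAt_coneEmb {n : WithTop ℕ∞} (c : ℝ) (hz : z ∈ GM0 p q) :
    ContDiffAt ℝ n (coneEmb β c) z :=
  ((contDiffAt_sphPart hz).const_smul β).prodMk ((contDiffAt_hypPart hz).prodMk contDiffAt_const)

theorem contDiffAt_coneNormal {n : WithTop ℕ∞} (c : ℝ) (hz : z ∈ GM0 p q) :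
    ContDiffAt ℝ n (coneNormal β c) z :=
  ((contDiffAt_sphPart hz).const_smul c).prodMk (contDiffAt_const.prodMk contDiffAt_const)

theorem differentiableAt_sphPart (hz : z ∈ GM0 p q) : DifferentiableAt ℝ sphPart z :=
  (contDiffAt_sphPart (n := 1) hz).differentiableAt (by norm_num)

theorem differentiableAt_hypPart (hz : z ∈ GM0 p q) : DifferentiableAt ℝ (hypPart β) z :=
  (contDiffAt_hypPart (n := 1) hz).differentiableAt (by norm_num)

theorem fderiv_coneEmb (c : ℝ) (hz : z ∈ GM0 p q) (U : GVec p q) :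
    fderiv ℝ (coneEmb β c) z U = (β • fderiv ℝ sphPart z U, fderiv ℝ (hypPart β) z U, 0) := by
  have h : HasFDerivAt (coneEmb β c) _ z :=
    ((differentiableAt_sphPart hz).hasFDerivAt.const_smul β).prodMk
      ((differentiableAt_hypPart hz).hasFDerivAt.prodMk (hasFDerivAt_const c z))
  rw [h.fderiv]
  rfl

theorem fderiv_coneNormal (c : ℝ) (hz : z ∈ GM0 p q) (U : GVec p q) :
    fderiv ℝ (coneNormal β c) z U = (c • fderiv ℝ sphPart z U, 0, 0) := by
  have h : HasFDerivAt (coneNormal β c) _ z :=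
    ((differentiableAt_sphPart hz).hasFDerivAt.const_smul c).prodMk
      ((hasFDerivAt_const (0 : LVec q) z).prodMk (hasFDerivAt_const β z))
  rw [h.fderiv]
  rfl

theorem inner_sphPart_fderiv (hz : z ∈ GM0 p q) (U : GVec p q) :
    ⟪sphPart z, fderiv ℝ sphPart z U⟫ = 0 := by
  have h0 := norm_fst_pos hz
  rw [fderiv_sphPart hz, sphPart]
  simp only [real_inner_smul_left, real_inner_smul_right, inner_sub_right,
    real_inner_self_eq_norm_sq]
  field_simp
  ring

theorem lorentzForm_hypPart_fderiv (hz : z ∈ GM0 p q) (U : GVec p q) :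
    lorentzForm q (hypPart β z) (fderiv ℝ (hypPart β) z U) = 0 := by
  have hρ := Real.rpow_pos_of_pos (norm_fst_pos hz) β
  rw [fderiv_hypPart hz, lorentzForm_apply]
  generalize β * ⟪z.1, U.1⟫ / ‖z.1‖ ^ 2 = s
  simp only [hypPart, real_inner_smul_left, real_inner_smul_right, inner_sub_right,
    real_inner_self_eq_norm_sq]
  field_simp
  ring

variable {c : ℝ}

theorem ambientForm_coneEmb_self (hc : c ^ 2 = β ^ 2 - 1) (hz : z ∈ GM0 p q) :
    ambientForm p q (coneEmb β c z) (coneEmb β c z) = 0 := by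
  simp only [ambientForm_apply, coneEmb, real_inner_smul_left, real_inner_smul_right,
    inner_sphPart_self hz, lorentzForm_hypPart_self hz]
  linarith

theorem ambientForm_coneEmb_fderiv (hz : z ∈ GM0 p q) (U : GVec p q) :
    ambientForm p q (coneEmb β c z) (fderiv ℝ (coneEmb β c) z U) = 0 := by
  rw [fderiv_coneEmb c hz]
  simp only [ambientForm_apply, coneEmb, real_inner_smul_left, real_inner_smul_right,
    inner_sphPart_fderiv hz, lorentzForm_hypPart_fderiv hz]
  ring

theorem ambientForm_fderiv_coneEmb (hz : z ∈ GM0 p q) (U W : GVec p q) :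
    ambientForm p q (fderiv ℝ (coneEmb β c) z U) (fderiv ℝ (coneEmb β c) z W)
      = prodMetric β z U W := by
  rw [fderiv_coneEmb c hz, fderiv_coneEmb c hz, ← sphMetric_add_hypMetric hz,
    ← sq_mul_inner_fderiv_sphPart hz, ← lorentzForm_fderiv_hypPart hz]
  simp only [ambientForm_apply, real_inner_smul_left, real_inner_smul_right]
  ring

theorem ambientForm_coneEmb_coneNormal (hz : z ∈ GM0 p q) :
    ambientForm p q (coneEmb β c z) (coneNormal β c z) = 0 := by
  simp only [ambientForm_apply, coneEmb, coneNormal, real_inner_smul_left, real_inner_smul_right,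
    inner_sphPart_self hz, map_zero]
  ring

theorem ambientForm_fderiv_coneEmb_coneNormal (hz : z ∈ GM0 p q) (U : GVec p q) :
    ambientForm p q (fderiv ℝ (coneEmb β c) z U) (coneNormal β c z) = 0 := by
  rw [fderiv_coneEmb c hz]
  simp only [ambientForm_apply, coneNormal, real_inner_smul_right, real_inner_comm (sphPart z),
    inner_sphPart_fderiv hz, map_zero]
  ring

theorem ambientForm_coneEmb_fderiv_coneNormal (hz : z ∈ GM0 p q) (U : GVec p q) :
    ambientForm p q (coneEmb β c z) (fderiv ℝ (coneNormal β c) z U) = 0 := by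
  rw [fderiv_coneNormal c hz]
  simp only [ambientForm_apply, coneEmb, real_inner_smul_left, real_inner_smul_right,
    inner_sphPart_fderiv hz, map_zero]
  ring

theorem ambientForm_fderiv_coneEmb_fderiv_coneNormal (hz : z ∈ GM0 p q) (U W : GVec p q) :
    ambientForm p q (fderiv ℝ (coneEmb β c) z U) (fderiv ℝ (coneNormal β c) z W)
      = c / β * sphMetric β z U W := by
  rw [fderiv_coneNormal c hz, fderiv_coneEmb c hz, ← sq_mul_inner_fderiv_sphPart hz]
  simp only [ambientForm_apply, real_inner_smul_left, real_inner_smul_right, map_zero]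
  field_simp
  ring

theorem ambientForm_eq_of_orthogonal (hβ : β ≠ 0) (hc : c ^ 2 = β ^ 2 - 1) (hz : z ∈ GM0 p q)
    {n n' : AVec p q} (hn : ∀ T, ambientForm p q n (fderiv ℝ (coneEmb β c) z T) = 0)
    (hn' : ∀ T, ambientForm p q n' (fderiv ℝ (coneEmb β c) z T) = 0)
    (h : ambientForm p q n (coneEmb β c z) = 0) (h' : ambientForm p q n' (coneEmb β c z) = 0) :
    ambientForm p q n n' =
      -(ambientForm p q n (coneNormal β c z) * ambientForm p q n' (coneNormal β c z)) := by
  have key : ∀ n : AVec p q, (∀ T, ambientForm p q n (fderiv ℝ (coneEmb β c) z T) = 0) →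
      ∃ a b s : ℝ, n = (a • sphPart z, b • hypPart β z, s) := by
    intro n hn
    have := normal_components hβ hz n.1 n.2.1 (fun T => by
      have := hn T
      rw [fderiv_coneEmb c hz] at this
      simpa only [ambientForm_apply, real_inner_smul_right, mul_zero, sub_zero] using this)
    exact ⟨_, _, n.2.2, Prod.ext this.1 (Prod.ext this.2 rfl)⟩
  obtain ⟨a, b, s, rfl⟩ := key n hn
  obtain ⟨a', b', s', rfl⟩ := key n' hn'
  simp only [ambientForm_apply, coneEmb, coneNormal, real_inner_smul_left, real_inner_smul_right,
    inner_sphPart_self hz, map_smul, smul_apply, smul_eq_mul, lorentzForm_hypPart_self hz,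
    map_zero] at h h' ⊢
  obtain rfl : b = a * β - s * c := by linarith
  obtain rfl : b' = a' * β - s' * c := by linarith
  linear_combination (a * a' - s * s') * hc

end ConeEmbedding

section ConformalComparison

variable {p q : ℕ} {β c : ℝ} {z : GVec p q}

theorem prodMetric_comm (U W : GVec p q) : prodMetric β z U W = prodMetric β z W U := by
  simp only [prodMetric, real_inner_comm]

theorem sphMetric_comm (U W : GVec p q) : sphMetric β z U W = sphMetric β z W U := by
  simp only [sphMetric, real_inner_comm W.1 U.1]; ring

/-- The lift of `f` to the light cone of `ambientForm`, rescaled by `μ`. -/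
def coneLift (β c : ℝ) (f : GVec p q → GVec p q) (μ : GVec p q → ℝ) (z : GVec p q) : AVec p q :=
  μ z • coneEmb β c (f z)

variable {f : GVec p q → GVec p q} {μ : GVec p q → ℝ}

theorem contDiffAt_coneLift {n : WithTop ℕ∞} (hf : ContDiffAt ℝ n f z) (hμ : ContDiffAt ℝ n μ z)
    (hz : f z ∈ GM0 p q) : ContDiffAt ℝ n (coneLift β c f μ) z :=
  hμ.smul ((contDiffAt_coneEmb c hz).comp z hf)

theorem fderiv_coneLift (hf : DifferentiableAt ℝ f z) (hμ : DifferentiableAt ℝ μ z)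
    (hz : f z ∈ GM0 p q) (U : GVec p q) :
    fderiv ℝ (coneLift β c f μ) z U = fderiv ℝ μ z U • coneEmb β c (f z)
      + μ z • fderiv ℝ (coneEmb β c) (f z) (fderiv ℝ f z U) := by
  have h1 : DifferentiableAt ℝ (coneEmb β c) (f z) :=
    (contDiffAt_coneEmb (n := 1) c hz).differentiableAt (by norm_num)
  have h : HasFDerivAt (coneLift β c f μ) _ z :=
    hμ.hasFDerivAt.smul (h1.hasFDerivAt.comp z hf.hasFDerivAt)
  rw [h.fderiv]
  simp [add_comm]

theorem ambientForm_fderiv_coneLift (hc : c ^ 2 = β ^ 2 - 1) (hf : DifferentiableAt ℝ f z)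
    (hμ : DifferentiableAt ℝ μ z) (hz : f z ∈ GM0 p q) (U W : GVec p q) :
    ambientForm p q (fderiv ℝ (coneLift β c f μ) z U) (fderiv ℝ (coneLift β c f μ) z W)
      = μ z ^ 2 * prodMetric β (f z) (fderiv ℝ f z U) (fderiv ℝ f z W) := by
  rw [fderiv_coneLift hf hμ hz, fderiv_coneLift hf hμ hz]
  simp only [map_add, map_smul, add_apply, smul_apply, smul_eq_mul,
    ambientForm_coneEmb_self hc hz, ambientForm_coneEmb_fderiv hz, ambientForm_fderiv_coneEmb hz,
    ambientForm_comm (fderiv ℝ (coneEmb β c) (f z) _) (coneEmb β c (f z))]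
  ring

theorem ambientForm_fderiv_coneLift_self (hc : c ^ 2 = β ^ 2 - 1) (hf : DifferentiableAt ℝ f z)
    (hμ : DifferentiableAt ℝ μ z) (hz : f z ∈ GM0 p q) (U : GVec p q) :
    ambientForm p q (fderiv ℝ (coneLift β c f μ) z U) (coneLift β c f μ z) = 0 := by
  rw [fderiv_coneLift hf hμ hz, coneLift]
  simp only [map_add, map_smul, add_apply, smul_apply, smul_eq_mul,
    ambientForm_coneEmb_self hc hz, ambientForm_coneEmb_fderiv hz,
    ambientForm_comm (fderiv ℝ (coneEmb β c) (f z) _) (coneEmb β c (f z))]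
  ring

theorem ambientForm_fderiv_coneLift_coneNormal (hf : DifferentiableAt ℝ f z)
    (hμ : DifferentiableAt ℝ μ z) (hz : f z ∈ GM0 p q) (U : GVec p q) :
    ambientForm p q (fderiv ℝ (coneLift β c f μ) z U) (coneNormal β c (f z)) = 0 := by
  rw [fderiv_coneLift hf hμ hz]
  simp only [map_add, map_smul, add_apply, smul_apply, smul_eq_mul,
    ambientForm_coneEmb_coneNormal hz, ambientForm_fderiv_coneEmb_coneNormal hz]
  ring

variable {Ω : Set (GVec p q)}

/-- Components of the second derivative of `coneLift` along `coneLift` and `coneNormal`. -/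
theorem ambientForm_secondDeriv_coneLift (hc : c ^ 2 = β ^ 2 - 1) (hΩ : IsOpen Ω)
    (hf : ∀ z ∈ Ω, ContDiffAt ℝ 3 f z) (hμ : ∀ z ∈ Ω, ContDiffAt ℝ 3 μ z)
    (hfM : ∀ z ∈ Ω, f z ∈ GM0 p q) (hz : z ∈ Ω) (U W : GVec p q) :
    ambientForm p q (secondDeriv (coneLift β c f μ) z U W) (coneLift β c f μ z)
        = -(μ z ^ 2 * prodMetric β (f z) (fderiv ℝ f z U) (fderiv ℝ f z W)) ∧
    ambientForm p q (secondDeriv (coneLift β c f μ) z U W) (coneNormal β c (f z))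
        = -(μ z * (c / β) * sphMetric β (f z) (fderiv ℝ f z U) (fderiv ℝ f z W)) := by
  have hdf : ∀ w ∈ Ω, DifferentiableAt ℝ f w := fun w hw =>
    (hf w hw).differentiableAt (by norm_num)
  have hdμ : ∀ w ∈ Ω, DifferentiableAt ℝ μ w := fun w hw =>
    (hμ w hw).differentiableAt (by norm_num)
  have hΦ := contDiffAt_coneLift (β := β) (c := c) (hf z hz) (hμ z hz) (hfM z hz)
  have hΦd : DifferentiableAt ℝ (coneLift β c f μ) z := hΦ.differentiableAt (by norm_num)
  have hΦW : DifferentiableAt ℝ (fun w => fderiv ℝ (coneLift β c f μ) w W) z :=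
    (hΦ.fderiv_apply_const (m := 1) (by norm_num) W).differentiableAt (by norm_num)
  have hν : DifferentiableAt ℝ (coneNormal β c) (f z) :=
    (contDiffAt_coneNormal (n := 1) c (hfM z hz)).differentiableAt (by norm_num)
  have hνf : HasFDerivAt (fun w => coneNormal β c (f w)) _ z :=
    hν.hasFDerivAt.comp z (hdf z hz).hasFDerivAt
  constructor
  · have h1 : (fun w => ambientForm p q (fderiv ℝ (coneLift β c f μ) w W) (coneLift β c f μ w))
        =ᶠ[nhds z] fun _ => 0 := by
      filter_upwards [hΩ.mem_nhds hz] with w hw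
      exact ambientForm_fderiv_coneLift_self hc (hdf w hw) (hdμ w hw) (hfM w hw) W
    have h2 := fderiv_bilin_apply (ambientForm p q) hΦW hΦd U
    rw [h1.fderiv_eq, ambientForm_fderiv_coneLift hc (hdf z hz) (hdμ z hz) (hfM z hz)] at h2
    rw [prodMetric_comm]
    simp only [fderiv_fun_const, Pi.zero_apply, zero_apply] at h2
    exact eq_neg_of_add_eq_zero_left h2.symm
  · have h1 : (fun w => ambientForm p q (fderiv ℝ (coneLift β c f μ) w W) (coneNormal β c (f w)))
        =ᶠ[nhds z] fun _ => 0 := by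
      filter_upwards [hΩ.mem_nhds hz] with w hw
      exact ambientForm_fderiv_coneLift_coneNormal (hdf w hw) (hdμ w hw) (hfM w hw) W
    have h2 := fderiv_bilin_apply (ambientForm p q) hΦW hνf.differentiableAt U
    rw [h1.fderiv_eq, hνf.fderiv, fderiv_coneLift (hdf z hz) (hdμ z hz) (hfM z hz) W] at h2
    simp only [map_add, map_smul, add_apply, smul_apply, smul_eq_mul,
      ContinuousLinearMap.comp_apply, ambientForm_coneEmb_fderiv_coneNormal (hfM z hz),
      ambientForm_fderiv_coneEmb_fderiv_coneNormal (hfM z hz)] at h2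
    rw [sphMetric_comm]
    simp only [fderiv_fun_const, Pi.zero_apply, zero_apply, mul_zero, zero_add] at h2
    refine (eq_neg_of_add_eq_zero_left h2.symm).trans ?_
    ring

/-- A curvature combination of the values of a symmetric bilinear form on a frame which, up to a
factor, computes a component of the Weyl tensor. -/
def weylComb (S : GVec p q → GVec p q → ℝ) (e : Fin 4 → GVec p q) : ℝ :=
  (S (e 0) (e 0) - S (e 3) (e 3)) * (S (e 1) (e 1) - S (e 2) (e 2))
    - S (e 0) (e 1) ^ 2 - S (e 2) (e 3) ^ 2 + S (e 0) (e 2) ^ 2 + S (e 1) (e 3) ^ 2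

theorem weylComb_secondForm (hβ : β ≠ 0) (hc : c ^ 2 = β ^ 2 - 1) (hΩ : IsOpen Ω)
    (hf : ∀ z ∈ Ω, ContDiffAt ℝ 3 f z) (hμ : ∀ z ∈ Ω, ContDiffAt ℝ 3 μ z)
    (hfM : ∀ z ∈ Ω, f z ∈ GM0 p q) (hz : z ∈ Ω) (hμ0 : μ z ≠ 0)
    (hsurj : Function.Surjective (fderiv ℝ f z))
    (hiso : ∀ U W, μ z ^ 2 * prodMetric β (f z) (fderiv ℝ f z U) (fderiv ℝ f z W)
      = prodMetric β z U W)
    (e : Fin 4 → GVec p q) (he : ∀ i j, prodMetric β z (e i) (e j) = if i = j then 1 else 0)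
    (G : GVec p q → GVec p q → GVec p q) (n : GVec p q → GVec p q → AVec p q)
    (hn : ∀ U W, n U W = secondDeriv (coneLift β c f μ) z U W
      - fderiv ℝ (coneLift β c f μ) z (G U W))
    (hn0 : ∀ U W T, ambientForm p q (n U W) (fderiv ℝ (coneLift β c f μ) z T) = 0) :
    (ambientForm p q (n (e 0) (e 0)) (n (e 1) (e 1)) - ambientForm p q (n (e 1) (e 0)) (n (e 0) (e 1)))
    + (ambientForm p q (n (e 2) (e 2)) (n (e 3) (e 3)) - ambientForm p q (n (e 3) (e 2)) (n (e 2) (e 3)))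
    - (ambientForm p q (n (e 0) (e 0)) (n (e 2) (e 2)) - ambientForm p q (n (e 2) (e 0)) (n (e 0) (e 2)))
    - (ambientForm p q (n (e 1) (e 1)) (n (e 3) (e 3)) - ambientForm p q (n (e 3) (e 1)) (n (e 1) (e 3)))
    = -((μ z * (c / β)) ^ 2 * weylComb (sphMetric β (f z)) (fun i => fderiv ℝ f z (e i))) := by
  have hdf : DifferentiableAt ℝ f z := (hf z hz).differentiableAt (by norm_num)
  have hdμ : DifferentiableAt ℝ μ z := (hμ z hz).differentiableAt (by norm_num)
  have hfz := hfM z hz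
  have h1 : ∀ U W, ambientForm p q (n U W) (coneEmb β c (f z)) = -(prodMetric β z U W / μ z) := by
    intro U W
    have := (ambientForm_secondDeriv_coneLift hc hΩ hf hμ hfM hz U W).1
    rw [hiso, ← sub_zero (ambientForm p q _ _),
      ← ambientForm_fderiv_coneLift_self hc hdf hdμ hfz (G U W), ← sub_apply, ← map_sub, ← hn,
      coneLift, map_smul, smul_eq_mul] at this
    rw [← neg_div, ← this]
    field_simp
  have h2 : ∀ U W, ambientForm p q (n U W) (coneNormal β c (f z))
      = -(μ z * (c / β) * sphMetric β (f z) (fderiv ℝ f z U) (fderiv ℝ f z W)) := by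
    intro U W
    rw [hn, map_sub, sub_apply, (ambientForm_secondDeriv_coneLift hc hΩ hf hμ hfM hz U W).2,
      ambientForm_fderiv_coneLift_coneNormal hdf hdμ hfz, sub_zero]
  have h3 : ∀ m : AVec p q, (∀ T, ambientForm p q m (fderiv ℝ (coneLift β c f μ) z T) = 0) →
      ambientForm p q m (coneEmb β c (f z)) = 0 →
      ∀ T, ambientForm p q m (fderiv ℝ (coneEmb β c) (f z) T) = 0 := by
    intro m hm hm0 T
    obtain ⟨T, rfl⟩ := hsurj T
    have := hm T
    rw [fderiv_coneLift hdf hdμ hfz, map_add, map_smul, map_smul, hm0, smul_zero, zero_add,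
      smul_eq_mul] at this
    exact (mul_eq_zero.1 this).resolve_left hμ0
  have h4 : ∀ i j, i ≠ j → ambientForm p q (n (e i) (e j)) (coneEmb β c (f z)) = 0 :=
    fun i j hij => by rw [h1, he, if_neg hij]; simp
  have h5 : ∀ i j, i ≠ j → ambientForm p q (n (e i) (e j)) (n (e j) (e i))
      = -((μ z * (c / β)) ^ 2 * sphMetric β (f z) (fderiv ℝ f z (e i)) (fderiv ℝ f z (e j)) ^ 2) := by
    intro i j hij
    rw [ambientForm_eq_of_orthogonal hβ hc hfz (h3 _ (hn0 _ _) (h4 i j hij))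
      (h3 _ (hn0 _ _) (h4 j i hij.symm)) (h4 i j hij) (h4 j i hij.symm), h2, h2,
      sphMetric_comm (fderiv ℝ f z (e j))]
    ring
  have h6 : ∀ i j, ambientForm p q (n (e i) (e i) - n (e j) (e j)) (coneEmb β c (f z)) = 0 :=
    fun i j => by rw [map_sub, sub_apply, h1, h1, he, he]; simp
  have h7 := ambientForm_eq_of_orthogonal hβ hc hfz
    (h3 _ (fun T => by rw [map_sub, sub_apply, hn0, hn0, sub_zero]) (h6 0 3))
    (h3 _ (fun T => by rw [map_sub, sub_apply, hn0, hn0, sub_zero]) (h6 1 2)) (h6 0 3) (h6 1 2)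
  simp only [map_sub, sub_apply, h2] at h7
  rw [h5 1 0 (by decide), h5 3 2 (by decide), h5 2 0 (by decide), h5 3 1 (by decide)]
  rw [ambientForm_comm (n (e 3) (e 3)), ambientForm_comm (n (e 3) (e 3))] at h7
  simp only [weylComb, sphMetric_comm (fderiv ℝ f z (e 1)) (fderiv ℝ f z (e 0)),
    sphMetric_comm (fderiv ℝ f z (e 3)) (fderiv ℝ f z (e 2)),
    sphMetric_comm (fderiv ℝ f z (e 2)) (fderiv ℝ f z (e 0)),
    sphMetric_comm (fderiv ℝ f z (e 3)) (fderiv ℝ f z (e 1))]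
  linear_combination h7

end ConformalComparison

section ConformalFactor

variable {p q : ℕ} {β c : ℝ} {z : GVec p q}
variable {f : GVec p q → GVec p q} {μ : GVec p q → ℝ} {Ω : Set (GVec p q)}

theorem surjective_fderiv_of_prodMetric (hβ : β ≠ 0) (hz : z ∈ GM0 p q)
    (hiso : ∀ U W, μ z ^ 2 * prodMetric β (f z) (fderiv ℝ f z U) (fderiv ℝ f z W)
      = prodMetric β z U W) : Function.Surjective (fderiv ℝ f z) := by
  have h : Function.Injective (fderiv ℝ f z : GVec p q →ₗ[ℝ] GVec p q) := by
    rw [injective_iff_map_eq_zero]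
    intro U hU
    by_contra hne
    have h1 := hiso U U
    have h2 := prodMetric_self_pos hβ hz hne
    rw [← h1, show fderiv ℝ f z U = 0 from hU] at h2
    simp [prodMetric] at h2
  exact LinearMap.injective_iff_surjective.1 h

theorem weylComb_conformal (hβ : β ≠ 0) (hβ1 : 1 < β ^ 2) (hΩ : IsOpen Ω) (hΩM : Ω ⊆ GM0 p q)
    (hf : ∀ z ∈ Ω, ContDiffAt ℝ 3 f z) (hμ : ∀ z ∈ Ω, ContDiffAt ℝ 3 μ z)
    (hfM : ∀ z ∈ Ω, f z ∈ GM0 p q) (hμ0 : ∀ z ∈ Ω, μ z ≠ 0)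
    (hiso : ∀ z ∈ Ω, ∀ U W, μ z ^ 2 * prodMetric β (f z) (fderiv ℝ f z U) (fderiv ℝ f z W)
      = prodMetric β z U W) (hz : z ∈ Ω)
    (e : Fin 4 → GVec p q) (he : ∀ i j, prodMetric β z (e i) (e j) = if i = j then 1 else 0) :
    weylComb (sphMetric β z) e
      = μ z ^ 2 * weylComb (sphMetric β (f z)) (fun i => fderiv ℝ f z (e i)) := by
  obtain ⟨c, hc0, hc⟩ : ∃ c : ℝ, c ≠ 0 ∧ c ^ 2 = β ^ 2 - 1 :=
    ⟨√(β ^ 2 - 1), (Real.sqrt_pos.2 (by linarith)).ne', Real.sq_sqrt (by linarith)⟩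
  have hid : ∀ z ∈ Ω, ContDiffAt ℝ 3 (id : GVec p q → GVec p q) z := fun z _ => contDiffAt_id
  have h1 : ∀ z ∈ Ω, ContDiffAt ℝ 3 (fun _ : GVec p q => (1 : ℝ)) z := fun z _ => contDiffAt_const
  have hidiso : ∀ z ∈ Ω, ∀ U W, (1 : ℝ) ^ 2 * prodMetric β (id z) (fderiv ℝ id z U)
      (fderiv ℝ id z W) = prodMetric β z U W := by
    intro z _ U W
    simp
  have hΦ : ∀ z ∈ Ω, ContDiffAt ℝ 3 (coneLift β c f μ) z := fun z hz =>
    contDiffAt_coneLift (hf z hz) (hμ z hz) (hfM z hz)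
  have hΨ : ∀ z ∈ Ω, ContDiffAt ℝ 3 (coneLift β c (id : GVec p q → _) fun _ => 1) z :=
    fun z hz => contDiffAt_coneLift (hid z hz) (h1 z hz) (hΩM hz)
  have hΨm : ∀ z ∈ Ω, ∀ U W, ambientForm p q
      (fderiv ℝ (coneLift β c (id : GVec p q → _) fun _ => 1) z U)
      (fderiv ℝ (coneLift β c (id : GVec p q → _) fun _ => 1) z W) = prodMetric β z U W := by
    intro z hz U W
    rw [ambientForm_fderiv_coneLift hc ((hid z hz).differentiableAt (by norm_num))
      ((h1 z hz).differentiableAt (by norm_num)) (hΩM hz), hidiso z hz]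
  have hΦm : ∀ z ∈ Ω, ∀ U W, ambientForm p q (fderiv ℝ (coneLift β c f μ) z U)
      (fderiv ℝ (coneLift β c f μ) z W) = prodMetric β z U W := by
    intro z hz U W
    rw [ambientForm_fderiv_coneLift hc ((hf z hz).differentiableAt (by norm_num))
      ((hμ z hz).differentiableAt (by norm_num)) (hfM z hz), hiso z hz]
  choose G hG using fun U W => exists_prodMetric_eq hβ (hΩM hz)
    ((ambientForm p q (secondDeriv (coneLift β c id fun _ => 1) z U W)).comp
      (fderiv ℝ (coneLift β c id fun _ => 1) z))
  obtain ⟨hn, hn', hgauss⟩ := gauss_of_isometric (ambientForm p q) (ambientForm p q)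
    ambientForm_comm ambientForm_comm hΩ hΦ hΨ (fun z hz U W => by rw [hΦm z hz, hΨm z hz]) hz G
    (fun U W T => by rw [hΨm z hz, hG]; rfl)
  have k1 := weylComb_secondForm hβ hc hΩ hf hμ hfM hz (hμ0 z hz)
    (surjective_fderiv_of_prodMetric hβ (hΩM hz) (hiso z hz)) (hiso z hz) e he G _
    (fun _ _ => rfl) hn
  have k2 := weylComb_secondForm hβ hc hΩ hid h1 (fun z hz => hΩM hz) hz one_ne_zero
    (surjective_fderiv_of_prodMetric (μ := fun _ => 1) hβ (hΩM hz) (hidiso z hz))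
    (hidiso z hz) e he G _ (fun _ _ => rfl) hn'
  simp only [hgauss, k2, fderiv_id, ContinuousLinearMap.coe_id', id_eq, one_mul, neg_inj] at k1
  rw [mul_pow, mul_comm (μ z ^ 2), mul_assoc] at k1
  exact mul_left_cancel₀ (by positivity) k1

section Frame

theorem sphMetric_smul_smul (s t : ℝ) (U W : GVec p q) :
    sphMetric β z (s • U) (t • W) = s * t * sphMetric β z U W := by
  simp only [sphMetric, Prod.smul_fst, real_inner_smul_left, real_inner_smul_right]
  ring

theorem hypMetric_smul_smul (s t : ℝ) (U W : GVec p q) :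
    hypMetric β z (s • U) (t • W) = s * t * hypMetric β z U W := by
  simp only [hypMetric, Prod.smul_fst, Prod.smul_snd, real_inner_smul_left, real_inner_smul_right]
  ring

theorem prodMetric_smul_smul (s t : ℝ) (U W : GVec p q) :
    prodMetric β z (s • U) (t • W) = s * t * prodMetric β z U W := by
  simp only [prodMetric, Prod.smul_fst, Prod.smul_snd, real_inner_smul_left, real_inner_smul_right]
  ring

theorem sphMetric_self_nonneg (hz : z ∈ GM0 p q) (U : GVec p q) : 0 ≤ sphMetric β z U U := by
  rw [← sq_mul_inner_fderiv_sphPart hz, real_inner_self_eq_norm_sq]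
  positivity

theorem sphMetric_sq_le (hz : z ∈ GM0 p q) (U W : GVec p q) :
    sphMetric β z U W ^ 2 ≤ sphMetric β z U U * sphMetric β z W W := by
  simp only [← sq_mul_inner_fderiv_sphPart hz, real_inner_self_eq_norm_sq]
  have := real_inner_mul_inner_self_le (fderiv ℝ sphPart z U) (fderiv ℝ sphPart z W)
  simp only [real_inner_self_eq_norm_sq] at this
  have hb : 0 ≤ β ^ 4 := by positivity
  nlinarith [mul_le_mul_of_nonneg_left this hb]

theorem hypMetric_self_nonneg (U : GVec p q) : 0 ≤ hypMetric β z U U := by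
  simp only [hypMetric, real_inner_self_eq_norm_sq]
  have := mul_self_nonneg (β * ⟪z.1, U.1⟫ / ‖z.1‖ ^ 2)
  positivity

theorem hypMetric_sq_le (U W : GVec p q) :
    hypMetric β z U W ^ 2 ≤ hypMetric β z U U * hypMetric β z W W := by
  simp only [hypMetric]
  generalize β * ⟪z.1, U.1⟫ / ‖z.1‖ ^ 2 = s
  generalize β * ⟪z.1, W.1⟫ / ‖z.1‖ ^ 2 = t
  generalize (‖z.1‖ ^ β)⁻¹ = k
  have h := real_inner_mul_inner_self_le (k • U.2) (k • W.2)
  have h' := real_inner_self_nonneg (F := EuclideanSpace ℝ (Fin q)) (x := s • (k • W.2) - t • (k • U.2))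
  simp only [inner_sub_left, inner_sub_right, real_inner_smul_left, real_inner_smul_right,
    real_inner_comm U.2 W.2] at h h'
  nlinarith

/-- The bound `P ≤ 1` on orthonormal frames. -/
theorem weylComb_sphMetric_le (hz : z ∈ GM0 p q) (e : Fin 4 → GVec p q)
    (he : ∀ i j, prodMetric β z (e i) (e j) = if i = j then 1 else 0) :
    weylComb (sphMetric β z) e ≤ 1 := by
  have hH : ∀ i j, hypMetric β z (e i) (e j) = (if i = j then 1 else 0)
      - sphMetric β z (e i) (e j) := fun i j => by
    rw [← he, ← sphMetric_add_hypMetric hz]; ring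
  have n1 := fun i => sphMetric_self_nonneg (β := β) hz (e i)
  have n2 := fun i => hypMetric_self_nonneg (β := β) (z := z) (e i)
  have c1 := fun i j => sphMetric_sq_le (β := β) hz (e i) (e j)
  have c2 := fun i j => hypMetric_sq_le (β := β) (z := z) (e i) (e j)
  simp only [hH, if_true] at n2 c2
  have a := c1 0 2
  have b := c1 1 3
  have a' := c2 0 2
  have b' := c2 1 3
  simp only [weylComb]
  rw [if_neg (by decide)] at a' b'
  have h01 := mul_nonneg (n1 0) (n2 1)
  have h10 := mul_nonneg (n1 1) (n2 0)
  have h23 := mul_nonneg (n1 2) (n2 3)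
  have h32 := mul_nonneg (n1 3) (n2 2)
  nlinarith [sq_nonneg (sphMetric β z (e 0) (e 1)), sq_nonneg (sphMetric β z (e 2) (e 3))]

theorem exists_unit_orthogonal_pair (hp : 3 ≤ p) (x u : EuclideanSpace ℝ (Fin p)) :
    ∃ v : EuclideanSpace ℝ (Fin p), ‖v‖ = 1 ∧ ⟪x, v⟫ = 0 ∧ ⟪u, v⟫ = 0 := by
  have h := LinearMap.ker_ne_bot_of_finrank_lt
    (f := ((innerSL ℝ x).prod (innerSL ℝ u) : EuclideanSpace ℝ (Fin p) →ₗ[ℝ] ℝ × ℝ))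
    (by simp; omega)
  obtain ⟨v, hv, hv0⟩ := Submodule.exists_mem_ne_zero_of_ne_bot h
  have hv' : ⟪x, v⟫ = 0 ∧ ⟪u, v⟫ = 0 := by simpa [Prod.ext_iff] using hv
  have := norm_pos_iff.2 hv0
  refine ⟨‖v‖⁻¹ • v, by simp [norm_smul, this.ne'], ?_, ?_⟩ <;>
    simp [real_inner_smul_right, hv'.1, hv'.2]

theorem exists_frame_weylComb_eq_one (hβ : β ≠ 0) (hp : 3 ≤ p) (hq : 1 ≤ q) (hz : z ∈ GM0 p q) :
    ∃ e : Fin 4 → GVec p q, (∀ i j, prodMetric β z (e i) (e j) = if i = j then 1 else 0) ∧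
      weylComb (sphMetric β z) e = 1 := by
  obtain ⟨v, hv, hxv, -⟩ := exists_unit_orthogonal_pair hp z.1 0
  obtain ⟨w, hw, hxw, hvw⟩ := exists_unit_orthogonal_pair hp z.1 v
  have h0 := norm_fst_pos hz
  have hρ := Real.rpow_pos_of_pos h0 β
  let y : EuclideanSpace ℝ (Fin q) := EuclideanSpace.single ⟨0, hq⟩ 1
  have hy : ‖y‖ = 1 := by simp [y]
  have hvx : ⟪v, z.1⟫ = 0 := by rw [real_inner_comm, hxv]
  have hwx : ⟪w, z.1⟫ = 0 := by rw [real_inner_comm, hxw]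
  have hwv : ⟪w, v⟫ = 0 := by rw [real_inner_comm, hvw]
  refine ⟨![((‖z.1‖ / β) • v, 0), ((‖z.1‖ / β) • w, 0), (β⁻¹ • z.1, 0), (0, ‖z.1‖ ^ β • y)],
    fun i j => ?_, ?_⟩
  · fin_cases i <;> fin_cases j <;>
      simp [prodMetric, norm_smul, mul_pow, div_pow, real_inner_smul_left, real_inner_smul_right, hv, hw, hy, hxv, hxw, hvw,
        hvx, hwx, hwv] <;> field_simp
  · simp [weylComb, sphMetric, norm_smul, mul_pow, div_pow, real_inner_smul_left, real_inner_smul_right, hv, hw, hxv, hxw, hvw,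
      hvx]
    field_simp
    ring

theorem weylComb_smul (s : ℝ) (e : Fin 4 → GVec p q) :
    weylComb (sphMetric β z) (fun i => s • e i) = s ^ 4 * weylComb (sphMetric β z) e := by
  simp only [weylComb, sphMetric_smul_smul]
  ring

end Frame

/-- A conformal map for `prodMetric` is isometric. -/
theorem conformal_factor_sq_eq_one (hβ : β ≠ 0) (hβ1 : 1 < β ^ 2) (hp : 3 ≤ p) (hq : 1 ≤ q)
    (hΩ : IsOpen Ω) (hΩM : Ω ⊆ GM0 p q)
    (hf : ∀ z ∈ Ω, ContDiffAt ℝ 3 f z) (hμ : ∀ z ∈ Ω, ContDiffAt ℝ 3 μ z)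
    (hfM : ∀ z ∈ Ω, f z ∈ GM0 p q) (hμ0 : ∀ z ∈ Ω, μ z ≠ 0)
    (hiso : ∀ z ∈ Ω, ∀ U W, μ z ^ 2 * prodMetric β (f z) (fderiv ℝ f z U) (fderiv ℝ f z W)
      = prodMetric β z U W) (hz : z ∈ Ω) : μ z ^ 2 = 1 := by
  have h0 := hμ0 z hz
  have hpos : 0 < μ z ^ 2 := by positivity
  have key := fun e he => weylComb_conformal hβ hβ1 hΩ hΩM hf hμ hfM hμ0 hiso hz e he
  apply le_antisymm
  · obtain ⟨e, he, he1⟩ := exists_frame_weylComb_eq_one hβ hp hq (hΩM hz)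
    have h1 := key e he
    have h2 := weylComb_sphMetric_le (β := β) (hfM z hz) (fun i => μ z • fderiv ℝ f z (e i))
      (fun i j => by rw [prodMetric_smul_smul, ← he, ← hiso z hz]; ring)
    rw [weylComb_smul] at h2
    rw [he1] at h1
    nlinarith
  · obtain ⟨e', he', he1⟩ := exists_frame_weylComb_eq_one hβ hp hq (hfM z hz)
    choose e he using fun i => surjective_fderiv_of_prodMetric hβ (hΩM hz) (hiso z hz)
      ((μ z)⁻¹ • e' i)
    have horth : ∀ i j, prodMetric β z (e i) (e j) = if i = j then 1 else 0 := fun i j => by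
      rw [← hiso z hz, he, he, prodMetric_smul_smul, ← he']
      field_simp
    have h1 := key e horth
    have h2 := weylComb_sphMetric_le (hΩM hz) e horth
    simp only [he] at h1
    rw [weylComb_smul, he1] at h1
    rw [h1] at h2
    field_simp at h2
    rwa [div_le_one hpos] at h2

end ConformalFactor

section NormalComponents

section Const

variable {V E : Type*} [NormedAddCommGroup V] [NormedSpace ℝ V] [NormedAddCommGroup E]
  [NormedSpace ℝ E] (B : E →L[ℝ] E →L[ℝ] ℝ) (hB : ∀ a b, B a b = B b a) {Ω : Set V}
  (hΩ : IsOpen Ω) {F : V → E} {ε : ℝ} (hFF : ∀ z ∈ Ω, B (F z) (F z) = ε) {z : V} (hz : z ∈ Ω)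

include hB hΩ hFF hz

theorem bilin_fderiv_of_const (hF : DifferentiableAt ℝ F z) (U : V) :
    B (fderiv ℝ F z U) (F z) = 0 := by
  have h1 := fderiv_bilin_apply B hF hF U
  have h2 : (fun w => B (F w) (F w)) =ᶠ[nhds z] fun _ => ε := by
    filter_upwards [hΩ.mem_nhds hz] with w hw using hFF w hw
  rw [h2.fderiv_eq, hB (F z)] at h1
  simp only [fderiv_fun_const, Pi.zero_apply, zero_apply] at h1
  linarith

theorem bilin_secondDeriv_of_const (hF : ∀ z ∈ Ω, ContDiffAt ℝ 3 F z) (U W : V) :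
    B (secondDeriv F z U W) (F z) = -B (fderiv ℝ F z U) (fderiv ℝ F z W) := by
  have h1 : (fun w => B (fderiv ℝ F w W) (F w)) =ᶠ[nhds z] fun _ => 0 := by
    filter_upwards [hΩ.mem_nhds hz] with w hw
    exact bilin_fderiv_of_const B hB hΩ hFF hw ((hF w hw).differentiableAt (by norm_num)) W
  have h2 := fderiv_bilin_apply B
    (((hF z hz).fderiv_apply_const (m := 1) (by norm_num) W).differentiableAt (by norm_num))
    ((hF z hz).differentiableAt (by norm_num)) U
  rw [h1.fderiv_eq] at h2
  simp only [fderiv_fun_const, Pi.zero_apply, zero_apply] at h2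
  rw [hB (fderiv ℝ F z U)]
  exact eq_neg_of_add_eq_zero_left h2.symm

end Const

variable {p q : ℕ} {β c : ℝ} {z : GVec p q}
variable {f : GVec p q → GVec p q} {Ω : Set (GVec p q)}

theorem contDiffAt_sphPart_comp {n : WithTop ℕ∞} (hf : ContDiffAt ℝ n f z) (hz : f z ∈ GM0 p q) :
    ContDiffAt ℝ n (fun w => sphPart (f w)) z :=
  (contDiffAt_sphPart hz).comp z hf

theorem contDiffAt_hypPart_comp {n : WithTop ℕ∞} (hf : ContDiffAt ℝ n f z) (hz : f z ∈ GM0 p q) :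
    ContDiffAt ℝ n (fun w => hypPart β (f w)) z :=
  (contDiffAt_hypPart hz).comp z hf

theorem fderiv_sphPart_comp (hf : DifferentiableAt ℝ f z) (hz : f z ∈ GM0 p q) (U : GVec p q) :
    fderiv ℝ (fun w => sphPart (f w)) z U = fderiv ℝ sphPart (f z) (fderiv ℝ f z U) := by
  have h : HasFDerivAt (fun w => sphPart (f w)) _ z :=
    (differentiableAt_sphPart hz).hasFDerivAt.comp z hf.hasFDerivAt
  rw [h.fderiv]; rfl

theorem fderiv_hypPart_comp (hf : DifferentiableAt ℝ f z) (hz : f z ∈ GM0 p q) (U : GVec p q) :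
    fderiv ℝ (fun w => hypPart β (f w)) z U = fderiv ℝ (hypPart β) (f z) (fderiv ℝ f z U) := by
  have h : HasFDerivAt (fun w => hypPart β (f w)) _ z :=
    (differentiableAt_hypPart hz).hasFDerivAt.comp z hf.hasFDerivAt
  rw [h.fderiv]; rfl

theorem fderiv_coneEmb_comp (hf : DifferentiableAt ℝ f z) (hz : f z ∈ GM0 p q) (U : GVec p q) :
    fderiv ℝ (fun w => coneEmb β c (f w)) z U
      = fderiv ℝ (coneEmb β c) (f z) (fderiv ℝ f z U) := by
  have h : HasFDerivAt (fun w => coneEmb β c (f w)) _ z :=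
    ((contDiffAt_coneEmb (n := 1) c hz).differentiableAt (by norm_num)).hasFDerivAt.comp z
      hf.hasFDerivAt
  rw [h.fderiv]; rfl

theorem secondDeriv_coneEmb_comp (hf : ContDiffAt ℝ 2 f z) (hz : f z ∈ GM0 p q) (U W : GVec p q) :
    secondDeriv (fun w => coneEmb β c (f w)) z U W
      = (β • secondDeriv (fun w => sphPart (f w)) z U W,
        secondDeriv (fun w => hypPart β (f w)) z U W, 0) := by
  have h : ContDiffAt ℝ 2 (fun w => coneEmb β c (f w)) z := (contDiffAt_coneEmb c hz).comp z hf
  have h1 := secondDeriv_clm (ContinuousLinearMap.fst ℝ _ _) h U W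
  have h2 := secondDeriv_clm ((ContinuousLinearMap.fst ℝ _ _).comp
    (ContinuousLinearMap.snd ℝ _ _)) h U W
  have h3 := secondDeriv_clm ((ContinuousLinearMap.snd ℝ _ _).comp
    (ContinuousLinearMap.snd ℝ _ _)) h U W
  have h4 := secondDeriv_clm (β • ContinuousLinearMap.id ℝ _) (contDiffAt_sphPart_comp hf hz) U W
  refine Prod.ext (h1.symm.trans h4) (Prod.ext h2.symm (h3.symm.trans ?_))
  change secondDeriv (fun _ => c) z U W = 0
  simp [secondDeriv]

/-- The second derivatives of the two components of a map, in terms of their tangential part. -/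
theorem secondDeriv_comp_of_orthogonal (hβ : β ≠ 0) (hΩ : IsOpen Ω)
    (hf : ∀ z ∈ Ω, ContDiffAt ℝ 3 f z) (hfM : ∀ z ∈ Ω, f z ∈ GM0 p q) (hz : z ∈ Ω)
    (hsurj : Function.Surjective (fderiv ℝ f z)) (U W g : GVec p q)
    (h : ∀ T, ambientForm p q (secondDeriv (fun w => coneEmb β 0 (f w)) z U W
      - fderiv ℝ (fun w => coneEmb β 0 (f w)) z g) (fderiv ℝ (fun w => coneEmb β 0 (f w)) z T) = 0) :
    secondDeriv (fun w => sphPart (f w)) z U W = fderiv ℝ (fun w => sphPart (f w)) z g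
      + (-(β⁻¹ ^ 2 * sphMetric β (f z) (fderiv ℝ f z U) (fderiv ℝ f z W))) • sphPart (f z) ∧
    secondDeriv (fun w => hypPart β (f w)) z U W = fderiv ℝ (fun w => hypPart β (f w)) z g
      + hypMetric β (f z) (fderiv ℝ f z U) (fderiv ℝ f z W) • hypPart β (f z) := by
  have hfz := hfM z hz
  have hdf : DifferentiableAt ℝ f z := (hf z hz).differentiableAt (by norm_num)
  have hF1 : ∀ z ∈ Ω, ContDiffAt ℝ 3 (fun w => sphPart (f w)) z :=
    fun z hz => contDiffAt_sphPart_comp (hf z hz) (hfM z hz)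
  have hF2 : ∀ z ∈ Ω, ContDiffAt ℝ 3 (fun w => hypPart β (f w)) z :=
    fun z hz => contDiffAt_hypPart_comp (hf z hz) (hfM z hz)
  have hs : ∀ a b : EuclideanSpace ℝ (Fin p), innerSL ℝ a b = innerSL ℝ b a :=
    fun a b => by simp only [innerSL_apply_apply, real_inner_comm]
  have hc1 : ∀ w ∈ Ω, innerSL ℝ (sphPart (f w)) (sphPart (f w)) = 1 :=
    fun w hw => inner_sphPart_self (hfM w hw)
  have hc2 : ∀ w ∈ Ω, lorentzForm q (hypPart β (f w)) (hypPart β (f w)) = -1 :=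
    fun w hw => lorentzForm_hypPart_self (hfM w hw)
  have a1 := bilin_secondDeriv_of_const (innerSL ℝ) hs hΩ hc1 hz hF1 U W
  have a2 := bilin_secondDeriv_of_const (lorentzForm q) lorentzForm_comm hΩ hc2 hz hF2 U W
  have b1 := bilin_fderiv_of_const (innerSL ℝ) hs hΩ hc1 hz
    ((hF1 z hz).differentiableAt (by norm_num)) g
  have b2 := bilin_fderiv_of_const (lorentzForm q) lorentzForm_comm hΩ hc2 hz
    ((hF2 z hz).differentiableAt (by norm_num)) g
  rw [innerSL_apply_apply, innerSL_apply_apply, fderiv_sphPart_comp hdf hfz,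
    fderiv_sphPart_comp hdf hfz] at a1
  rw [innerSL_apply_apply] at b1
  rw [fderiv_hypPart_comp hdf hfz, fderiv_hypPart_comp hdf hfz,
    lorentzForm_fderiv_hypPart hfz] at a2
  rw [← sq_mul_inner_fderiv_sphPart hfz]
  obtain ⟨h1, h2⟩ := normal_components hβ hfz
    (β • (secondDeriv (fun w => sphPart (f w)) z U W - fderiv ℝ (fun w => sphPart (f w)) z g))
    (secondDeriv (fun w => hypPart β (f w)) z U W - fderiv ℝ (fun w => hypPart β (f w)) z g)
    (fun T => by
      obtain ⟨T, rfl⟩ := hsurj T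
      have := h T
      rw [secondDeriv_coneEmb_comp ((hf z hz).of_le (by norm_num)) hfz,
        fderiv_coneEmb_comp hdf hfz, fderiv_coneEmb_comp hdf hfz, fderiv_coneEmb 0 hfz,
        fderiv_coneEmb 0 hfz, ← fderiv_sphPart_comp hdf hfz g,
        ← fderiv_hypPart_comp hdf hfz g, ambientForm_apply] at this
      simpa only [Prod.mk_sub_mk, ← smul_sub, real_inner_smul_right, mul_zero, sub_zero] using this)
  rw [← sub_eq_iff_eq_add', ← sub_eq_iff_eq_add']
  constructor
  · rw [real_inner_smul_left, mul_smul] at h1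
    rw [smul_right_injective _ hβ h1, inner_sub_left, a1, b1, sub_zero]
    congr 1
    field_simp
  · rw [h2, map_sub, sub_apply, a2, b2, sub_zero, neg_neg]

/-- Two splittings of the same symmetric form agree if their second parts have the same kernel. -/
theorem eq_of_add_eq_add_of_ker_eq {V : Type*} {S H S' H' : V → V → ℝ}
    (hS : ∀ U W, S U W = S W U) (hS' : ∀ U W, S' U W = S' W U)
    (hH : ∀ U W, H U W ^ 2 ≤ H U U * H W W) (hH' : ∀ U W, H' U W ^ 2 ≤ H' U U * H' W W)
    (hadd : ∀ U W, S U W + H U W = S' U W + H' U W) (hker : ∀ U, H U U = 0 ↔ H' U U = 0)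
    (hl : ∀ U, ∃ U', H U' U' = 0 ∧ ∀ W, S U' W = S U W)
    (hl' : ∀ U, ∃ U', H' U' U' = 0 ∧ ∀ W, S' U' W = S' U W) (U W : V) : S U W = S' U W := by
  have key : ∀ U, H U U = 0 → ∀ W, S U W = S' U W := by
    intro U hU W
    have h1 := hH U W
    have h2 := hH' U W
    rw [hU, zero_mul] at h1
    rw [(hker U).1 hU, zero_mul] at h2
    have h3 := hadd U W
    rw [pow_eq_zero_iff two_ne_zero |>.1 (le_antisymm h1 (sq_nonneg _)),
      pow_eq_zero_iff two_ne_zero |>.1 (le_antisymm h2 (sq_nonneg _))] at h3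
    simpa using h3
  obtain ⟨U', hU', hUS⟩ := hl U
  obtain ⟨W', hW', hWS⟩ := hl' W
  calc S U W = S' W U' := by rw [← hUS, key U' hU', hS']
    _ = S U W' := by rw [← hWS, ← key W' ((hker W').2 hW'), hS, hUS]
    _ = S' U W := by rw [hS, key W' ((hker W').2 hW'), hWS, hS']

theorem exists_lift_sphMetric (hz : z ∈ GM0 p q) (U : GVec p q) :
    ∃ U', hypMetric β z U' U' = 0 ∧ ∀ W, sphMetric β z U' W = sphMetric β z U W := by
  refine ⟨sphLift z (fderiv ℝ sphPart z U), ?_, fun W => ?_⟩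
  · rw [← lorentzForm_fderiv_hypPart hz, fderiv_hypPart_sphLift hz, map_zero]
  · rw [← sq_mul_inner_fderiv_sphPart hz, ← sq_mul_inner_fderiv_sphPart hz,
      fderiv_sphPart_sphLift hz, real_inner_comm (sphPart z), inner_sphPart_fderiv hz, zero_smul,
      sub_zero]

theorem exists_orthogonal_of_hypMetric_eq_zero (hβ : β ≠ 0) (hp : 3 ≤ p) (hz : z ∈ GM0 p q)
    (U : GVec p q) : ∃ W, hypMetric β z W W = 0 ∧ prodMetric β z W W = 1 ∧
      prodMetric β z U W = 0 := by
  obtain ⟨v, hv, hxv, huv⟩ := exists_unit_orthogonal_pair hp z.1 U.1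
  have h0 := norm_fst_pos hz
  refine ⟨((‖z.1‖ / β) • v, 0), ?_, ?_, ?_⟩
  · simp [hypMetric, real_inner_smul_right, hxv]
  · simp [prodMetric, norm_smul, div_pow, hv]
    field_simp
  · simp [prodMetric, real_inner_smul_right, huv]

/-- If the sectional curvature of `S - H` on a spherical plane is preserved, the plane stays
spherical. -/
theorem hypMetric_eq_zero_of_gauss {k a b d a' b' d' : ℝ} (hk : 0 < k)
    (hab' : d' ^ 2 ≤ (1 - a') * (1 - b')) (ha' : 0 ≤ a') (ha1 : a' ≤ 1) (hb1 : b' ≤ 1)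
    (ha : a = 1) (hb : b = 1) (hd : d = 0)
    (h : k * (a * b - d ^ 2) - ((1 - a) * (1 - b) - d ^ 2)
      = k * (a' * b' - d' ^ 2) - ((1 - a') * (1 - b') - d' ^ 2)) : a' = 1 := by
  subst ha hb hd
  have h1 : 1 ≤ a' * b' - d' ^ 2 := by
    by_contra! hlt
    nlinarith
  nlinarith [sq_nonneg d']

end NormalComponents

section Splitting

variable {p q : ℕ} {β c : ℝ} {z : GVec p q}
variable {f : GVec p q → GVec p q} {Ω : Set (GVec p q)}

theorem hypMetric_comm (U W : GVec p q) : hypMetric β z U W = hypMetric β z W U := by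
  simp only [hypMetric, real_inner_comm]
  ring

theorem ambientForm_normal (hβ : β ≠ 0) (hΩ : IsOpen Ω)
    (hf : ∀ z ∈ Ω, ContDiffAt ℝ 3 f z) (hfM : ∀ z ∈ Ω, f z ∈ GM0 p q) (hz : z ∈ Ω)
    (hsurj : Function.Surjective (fderiv ℝ f z)) {G : GVec p q → GVec p q → GVec p q}
    (h : ∀ U W T, ambientForm p q (secondDeriv (fun w => coneEmb β 0 (f w)) z U W
      - fderiv ℝ (fun w => coneEmb β 0 (f w)) z (G U W))
        (fderiv ℝ (fun w => coneEmb β 0 (f w)) z T) = 0) (U W U' W' : GVec p q) :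
    ambientForm p q (secondDeriv (fun w => coneEmb β 0 (f w)) z U W
        - fderiv ℝ (fun w => coneEmb β 0 (f w)) z (G U W))
      (secondDeriv (fun w => coneEmb β 0 (f w)) z U' W'
        - fderiv ℝ (fun w => coneEmb β 0 (f w)) z (G U' W'))
      = β⁻¹ ^ 2 * (sphMetric β (f z) (fderiv ℝ f z U) (fderiv ℝ f z W)
          * sphMetric β (f z) (fderiv ℝ f z U') (fderiv ℝ f z W'))
        - hypMetric β (f z) (fderiv ℝ f z U) (fderiv ℝ f z W)
          * hypMetric β (f z) (fderiv ℝ f z U') (fderiv ℝ f z W') := by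
  have hfz := hfM z hz
  have hdf : DifferentiableAt ℝ f z := (hf z hz).differentiableAt (by norm_num)
  have key : ∀ U W, secondDeriv (fun w => coneEmb β 0 (f w)) z U W
      - fderiv ℝ (fun w => coneEmb β 0 (f w)) z (G U W)
      = (-(β⁻¹ * sphMetric β (f z) (fderiv ℝ f z U) (fderiv ℝ f z W)) • sphPart (f z),
        hypMetric β (f z) (fderiv ℝ f z U) (fderiv ℝ f z W) • hypPart β (f z), 0) := by
    intro U W
    obtain ⟨h1, h2⟩ := secondDeriv_comp_of_orthogonal hβ hΩ hf hfM hz hsurj U W _ (h U W)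
    rw [secondDeriv_coneEmb_comp ((hf z hz).of_le (by norm_num)) hfz, fderiv_coneEmb_comp hdf hfz,
      fderiv_coneEmb 0 hfz, ← fderiv_sphPart_comp hdf hfz, ← fderiv_hypPart_comp hdf hfz, h1, h2,
      Prod.mk_sub_mk, Prod.mk_sub_mk, ← smul_sub, add_sub_cancel_left, add_sub_cancel_left,
      smul_smul, sub_zero]
    congr 2
    field_simp
  rw [key, key, ambientForm_apply]
  simp only [real_inner_smul_left, real_inner_smul_right, inner_sphPart_self hfz, map_smul,
    smul_apply, lorentzForm_hypPart_self hfz, smul_eq_mul]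
  ring

theorem exists_tangential_of_isometric (hβ : β ≠ 0) (hΩ : IsOpen Ω) (hΩM : Ω ⊆ GM0 p q)
    (hf : ∀ z ∈ Ω, ContDiffAt ℝ 3 f z) (hfM : ∀ z ∈ Ω, f z ∈ GM0 p q)
    (hiso : ∀ z ∈ Ω, ∀ U W, prodMetric β (f z) (fderiv ℝ f z U) (fderiv ℝ f z W)
      = prodMetric β z U W) (hz : z ∈ Ω) :
    ∃ G : GVec p q → GVec p q → GVec p q,
      (∀ U W, (secondDeriv sphPart z U W = fderiv ℝ sphPart z (G U W)
          + (-(β⁻¹ ^ 2 * sphMetric β z U W)) • sphPart z ∧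
        secondDeriv (hypPart β) z U W = fderiv ℝ (hypPart β) z (G U W)
          + hypMetric β z U W • hypPart β z) ∧
        secondDeriv (fun w => sphPart (f w)) z U W = fderiv ℝ (fun w => sphPart (f w)) z (G U W)
          + (-(β⁻¹ ^ 2 * sphMetric β (f z) (fderiv ℝ f z U) (fderiv ℝ f z W))) • sphPart (f z) ∧
        secondDeriv (fun w => hypPart β (f w)) z U W
          = fderiv ℝ (fun w => hypPart β (f w)) z (G U W)
          + hypMetric β (f z) (fderiv ℝ f z U) (fderiv ℝ f z W) • hypPart β (f z)) ∧
      ∀ U W, β⁻¹ ^ 2 * (sphMetric β (f z) (fderiv ℝ f z U) (fderiv ℝ f z U)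
            * sphMetric β (f z) (fderiv ℝ f z W) (fderiv ℝ f z W)
            - sphMetric β (f z) (fderiv ℝ f z U) (fderiv ℝ f z W) ^ 2)
          - (hypMetric β (f z) (fderiv ℝ f z U) (fderiv ℝ f z U)
            * hypMetric β (f z) (fderiv ℝ f z W) (fderiv ℝ f z W)
            - hypMetric β (f z) (fderiv ℝ f z U) (fderiv ℝ f z W) ^ 2)
        = β⁻¹ ^ 2 * (sphMetric β z U U * sphMetric β z W W - sphMetric β z U W ^ 2)
          - (hypMetric β z U U * hypMetric β z W W - hypMetric β z U W ^ 2) := by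
  have hid : ∀ z ∈ Ω, ContDiffAt ℝ 3 (id : GVec p q → GVec p q) z := fun _ _ => contDiffAt_id
  have hsid : Function.Surjective (fderiv ℝ (id : GVec p q → GVec p q) z) := by
    rw [fderiv_id]; exact Function.surjective_id
  have hsurj : Function.Surjective (fderiv ℝ f z) :=
    surjective_fderiv_of_prodMetric (μ := fun _ => 1) hβ (hΩM hz)
      (fun U W => by rw [one_pow, one_mul, hiso z hz])
  have hfc : ∀ z ∈ Ω, ContDiffAt ℝ 3 (fun w => coneEmb β 0 (f w)) z :=
    fun z hz => (contDiffAt_coneEmb 0 (hfM z hz)).comp z (hf z hz)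
  have hic : ∀ z ∈ Ω, ContDiffAt ℝ 3 (coneEmb β 0) z := fun z hz => contDiffAt_coneEmb 0 (hΩM hz)
  have hG : ∀ U W, ∃ G, ∀ T, ambientForm p q (fderiv ℝ (coneEmb β 0) z G)
      (fderiv ℝ (coneEmb β 0) z T) = ambientForm p q (secondDeriv (coneEmb β 0) z U W)
      (fderiv ℝ (coneEmb β 0) z T) := by
    intro U W
    obtain ⟨G, hG⟩ := exists_prodMetric_eq hβ (hΩM hz)
      ((ambientForm p q (secondDeriv (coneEmb β 0) z U W)).comp (fderiv ℝ (coneEmb β 0) z))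
    exact ⟨G, fun T => by rw [ambientForm_fderiv_coneEmb (hΩM hz), hG]; rfl⟩
  choose G hG using hG
  obtain ⟨hn, hn', hgauss⟩ := gauss_of_isometric (ambientForm p q) (ambientForm p q)
    ambientForm_comm ambientForm_comm hΩ hfc hic (fun z hz U W => by
      rw [fderiv_coneEmb_comp ((hf z hz).differentiableAt (by norm_num)) (hfM z hz),
        fderiv_coneEmb_comp ((hf z hz).differentiableAt (by norm_num)) (hfM z hz),
        ambientForm_fderiv_coneEmb (hfM z hz), ambientForm_fderiv_coneEmb (hΩM hz), hiso z hz])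
    hz G hG
  refine ⟨G, fun U W => ⟨?_, ?_⟩, fun U W => ?_⟩
  · have := secondDeriv_comp_of_orthogonal hβ hΩ hid (fun z hz => hΩM hz) hz hsid U W _ (hn' U W)
    simpa only [id_eq, fderiv_id, ContinuousLinearMap.coe_id'] using this
  · exact secondDeriv_comp_of_orthogonal hβ hΩ hf hfM hz hsurj U W _ (hn U W)
  · have h := hgauss U W U W
    have h1 := ambientForm_normal hβ hΩ hf hfM hz hsurj hn
    have h2 := ambientForm_normal hβ hΩ hid (fun z hz => hΩM hz) hz hsid hn'
    simp only [id_eq, fderiv_id, ContinuousLinearMap.coe_id'] at h2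
    rw [h1, h1, h2, h2, sphMetric_comm W U, hypMetric_comm W U,
      sphMetric_comm (fderiv ℝ f z W) (fderiv ℝ f z U),
      hypMetric_comm (fderiv ℝ f z W) (fderiv ℝ f z U)] at h
    linear_combination h

/-- Two splittings of the same form with the same curvature agree on the null directions of their
second parts. -/
theorem hypPart_eq_zero_of_gauss {V : Type*} {S H S' H' : V → V → ℝ} {k : ℝ} (hk : 0 < k)
    (hS' : ∀ U, 0 ≤ S' U U) (hH0 : ∀ U, 0 ≤ H' U U)
    (hH : ∀ U W, H U W ^ 2 ≤ H U U * H W W) (hH' : ∀ U W, H' U W ^ 2 ≤ H' U U * H' W W)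
    (hadd : ∀ U W, S U W + H U W = S' U W + H' U W)
    (hg : ∀ U W, k * (S U U * S W W - S U W ^ 2) - (H U U * H W W - H U W ^ 2)
      = k * (S' U U * S' W W - S' U W ^ 2) - (H' U U * H' W W - H' U W ^ 2))
    {e w : V} (he : S e e + H e e = 1) (hw : S w w + H w w = 1) (hew : S e w + H e w = 0)
    (hw0 : H w w = 0) (he0 : H e e = 0) : H' e e = 0 := by
  have d0 : H e w = 0 := by
    have := hH e w
    rw [he0, zero_mul] at this
    exact pow_eq_zero_iff two_ne_zero |>.1 (le_antisymm this (sq_nonneg _))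
  have a1 := hadd e e
  have a2 := hadd e w
  have a3 := hadd w w
  have e1 : H' e e = 1 - S' e e := by linarith
  have e2 : H' e w = -S' e w := by linarith
  have e3 : H' w w = 1 - S' w w := by linarith
  have g := hg e w
  have c := hH' e w
  have c1 := hH0 e
  have c2 := hH0 w
  rw [e1, e2, e3, neg_sq] at c
  rw [he0, hw0, d0, e1, e2, e3, neg_sq] at g
  rw [he0, add_zero] at he
  rw [hw0, add_zero] at hw
  rw [d0, add_zero] at hew
  have := hypMetric_eq_zero_of_gauss hk c (hS' e) (by linarith) (by linarith) he hw hew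
    (by rw [he, hw, hew] at g ⊢; linarith)
  linarith

theorem hypMetric_fderiv_eq_zero_iff (hβ : β ≠ 0) (hp : 3 ≤ p) (hΩ : IsOpen Ω) (hΩM : Ω ⊆ GM0 p q)
    (hf : ∀ z ∈ Ω, ContDiffAt ℝ 3 f z) (hfM : ∀ z ∈ Ω, f z ∈ GM0 p q)
    (hiso : ∀ z ∈ Ω, ∀ U W, prodMetric β (f z) (fderiv ℝ f z U) (fderiv ℝ f z W)
      = prodMetric β z U W) (hz : z ∈ Ω) (e : GVec p q) :
    hypMetric β (f z) (fderiv ℝ f z e) (fderiv ℝ f z e) = 0 ↔ hypMetric β z e e = 0 := by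
  obtain ⟨-, -, hgauss⟩ := exists_tangential_of_isometric hβ hΩ hΩM hf hfM hiso hz
  have hsurj : Function.Surjective (fderiv ℝ f z) :=
    surjective_fderiv_of_prodMetric (μ := fun _ => 1) hβ (hΩM hz)
      (fun U W => by rw [one_pow, one_mul, hiso z hz])
  have hfz := hfM z hz
  have hz0 := hΩM hz
  have hk : 0 < β⁻¹ ^ 2 := by positivity
  have hadd : ∀ U W, sphMetric β (f z) (fderiv ℝ f z U) (fderiv ℝ f z W)
      + hypMetric β (f z) (fderiv ℝ f z U) (fderiv ℝ f z W)
      = sphMetric β z U W + hypMetric β z U W := fun U W => by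
    rw [sphMetric_add_hypMetric hfz, sphMetric_add_hypMetric hz0, hiso z hz]
  have unit : ∀ e, prodMetric β z e e = 1 →
      (hypMetric β (f z) (fderiv ℝ f z e) (fderiv ℝ f z e) = 0 ↔ hypMetric β z e e = 0) := by
    intro e he
    have he' := he
    rw [← hiso z hz] at he'
    constructor
    · obtain ⟨w, hw0, hw1, hw2⟩ := exists_orthogonal_of_hypMetric_eq_zero hβ hp hfz
        (fderiv ℝ f z e)
      obtain ⟨w, rfl⟩ := hsurj w
      rw [← sphMetric_add_hypMetric hfz] at he' hw1 hw2
      exact hypPart_eq_zero_of_gauss (S' := sphMetric β z) (H' := hypMetric β z)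
        (S := fun U W => sphMetric β (f z) (fderiv ℝ f z U) (fderiv ℝ f z W))
        (H := fun U W => hypMetric β (f z) (fderiv ℝ f z U) (fderiv ℝ f z W)) hk
        (fun U => sphMetric_self_nonneg hz0 U)
        (fun U => hypMetric_self_nonneg U) (fun U W => hypMetric_sq_le _ _)
        (fun U W => hypMetric_sq_le _ _) hadd hgauss he' hw1 hw2 hw0
    · obtain ⟨w, hw0, hw1, hw2⟩ := exists_orthogonal_of_hypMetric_eq_zero hβ hp hz0 e
      rw [← sphMetric_add_hypMetric hz0] at he hw1 hw2
      exact hypPart_eq_zero_of_gauss (S := sphMetric β z) (H := hypMetric β z)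
        (S' := fun U W => sphMetric β (f z) (fderiv ℝ f z U) (fderiv ℝ f z W))
        (H' := fun U W => hypMetric β (f z) (fderiv ℝ f z U) (fderiv ℝ f z W)) hk
        (fun U => sphMetric_self_nonneg hfz _)
        (fun U => hypMetric_self_nonneg _) (fun U W => hypMetric_sq_le _ _)
        (fun U W => hypMetric_sq_le _ _) (fun U W => (hadd U W).symm)
        (fun U W => (hgauss U W).symm) he hw1 hw2 hw0
  rcases eq_or_ne e 0 with rfl | he
  · simp [hypMetric]
  · have h0 := prodMetric_self_pos hβ hz0 he
    have hs := Real.sqrt_pos.2 h0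
    have := unit ((Real.sqrt (prodMetric β z e e))⁻¹ • e) (by
      rw [prodMetric_smul_smul, ← mul_inv, Real.mul_self_sqrt h0.le, inv_mul_cancel₀ h0.ne'])
    rw [map_smul, hypMetric_smul_smul, hypMetric_smul_smul] at this
    simpa [hs.ne'] using this

/-- An isometry of the product metric preserves the spherical and the hyperbolic part. -/
theorem sphMetric_eq_of_isometric (hβ : β ≠ 0) (hp : 3 ≤ p) (hΩ : IsOpen Ω) (hΩM : Ω ⊆ GM0 p q)
    (hf : ∀ z ∈ Ω, ContDiffAt ℝ 3 f z) (hfM : ∀ z ∈ Ω, f z ∈ GM0 p q)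
    (hiso : ∀ z ∈ Ω, ∀ U W, prodMetric β (f z) (fderiv ℝ f z U) (fderiv ℝ f z W)
      = prodMetric β z U W) (hz : z ∈ Ω) (U W : GVec p q) :
    sphMetric β (f z) (fderiv ℝ f z U) (fderiv ℝ f z W) = sphMetric β z U W := by
  have hsurj : Function.Surjective (fderiv ℝ f z) :=
    surjective_fderiv_of_prodMetric (μ := fun _ => 1) hβ (hΩM hz)
      (fun U W => by rw [one_pow, one_mul, hiso z hz])
  have hfz := hfM z hz
  have hz0 := hΩM hz
  have hadd : ∀ U W, sphMetric β (f z) (fderiv ℝ f z U) (fderiv ℝ f z W)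
      + hypMetric β (f z) (fderiv ℝ f z U) (fderiv ℝ f z W)
      = sphMetric β z U W + hypMetric β z U W := fun U W => by
    rw [sphMetric_add_hypMetric hfz, sphMetric_add_hypMetric hz0, hiso z hz]
  have hlift : ∀ U, ∃ V, hypMetric β (f z) (fderiv ℝ f z V) (fderiv ℝ f z V) = 0 ∧
      ∀ W, sphMetric β (f z) (fderiv ℝ f z V) (fderiv ℝ f z W)
        = sphMetric β (f z) (fderiv ℝ f z U) (fderiv ℝ f z W) := by
    intro U
    obtain ⟨V, h1, h2⟩ := exists_lift_sphMetric (β := β) hfz (fderiv ℝ f z U)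
    obtain ⟨V, rfl⟩ := hsurj V
    exact ⟨V, h1, fun W => h2 (fderiv ℝ f z W)⟩
  exact eq_of_add_eq_add_of_ker_eq
    (S := fun U W => sphMetric β (f z) (fderiv ℝ f z U) (fderiv ℝ f z W))
    (H := fun U W => hypMetric β (f z) (fderiv ℝ f z U) (fderiv ℝ f z W))
    (S' := sphMetric β z) (H' := hypMetric β z)
    (fun U W => sphMetric_comm _ _) (fun U W => sphMetric_comm _ _)
    (fun U W => hypMetric_sq_le _ _) (fun U W => hypMetric_sq_le _ _) hadd
    (hypMetric_fderiv_eq_zero_iff hβ hp hΩ hΩM hf hfM hiso hz) hlift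
    (exists_lift_sphMetric hz0) U W

end Splitting

section LinearAction

variable {p q : ℕ} {β c : ℝ} {z : GVec p q}
variable {f : GVec p q → GVec p q} {Ω : Set (GVec p q)}

theorem fderiv_hypPart_eq_zero (hz : z ∈ GM0 p q) {U : GVec p q}
    (h : hypMetric β z U U = 0) : fderiv ℝ (hypPart β) z U = 0 := by
  have h0 := norm_fst_pos hz
  have hr := Real.rpow_pos_of_pos h0 β
  have h1 : β * ⟪z.1, U.1⟫ / ‖z.1‖ ^ 2 = 0 ∧ U.2 = 0 := by
    unfold hypMetric at h
    have h2 : 0 ≤ ((‖z.1‖ ^ β)⁻¹) ^ 2 * ⟪U.2, U.2⟫ := mul_nonneg (by positivity) real_inner_self_nonneg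
    rw [add_eq_zero_iff_of_nonneg (mul_self_nonneg _) h2] at h
    exact ⟨mul_self_eq_zero.1 h.1, by simpa [hr.ne'] using h.2⟩
  rw [fderiv_hypPart hz, h1.1, h1.2]
  simp

/-- An isometry of the product metric acts linearly on the sphere and on the hyperboloid. -/
theorem exists_linear_of_isometric (hβ : β ≠ 0) (hp : 3 ≤ p) (hΩ : IsOpen Ω)
    (hΩc : IsConnected Ω) (hΩM : Ω ⊆ GM0 p q)
    (hf : ∀ z ∈ Ω, ContDiffAt ℝ 3 f z) (hfM : ∀ z ∈ Ω, f z ∈ GM0 p q)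
    (hiso : ∀ z ∈ Ω, ∀ U W, prodMetric β (f z) (fderiv ℝ f z U) (fderiv ℝ f z W)
      = prodMetric β z U W) :
    (∃ A : EuclideanSpace ℝ (Fin p) →ₗ[ℝ] EuclideanSpace ℝ (Fin p),
      (∀ w w', ⟪A w, A w'⟫ = ⟪w, w'⟫) ∧ ∀ z ∈ Ω, sphPart (f z) = A (sphPart z)) ∧
    ∃ M : LVec q →ₗ[ℝ] LVec q, (∀ w w', lorentzForm q (M w) (M w') = lorentzForm q w w') ∧
      ∀ z ∈ Ω, hypPart β (f z) = M (hypPart β z) := by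
  have hT : ∀ z : GVec p q, ∃ G : GVec p q → GVec p q → GVec p q, z ∈ Ω → _ := fun z => by
    by_cases hz : z ∈ Ω
    · obtain ⟨G, hG⟩ := exists_tangential_of_isometric hβ hΩ hΩM hf hfM hiso hz
      exact ⟨G, fun _ => hG.1⟩
    · exact ⟨fun _ _ => 0, fun h => absurd h hz⟩
  choose G hG using hT
  have hS := fun z (hz : z ∈ Ω) => sphMetric_eq_of_isometric hβ hp hΩ hΩM hf hfM hiso hz
  have hH : ∀ z ∈ Ω, ∀ U W, hypMetric β (f z) (fderiv ℝ f z U) (fderiv ℝ f z W)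
      = hypMetric β z U W := fun z hz U W => by
    have := hiso z hz U W
    rw [← sphMetric_add_hypMetric (hfM z hz), ← sphMetric_add_hypMetric (hΩM hz),
      hS z hz] at this
    exact add_left_cancel this
  have hdf : ∀ z ∈ Ω, DifferentiableAt ℝ f z := fun z hz => (hf z hz).differentiableAt (by norm_num)
  have hb2 : (0:ℝ) < β ^ 2 := by positivity
  have hiso1 : ∀ z ∈ Ω, ∀ U W, ⟪fderiv ℝ (fun w => sphPart (f w)) z U,
      fderiv ℝ (fun w => sphPart (f w)) z W⟫ = ⟪fderiv ℝ sphPart z U, fderiv ℝ sphPart z W⟫ :=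
    fun z hz U W => by
    rw [fderiv_sphPart_comp (hdf z hz) (hfM z hz), fderiv_sphPart_comp (hdf z hz) (hfM z hz)]
    apply mul_left_cancel₀ hb2.ne'
    rw [sq_mul_inner_fderiv_sphPart (hfM z hz), sq_mul_inner_fderiv_sphPart (hΩM hz), hS z hz]
  constructor
  · exact exists_linear_of_secondDeriv_eq (V := GVec p q) (innerSL ℝ)
      (fun a b : EuclideanSpace ℝ (Fin p) => real_inner_comm b a) hΩ hΩc (X := sphPart)
      (F := fun w => sphPart (f w)) (fun z hz => contDiffAt_sphPart (hΩM hz))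
      (fun z hz => contDiffAt_sphPart_comp (hf z hz) (hfM z hz)) 1 (by norm_num)
      (fun z hz => inner_sphPart_self (hΩM hz)) (fun z hz => inner_sphPart_self (hfM z hz))
      hiso1
      (fun z hz U hU => by
        have := hiso1 z hz U U
        rw [hU, inner_zero_left] at this
        exact inner_self_eq_zero.1 this)
      sphLift (fun w z hz => differentiableAt_sphLift (hΩM hz) w)
      (fun z hz w => by rw [fderiv_sphPart_sphLift (hΩM hz), one_mul]; rfl)
      G (fun z U W => -(β⁻¹ ^ 2 * sphMetric β z U W))
      (fun z hz U W => (hG z hz U W).1.1)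
      (fun z hz U W => by rw [(hG z hz U W).2.1, hS z hz])
  · refine exists_linear_of_secondDeriv_eq (V := GVec p q) (lorentzForm q)
      lorentzForm_comm hΩ hΩc (X := hypPart β)
      (F := fun w => hypPart β (f w)) (fun z hz => contDiffAt_hypPart (hΩM hz))
      (fun z hz => contDiffAt_hypPart_comp (hf z hz) (hfM z hz)) (-1) (by norm_num)
      (fun z hz => lorentzForm_hypPart_self (hΩM hz))
      (fun z hz => lorentzForm_hypPart_self (hfM z hz))
      (fun z hz U W => ?_) (fun z hz U hU => ?_)
      (hypLift β) (fun w z hz => differentiableAt_hypLift (hΩM hz) w)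
      (fun z hz w => by
        rw [fderiv_hypPart_hypLift hβ (hΩM hz), neg_one_mul, neg_smul, sub_neg_eq_add])
      G (fun z U W => hypMetric β z U W)
      (fun z hz U W => (hG z hz U W).1.2)
      (fun z hz U W => by rw [(hG z hz U W).2.2, hH z hz])
    · rw [fderiv_hypPart_comp (hdf z hz) (hfM z hz), fderiv_hypPart_comp (hdf z hz) (hfM z hz),
        lorentzForm_fderiv_hypPart (hfM z hz), lorentzForm_fderiv_hypPart (hΩM hz), hH z hz]
    · rw [fderiv_hypPart_comp (hdf z hz) (hfM z hz)]
      apply fderiv_hypPart_eq_zero (hfM z hz)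
      rw [hH z hz, ← lorentzForm_fderiv_hypPart (hΩM hz), hU, map_zero]

end LinearAction

section CauchyRiemann

variable {p q : ℕ} {α β c : ℝ} {z : GVec p q}
variable {f : GVec p q → GVec p q} {u : GVec p q → ℝ} {Ω : Set (GVec p q)}

theorem prodMetric_eq_ghat (hα : 0 < α) (hz : z ∈ GM0 p q) (U W : GVec p q) :
    prodMetric (α + 1) z U W = (α + 1) ^ 2 / ‖z.1‖ ^ 2 * ghat α p q z.1 U W := by
  have h0 := norm_fst_pos hz
  have h1 := Real.rpow_pos_of_pos h0 α
  have h2 : ‖z.1‖ ^ (α + 1) = ‖z.1‖ ^ α * ‖z.1‖ := by rw [Real.rpow_add h0, Real.rpow_one]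
  have h3 : ‖z.1‖ ^ (2 * α) = (‖z.1‖ ^ α) ^ 2 := by
    rw [mul_comm, Real.rpow_mul h0.le, Real.rpow_ofNat]
  unfold prodMetric ghat
  rw [h2, h3]
  field_simp

theorem contDiffAt_prodMetric_fderiv {m n : WithTop ℕ∞} (hΩ : IsOpen Ω)
    (hf : ∀ z ∈ Ω, ContDiffAt ℝ n f z) (hfM : ∀ z ∈ Ω, f z ∈ GM0 p q) (hmn : m + 1 ≤ n)
    (hz : z ∈ Ω) (U : GVec p q) :
    ContDiffAt ℝ m (fun w => prodMetric β (f w) (fderiv ℝ f w U) (fderiv ℝ f w U)) z := by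
  have h1 : ContDiffAt ℝ m (fun w => fderiv ℝ (fun w => coneEmb β 0 (f w)) w U) z :=
    ((contDiffAt_coneEmb 0 (hfM z hz)).comp z (hf z hz) :
      ContDiffAt ℝ n (fun w => coneEmb β 0 (f w)) z).fderiv_apply_const hmn U
  have h2 := ((contDiffAt_const (c := ambientForm p q)).clm_apply h1).clm_apply h1
  refine h2.congr_of_eventuallyEq ?_
  filter_upwards [hΩ.mem_nhds hz] with w hw
  have hd : DifferentiableAt ℝ f w := (hf w hw).differentiableAt (by
    rintro rfl
    simp at hmn)
  rw [fderiv_coneEmb_comp hd (hfM w hw), ambientForm_fderiv_coneEmb (hfM w hw)]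

/-- A solution of the Cauchy-Riemann system is an isometry of the product metric. -/
theorem prodMetric_eq_of_conformal (hα : 0 < α) (hp : 3 ≤ p) (hq : 1 ≤ q) (hΩ : IsOpen Ω)
    (hΩM : Ω ⊆ GM0 p q) (hf : ∀ z ∈ Ω, ContDiffAt ℝ 4 f z) (hfM : ∀ z ∈ Ω, f z ∈ GM0 p q)
    (hu : ∀ z ∈ Ω, 0 < u z)
    (hCR : ∀ z ∈ Ω, ∀ U V : GVec p q,
      ghat α p q (f z).1 (fderiv ℝ f z U) (fderiv ℝ f z V) = (u z ^ 2)⁻¹ * ghat α p q z.1 U V)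
    (hz : z ∈ Ω) (U W : GVec p q) :
    prodMetric (α + 1) (f z) (fderiv ℝ f z U) (fderiv ℝ f z W) = prodMetric (α + 1) z U W := by
  have hβ : α + 1 ≠ 0 := by positivity
  set μ : GVec p q → ℝ := fun z => ‖(f z).1‖ * u z / ‖z.1‖ with hμ
  have hμ0 : ∀ z ∈ Ω, 0 < μ z := fun z hz =>
    div_pos (mul_pos (norm_fst_pos (hfM z hz)) (hu z hz)) (norm_fst_pos (hΩM hz))
  have hiso : ∀ z ∈ Ω, ∀ U W, μ z ^ 2 * prodMetric (α + 1) (f z) (fderiv ℝ f z U)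
      (fderiv ℝ f z W) = prodMetric (α + 1) z U W := fun z hz U W => by
    have h0 := norm_fst_pos (hΩM hz)
    have h1 := norm_fst_pos (hfM z hz)
    have h2 := hu z hz
    rw [prodMetric_eq_ghat hα (hfM z hz), prodMetric_eq_ghat hα (hΩM hz), hCR z hz, hμ]
    field_simp
  have hsm : ∀ z ∈ Ω, ContDiffAt ℝ 3 μ z := by
    intro z hz
    have : Nontrivial (GVec p q) := by
      have : Nonempty (Fin p) := ⟨⟨0, by omega⟩⟩
      infer_instance
    obtain ⟨e, he⟩ := exists_ne (0 : GVec p q)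
    have hpos := prodMetric_self_pos hβ (hΩM hz) he
    have hne : prodMetric (α + 1) (f z) (fderiv ℝ f z e) (fderiv ℝ f z e) ≠ 0 := fun h => by
      rw [← hiso z hz, h, mul_zero] at hpos
      exact lt_irrefl _ hpos
    have h1 := contDiffAt_prodMetric_fderiv (β := α + 1) (m := 3) hΩ hf hfM (by norm_num) hz e
    have h2 := contDiffAt_prodMetric_fderiv (β := α + 1) (f := id) (m := 3) (n := 4) hΩ
      (fun _ _ => contDiffAt_id) (fun z hz => hΩM hz) (by norm_num) hz e
    simp only [id_eq, fderiv_id, ContinuousLinearMap.coe_id'] at h2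
    refine ((h2.div h1 hne).sqrt (div_ne_zero hpos.ne' hne)).congr_of_eventuallyEq ?_
    filter_upwards [hΩ.mem_nhds hz] with w hw
    have hposw := prodMetric_self_pos hβ (hΩM hw) he
    simp only [Pi.div_apply]
    rw [← hiso w hw, mul_div_cancel_right₀, Real.sqrt_sq (hμ0 w hw).le]
    intro h
    rw [← hiso w hw, h, mul_zero] at hposw
    exact lt_irrefl _ hposw
  have h1 := conformal_factor_sq_eq_one hβ (by nlinarith) hp hq hΩ hΩM
    (fun z hz => (hf z hz).of_le (by norm_num)) hsm hfM (fun z hz => (hμ0 z hz).ne') hiso hz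
  rw [← hiso z hz, h1, one_mul]

end CauchyRiemann

section HalfSpace

variable {p q : ℕ}

/-- The point of the hyperboloid with upper half space coordinates `(r, y)`. -/
def halfSpacePoint (r : ℝ) (y : EuclideanSpace ℝ (Fin q)) : LVec q :=
  (r⁻¹ • y, r⁻¹, r + r⁻¹ * ‖y‖ ^ 2)

/-- The null vector `(0, 0, 1)`, the point at infinity of the half space. -/
def infVec (q : ℕ) : LVec q := (0, 0, 1)

theorem lorentzForm_infVec (w : LVec q) : lorentzForm q w (infVec q) = -w.2.1 / 2 := by
  rw [lorentzForm_apply, infVec]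
  simp
  ring

/-- Null translates of horizontal vectors. -/
def horoLift (b : EuclideanSpace ℝ (Fin q)) : EuclideanSpace ℝ (Fin q) →ₗ[ℝ] LVec q where
  toFun w := (w, 0, 2 * ⟪b, w⟫)
  map_add' v w := by simp [inner_add_right, mul_add]
  map_smul' s w := by simp [real_inner_smul_right, mul_left_comm]

theorem lorentzForm_horoLift (b w w' : EuclideanSpace ℝ (Fin q)) :
    lorentzForm q (horoLift b w) (horoLift b w') = ⟪w, w'⟫ := by
  rw [lorentzForm_apply]
  simp [horoLift]

theorem inner_fst_map_horoLift {M : LVec q →ₗ[ℝ] LVec q}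
    (hM : ∀ w w', lorentzForm q (M w) (M w') = lorentzForm q w w')
    (b : EuclideanSpace ℝ (Fin q)) (h : ∀ w, (M (horoLift b w)).2.1 = 0)
    (w w' : EuclideanSpace ℝ (Fin q)) :
    ⟪(M (horoLift b w)).1, (M (horoLift b w')).1⟫ = ⟪w, w'⟫ := by
  rw [← lorentzForm_horoLift b w w', ← hM, lorentzForm_apply, h, h]
  simp

theorem injective_of_lorentzForm {M : LVec q →ₗ[ℝ] LVec q}
    (hM : ∀ w w', lorentzForm q (M w) (M w') = lorentzForm q w w') : Function.Injective M := by
  rw [← LinearMap.ker_eq_bot, LinearMap.ker_eq_bot']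
  intro m hm
  refine eq_zero_of_lorentzForm_eq_zero fun w => ?_
  rw [← hM, hm, map_zero]; rfl

/-- Lorentz transformations act on the half space as similarities or inversions. -/
theorem exists_halfSpace_action {M : LVec q →ₗ[ℝ] LVec q}
    (hM : ∀ w w', lorentzForm q (M w) (M w') = lorentzForm q w w')
    (hex : ∃ r r' y y', 0 < r ∧ 0 < r' ∧ M (halfSpacePoint r y) = halfSpacePoint r' y') :
    ∃ (B : EuclideanSpace ℝ (Fin q) →ₗ[ℝ] EuclideanSpace ℝ (Fin q))
      (b' b : EuclideanSpace ℝ (Fin q)) (a : ℝ), (∀ w w', ⟪B w, B w'⟫ = ⟪w, w'⟫) ∧ 0 < a ∧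
      ((∀ r r' y y', 0 < r → 0 < r' → M (halfSpacePoint r y) = halfSpacePoint r' y' →
          r' = a⁻¹ * r ∧ y' = B (a⁻¹ • (y - b)) + b') ∨
        ∀ r r' y y', 0 < r → 0 < r' → M (halfSpacePoint r y) = halfSpacePoint r' y' →
          r' = (a * (r ^ 2 + ‖y - b‖ ^ 2))⁻¹ * r ∧
            y' = B ((a * (r ^ 2 + ‖y - b‖ ^ 2))⁻¹ • (y - b)) + b') := by
  obtain ⟨m, hm⟩ := LinearMap.injective_iff_surjective.1 (injective_of_lorentzForm hM) (infVec q)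
  obtain ⟨v, a, d⟩ := m
  have hnull : ‖v‖ ^ 2 = a * d := by
    have := hM (v, a, d) (v, a, d)
    rw [hm, lorentzForm_infVec, lorentzForm_apply] at this
    simp [infVec] at this
    linarith
  have hsnd : ∀ w, (M w).2.1 = -2 * lorentzForm q w (v, a, d) := fun w => by
    rw [← hM, hm, lorentzForm_infVec]; ring
  have hr : ∀ r r' y y', M (halfSpacePoint r y) = halfSpacePoint r' y' →
      r'⁻¹ = r⁻¹ * d + (r + r⁻¹ * ‖y‖ ^ 2) * a - 2 * (r⁻¹ * ⟪y, v⟫) := by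
    intro r r' y y' h
    have := hsnd (halfSpacePoint r y)
    rw [h, lorentzForm_apply] at this
    simp only [halfSpacePoint, real_inner_smul_left] at this
    linarith
  obtain ⟨r₀, r₀', y₀, y₀', hr₀, hr₀', h₀⟩ := hex
  have hpos := inv_pos.2 hr₀'
  rw [hr _ _ _ _ h₀] at hpos
  rcases eq_or_ne a 0 with rfl | ha
  · obtain rfl : v = 0 := by simpa using hnull
    have hd : 0 < d := by
      simp only [mul_zero, add_zero, inner_zero_right, sub_zero] at hpos
      exact pos_of_mul_pos_right hpos (inv_pos.2 hr₀).le
    have hinf : (M (infVec q)).1 = 0 := by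
      have : infVec q = d⁻¹ • ((0, 0, d) : LVec q) := by
        simp [infVec, hd.ne']
      rw [this, map_smul, hm]
      simp [infVec]
    have hB := inner_fst_map_horoLift hM 0 fun w => by
      rw [hsnd, lorentzForm_apply]; simp [horoLift]
    refine ⟨LinearMap.fst ℝ _ _ ∘ₗ M ∘ₗ horoLift 0, d⁻¹ • (M (0, 1, 0)).1, 0, d, hB, hd,
      Or.inl fun r r' y y' hr0 hr0' h => ?_⟩
    have h1 : r' = d⁻¹ * r := by
      have := hr _ _ _ _ h
      simp only [mul_zero, add_zero, inner_zero_right, sub_zero] at this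
      rw [← inv_inv r', this, mul_inv, inv_inv, mul_comm]
    refine ⟨h1, ?_⟩
    have h2 : halfSpacePoint r y
        = r⁻¹ • (horoLift 0 y + (0, 1, 0) + (r ^ 2 + ‖y‖ ^ 2) • infVec q) := by
      refine Prod.ext ?_ (Prod.ext ?_ ?_) <;> simp [halfSpacePoint, horoLift, infVec]
      field_simp
    have h3 := congrArg Prod.fst h
    rw [h2] at h3
    simp only [map_smul, map_add, Prod.smul_fst, Prod.fst_add, hinf, smul_zero, add_zero,
      halfSpacePoint] at h3
    have h4 : y' = (r' * r⁻¹) • ((M (horoLift 0 y)).1 + (M (0, 1, 0)).1) := by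
      rw [mul_smul, h3, smul_smul, mul_inv_cancel₀ hr0'.ne', one_smul]
    rw [h4, h1, mul_assoc, mul_inv_cancel₀ hr0.ne', mul_one, smul_add, sub_zero, map_smul]
    rfl
  · set b := a⁻¹ • v with hb
    have hv : v = a • b := by rw [hb, smul_smul, mul_inv_cancel₀ ha, one_smul]
    have hd : d = a * ‖b‖ ^ 2 := by
      rw [hv, norm_smul, mul_pow, Real.norm_eq_abs, sq_abs] at hnull
      apply mul_left_cancel₀ ha
      rw [← hnull]; ring
    have hr2 : ∀ r r' y y', 0 < r → M (halfSpacePoint r y) = halfSpacePoint r' y' →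
        r'⁻¹ = a * (r ^ 2 + ‖y - b‖ ^ 2) * r⁻¹ := by
      intro r r' y y' hr0 h
      rw [hr _ _ _ _ h, norm_sub_sq_real, hd, hv, real_inner_smul_right]
      field_simp
      ring
    have ha0 : 0 < a := by
      rw [← hr _ _ _ _ h₀, hr2 _ _ _ _ hr₀ h₀] at hpos
      exact pos_of_mul_pos_left (pos_of_mul_pos_left hpos (inv_pos.2 hr₀).le) (by positivity)
    have hbM : (M (b, 1, ‖b‖ ^ 2)).1 = 0 := by
      have : ((b, 1, ‖b‖ ^ 2) : LVec q) = a⁻¹ • (v, a, d) := by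
        simp [hv, hd, smul_smul, ha]
      rw [this, map_smul, hm]
      simp [infVec]
    have hB := inner_fst_map_horoLift hM b fun w => by
      rw [hsnd, lorentzForm_apply, hv, hd]
      simp [horoLift, real_inner_smul_right, real_inner_comm b w]
      ring_nf
    refine ⟨LinearMap.fst ℝ _ _ ∘ₗ M ∘ₗ horoLift b, a⁻¹ • (M (infVec q)).1, b, a, hB, ha0,
      Or.inr fun r r' y y' hr0 hr0' h => ?_⟩
    have hN : 0 < r ^ 2 + ‖y - b‖ ^ 2 := by positivity
    have h1 : r' = (a * (r ^ 2 + ‖y - b‖ ^ 2))⁻¹ * r := by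
      rw [← inv_inv r', hr2 _ _ _ _ hr0 h, mul_inv, inv_inv]
    refine ⟨h1, ?_⟩
    have h2 : halfSpacePoint r y = r⁻¹ • (horoLift b (y - b) + (b, 1, ‖b‖ ^ 2)
        + (r ^ 2 + ‖y - b‖ ^ 2) • infVec q) := by
      refine Prod.ext ?_ (Prod.ext ?_ ?_) <;> simp [halfSpacePoint, horoLift, infVec]
      rw [norm_sub_sq_real, inner_sub_right, real_inner_self_eq_norm_sq, real_inner_comm]
      field_simp
      ring
    have h3 := congrArg Prod.fst h
    rw [h2] at h3
    simp only [map_smul, map_add, Prod.smul_fst, Prod.fst_add, hbM, add_zero,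
      halfSpacePoint] at h3
    have h4 : y' = (r' * r⁻¹) • ((M (horoLift b (y - b))).1
        + (r ^ 2 + ‖y - b‖ ^ 2) • (M (infVec q)).1) := by
      rw [mul_smul, h3, smul_smul, mul_inv_cancel₀ hr0'.ne', one_smul]
    rw [h4, h1, mul_assoc, mul_inv_cancel₀ hr0.ne', mul_one, smul_add, map_smul, smul_smul,
      mul_inv, mul_assoc, inv_mul_cancel₀ hN.ne', mul_one]
    rfl

end HalfSpace

def linearIsometryEquivOfInner {n : ℕ}
    (A : EuclideanSpace ℝ (Fin n) →ₗ[ℝ] EuclideanSpace ℝ (Fin n))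
    (hA : ∀ w w', ⟪A w, A w'⟫ = ⟪w, w'⟫) :
    EuclideanSpace ℝ (Fin n) ≃ₗᵢ[ℝ] EuclideanSpace ℝ (Fin n) :=
  (A.isometryOfInner hA).toLinearIsometryEquiv rfl

/-- A point is recovered from its radius, its spherical part and its vertical part. -/
theorem eq_gdil_of_parts {α : ℝ} {p q : ℕ} (hα : 0 < α) {z z' : GVec p q} (hz : z ∈ GM0 p q)
    (hz' : z' ∈ GM0 p q)
    {A : EuclideanSpace ℝ (Fin p) ≃ₗᵢ[ℝ] EuclideanSpace ℝ (Fin p)}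
    {B : EuclideanSpace ℝ (Fin q) ≃ₗᵢ[ℝ] EuclideanSpace ℝ (Fin q)}
    {b' b : EuclideanSpace ℝ (Fin q)} {τ κ : ℝ} (hτ : 0 ≤ τ) (hκ : τ ^ (α + 1) = κ)
    (hA : sphPart z' = A (sphPart z))
    (hr : ‖z'.1‖ ^ (α + 1) = κ * ‖z.1‖ ^ (α + 1))
    (hy : z'.2 = B (κ • (z.2 - b)) + b') :
    z' = ((fun w : GVec p q => (A w.1, B w.2 + b')) (gdil α p q τ (z.1, z.2 - b))) := by
  have h0 := norm_fst_pos hz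
  have h0' := norm_fst_pos hz'
  have h1 : ‖z'.1‖ = τ * ‖z.1‖ := by
    rw [← hκ, ← Real.mul_rpow hτ h0.le] at hr
    exact (Real.rpow_left_inj h0'.le (by positivity) (by positivity)).1 hr
  refine Prod.ext ?_ ?_
  · change z'.1 = A (τ • z.1)
    have h2 : z'.1 = ‖z'.1‖ • sphPart z' := by
      rw [sphPart, smul_smul, mul_inv_cancel₀ h0'.ne', one_smul]
    rw [h2, hA, h1, sphPart, map_smul, map_smul, smul_smul, mul_assoc, mul_inv_cancel₀ h0.ne',
      mul_one]
  · rw [hy, ← hκ]; rfl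

theorem homNorm_rpow {α : ℝ} {p q : ℕ} (hα : 0 < α) (z : GVec p q) :
    (homNorm α p q z ^ (-2 : ℝ)) ^ (α + 1) = ((‖z.1‖ ^ (α + 1)) ^ 2 + ‖z.2‖ ^ 2)⁻¹ := by
  have h1 : ‖z.1‖ ^ (2 * (α + 1)) = (‖z.1‖ ^ (α + 1)) ^ 2 := by
    rw [mul_comm, Real.rpow_mul (norm_nonneg _), Real.rpow_ofNat]
  have h2 : 0 ≤ (‖z.1‖ ^ (α + 1)) ^ 2 + ‖z.2‖ ^ 2 := by positivity
  rw [homNorm, h1, ← Real.rpow_mul h2, ← Real.rpow_mul h2, ← Real.rpow_neg_one]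
  congr 1
  field_simp

/-- Liouville theorem for smooth conformal diffeomorphisms of the
Riemannian metric `ĝ` on `M₀`, `p ≥ 3`, `q ≥ 1`. -/
theorem grushin_liouville_riemannian
    (α : ℝ) (hα : 0 < α) (p q : ℕ) (hp : 3 ≤ p) (hq : 1 ≤ q)
    (Ω Ω' : Set (GVec p q)) (hΩ : Ω ⊆ GM0 p q) (hΩ' : Ω' ⊆ GM0 p q)
    (hΩo : IsOpen Ω) (hΩc : IsConnected Ω) (hΩ'o : IsOpen Ω') (hΩ'c : IsConnected Ω')
    (f finv : GVec p q → GVec p q)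
    (hf : ContDiffOn ℝ (⊤ : ℕ∞) f Ω) (hbij : Set.BijOn f Ω Ω')
    (hfinv : ContDiffOn ℝ (⊤ : ℕ∞) finv Ω') (hinv : Set.InvOn finv f Ω Ω')
    (u : GVec p q → ℝ) (hu : ∀ z ∈ Ω, 0 < u z)
    (hCR : ∀ z ∈ Ω, ∀ U V : GVec p q,
      ghat α p q (f z).1 (fderiv ℝ f z U) (fderiv ℝ f z V) = (u z ^ 2)⁻¹ * ghat α p q z.1 U V) :
    ∃ (A : EuclideanSpace ℝ (Fin p) ≃ₗᵢ[ℝ] EuclideanSpace ℝ (Fin p))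
      (B : EuclideanSpace ℝ (Fin q) ≃ₗᵢ[ℝ] EuclideanSpace ℝ (Fin q))
      (b' b : EuclideanSpace ℝ (Fin q)) (t s : ℝ),
      0 < t ∧ (s = 0 ∨ s = -2) ∧
      ∀ z ∈ Ω,
        f z = ((fun w : GVec p q => (A w.1, B w.2 + b'))
          (gdil α p q (t * homNorm α p q (z.1, z.2 - b) ^ s) (z.1, z.2 - b))) := by
  have hβ : α + 1 ≠ 0 := by positivity
  have hf4 : ∀ z ∈ Ω, ContDiffAt ℝ 4 f z := fun z hz =>
    ((hf z hz).contDiffAt (hΩo.mem_nhds hz)).of_le (WithTop.coe_le_coe.2 (le_top : (4 : ℕ∞) ≤ ⊤))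
  have hfM : ∀ z ∈ Ω, f z ∈ GM0 p q := fun z hz => hΩ' (hbij.mapsTo hz)
  obtain ⟨⟨A, hA, hAf⟩, M, hM, hMf⟩ := exists_linear_of_isometric hβ hp hΩo hΩc hΩ
    (fun z hz => (hf4 z hz).of_le (by norm_num)) hfM
    fun z hz => prodMetric_eq_of_conformal hα hp hq hΩo hΩ hf4 hfM hu hCR hz
  have hr : ∀ z ∈ Ω, 0 < ‖z.1‖ ^ (α + 1) := fun z hz => Real.rpow_pos_of_pos (norm_fst_pos (hΩ hz)) _
  have hr' : ∀ z ∈ Ω, 0 < ‖(f z).1‖ ^ (α + 1) :=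
    fun z hz => Real.rpow_pos_of_pos (norm_fst_pos (hfM z hz)) _
  have hMf' : ∀ z ∈ Ω, M (halfSpacePoint (‖z.1‖ ^ (α + 1)) z.2)
      = halfSpacePoint (‖(f z).1‖ ^ (α + 1)) (f z).2 := fun z hz => (hMf z hz).symm
  obtain ⟨z₀, hz₀⟩ := hΩc.nonempty
  obtain ⟨B, b', b, a, hB, ha, h⟩ := exists_halfSpace_action hM
    ⟨_, _, _, _, hr z₀ hz₀, hr' z₀ hz₀, hMf' z₀ hz₀⟩
  have hpow : (a⁻¹ ^ (α + 1)⁻¹) ^ (α + 1) = a⁻¹ := Real.rpow_inv_rpow (by positivity) hβ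
  rcases h with h | h
  · refine ⟨linearIsometryEquivOfInner A hA, linearIsometryEquivOfInner B hB, b', b,
      a⁻¹ ^ (α + 1)⁻¹, 0, by positivity, Or.inl rfl, fun z hz => ?_⟩
    obtain ⟨h1, h2⟩ := h _ _ _ _ (hr z hz) (hr' z hz) (hMf' z hz)
    rw [Real.rpow_zero, mul_one]
    exact eq_gdil_of_parts hα (hΩ hz) (hfM z hz) (by positivity) hpow (hAf z hz) h1 h2
  · refine ⟨linearIsometryEquivOfInner A hA, linearIsometryEquivOfInner B hB, b', b,
      a⁻¹ ^ (α + 1)⁻¹, -2, by positivity, Or.inr rfl, fun z hz => ?_⟩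
    obtain ⟨h1, h2⟩ := h _ _ _ _ (hr z hz) (hr' z hz) (hMf' z hz)
    have h3 : 0 ≤ homNorm α p q (z.1, z.2 - b) := by unfold homNorm; positivity
    refine eq_gdil_of_parts hα (hΩ hz) (hfM z hz) (by positivity) ?_ (hAf z hz) h1 h2
    rw [Real.mul_rpow (by positivity) (by positivity), hpow, homNorm_rpow hα, mul_inv]

end
end

section
/- Assume p ≥ 3 and q ≥ 1. Then any connected umbilical hypersurface in (M₀, g) is contained in one among the following: (A1) a homogeneous sphere of equation |x|^{2(α+1)} + |y−b|² = c², with b ∈ ℝ^q and c > 0; (A2) a plane of equation ⟨a, y⟩ = c, with a ∈ ℝ^q∖{0} and c ∈ ℝ; (B) a plane of equation ⟨a, x⟩ = 0, with a ∈ ℝ^p∖{0}. -/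
noncomputable section

open scoped RealInnerProductSpace

section

open Filter Topology

variable {E : Type*} [NormedAddCommGroup E] [NormedSpace ℝ E]

/-- A regular level set of a `C²` function admits, near each of its points, a `C²` parametrization
by the ambient space whose derivative at the base point fixes the tangent directions. -/
lemma exists_levelSet_parametrization [CompleteSpace E] {F : E → ℝ} {P : E}
    (hF : ContDiffAt ℝ 2 F P) (hP : F P = 0) (hF' : fderiv ℝ F P ≠ 0) :
    ∃ φ : E → E, ContDiffAt ℝ 2 φ 0 ∧ φ 0 = P ∧ (∀ᶠ t in 𝓝 0, F (φ t) = 0) ∧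
      (∀ X, fderiv ℝ F P X = 0 → fderiv ℝ φ 0 X = X) ∧
      ∀ U ∈ 𝓝 (0 : E), ∀ᶠ z in 𝓝 P, F z = 0 → z ∈ φ '' U := by
  obtain ⟨ν, hν⟩ : ∃ ν, fderiv ℝ F P ν = 1 := by
    obtain ⟨X, hX⟩ : ∃ X, fderiv ℝ F P X ≠ 0 := by
      by_contra! h
      exact hF' (ContinuousLinearMap.ext h)
    exact ⟨(fderiv ℝ F P X)⁻¹ • X, by simp [hX]⟩
  set L := fderiv ℝ F P with hL
  set Ψ : E → E := fun z => z + (F z - L z) • ν with hΨ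
  have hΨc : ContDiffAt ℝ 2 Ψ P := by fun_prop
  have hFd : HasFDerivAt F L P := (hF.differentiableAt (by norm_num)).hasFDerivAt
  have hΨd : HasFDerivAt Ψ ((ContinuousLinearEquiv.refl ℝ E : E ≃L[ℝ] E) : E →L[ℝ] E) P := by
    have := (hasFDerivAt_id (𝕜 := ℝ) P).add ((hFd.sub L.hasFDerivAt).smul_const ν)
    refine this.congr_fderiv ?_
    ext X
    simp
  have hLΨ : ∀ z, L (Ψ z) = F z := fun z => by simp [hΨ, hν]
  set R := hΨc.toOpenPartialHomeomorph Ψ hΨd two_ne_zero with hR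
  have hRcoe : ∀ z, R z = Ψ z := fun _ => rfl
  have hPs : P ∈ R.source := hΨc.mem_toOpenPartialHomeomorph_source hΨd two_ne_zero
  have hPt : Ψ P ∈ R.target := hΨc.image_mem_toOpenPartialHomeomorph_target hΨd two_ne_zero
  have hsymmP : R.symm (Ψ P) = P := R.left_inv hPs
  have hsd : HasFDerivAt R.symm ((ContinuousLinearEquiv.refl ℝ E).symm : E →L[ℝ] E) (Ψ P) :=
    R.hasFDerivAt_symm hPt (by rw [hsymmP]; exact hΨd)
  have hsc : ContDiffAt ℝ 2 R.symm (Ψ P) :=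
    R.contDiffAt_symm hPt (by rw [hsymmP]; exact hΨd) (by rw [hsymmP]; exact hΨc)
  let π : E →L[ℝ] E := ContinuousLinearMap.id ℝ E - L.smulRight ν
  have hLπ : ∀ t, L (π t) = 0 := fun t => by simp [π, hν]
  have hπ : ∀ t, L t = 0 → π t = t := fun t ht => by simp [π, ht]
  have hlin : HasFDerivAt (fun t => Ψ P + π t) π 0 := π.hasFDerivAt.const_add _
  have h0 : Ψ P + π 0 = Ψ P := by simp
  refine ⟨fun t => R.symm (Ψ P + π t), ?_, ?_, ?_, ?_, ?_⟩
  · refine ContDiffAt.comp (g := R.symm) (f := fun t => Ψ P + π t) 0 ?_ (by fun_prop)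
    rw [h0]; exact hsc
  · simp [hsymmP]
  · have : Tendsto (fun t => Ψ P + π t) (𝓝 0) (𝓝 (Ψ P)) := by
      have := hlin.continuousAt.tendsto
      rwa [h0] at this
    filter_upwards [this.eventually (R.open_target.mem_nhds hPt)] with t ht
    rw [← hLΨ, ← hRcoe, R.right_inv ht, map_add, hLπ, hLΨ, hP, add_zero]
  · intro X hX
    have : HasFDerivAt (fun t => R.symm (Ψ P + π t)) _ 0 :=
      HasFDerivAt.comp (g := R.symm) (f := fun t => Ψ P + π t) 0 (by rw [h0]; exact hsd) hlin
    rw [this.fderiv]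
    simpa using hπ X hX
  · intro U hU
    have hcont : Tendsto (fun z => Ψ z - Ψ P) (𝓝 P) (𝓝 0) := by
      have := hΨd.continuousAt.tendsto.sub_const (Ψ P)
      rwa [sub_self] at this
    filter_upwards [hcont hU, R.open_source.mem_nhds hPs] with z hzU hz hFz
    refine ⟨Ψ z - Ψ P, hzU, ?_⟩
    have : π (Ψ z - Ψ P) = Ψ z - Ψ P := hπ _ (by rw [map_sub, hLΨ, hLΨ, hFz, hP, sub_zero])
    simp only [this, add_sub_cancel]
    exact R.left_inv hz

lemma hasDerivAt_fderiv_apply_line {G : Type*} [NormedAddCommGroup G] [NormedSpace ℝ G]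
    {h : E → G} {t : E} (hh : ContDiffAt ℝ 2 h t) (e f : E) :
    HasDerivAt (fun r : ℝ => fderiv ℝ h (t + r • f) e) (fderiv ℝ (fderiv ℝ h) t f e) 0 := by
  have h1 : HasFDerivAt (fderiv ℝ h) (fderiv ℝ (fderiv ℝ h) t) (t + (0 : ℝ) • f) := by
    rw [zero_smul, add_zero]
    exact ((hh.fderiv_right (m := 1) (by norm_num)).differentiableAt (by norm_num)).hasFDerivAt
  have h2 : HasDerivAt (fun r : ℝ => t + r • f) f 0 := by
    simpa using ((hasDerivAt_id (0 : ℝ)).smul_const f).const_add t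
  exact (ContinuousLinearMap.apply ℝ G e).hasFDerivAt.comp_hasDerivAt (0 : ℝ)
    (h1.comp_hasDerivAt (0 : ℝ) h2)

lemma DifferentiableAt.hasDerivAt_line {G : Type*} [NormedAddCommGroup G] [NormedSpace ℝ G]
    {h : E → G} {t : E} (hh : DifferentiableAt ℝ h t) (f : E) :
    HasDerivAt (fun r : ℝ => h (t + r • f)) (fderiv ℝ h t f) 0 := by
  have h1 : HasFDerivAt h (fderiv ℝ h t) (t + (0 : ℝ) • f) := by
    rw [zero_smul, add_zero]
    exact hh.hasFDerivAt
  have h2 : HasDerivAt (fun r : ℝ => t + r • f) f 0 := by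
    simpa using ((hasDerivAt_id (0 : ℝ)).smul_const f).const_add t
  exact h1.comp_hasDerivAt (0 : ℝ) h2

lemma Filter.Eventually.line {p : E → Prop} {t : E} (h : ∀ᶠ s in 𝓝 t, p s) (f : E) :
    ∀ᶠ r : ℝ in 𝓝 0, p (t + r • f) := by
  have : Tendsto (fun r : ℝ => t + r • f) (𝓝 0) (𝓝 t) := by
    have h : ContinuousAt (fun r : ℝ => t + r • f) 0 := by fun_prop
    simpa [ContinuousAt] using h
  exact this.eventually h

/-- Codazzi equation for the flat factor. -/
lemma codazzi_flat {G : Type*} [NormedAddCommGroup G] [NormedSpace ℝ G]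
    {y w : E → G} {k : E → ℝ} {t : E} (hy : ContDiffAt ℝ 2 y t) (hw : ContDiffAt ℝ 2 w t)
    (hk : DifferentiableAt ℝ k t)
    (h : ∀ᶠ s in 𝓝 t, ∀ e, fderiv ℝ w s e = -(k s) • fderiv ℝ y s e) (e f : E) :
    fderiv ℝ k t f • fderiv ℝ y t e = fderiv ℝ k t e • fderiv ℝ y t f := by
  have key : ∀ e f, fderiv ℝ (fderiv ℝ w) t f e =
      -(k t) • fderiv ℝ (fderiv ℝ y) t f e + -(fderiv ℝ k t f) • fderiv ℝ y t e := by
    intro e f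
    have h1 := (hk.hasDerivAt_line f).neg.smul (hasDerivAt_fderiv_apply_line hy e f)
    have h2 := hasDerivAt_fderiv_apply_line hw e f
    have h3 := h2.unique (h1.congr_of_eventuallyEq ((h.line f).mono fun r hr => hr e))
    simpa using h3
  have s1 := (hw.isSymmSndFDerivAt (by simp)).eq e f
  have s2 := (hy.isSymmSndFDerivAt (by simp)).eq e f
  rw [key e f, key f e, s2] at s1
  have := add_left_cancel s1
  simpa using this.symm

/-- Codazzi equation for the conical factor. -/
lemma codazzi_cone {F : Type*} [NormedAddCommGroup F] [InnerProductSpace ℝ F] {α : ℝ}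
    {x n : E → F} {k : E → ℝ} {t : E} (hx : ContDiffAt ℝ 2 x t) (hn : ContDiffAt ℝ 2 n t)
    (hk : DifferentiableAt ℝ k t)
    (h : ∀ᶠ s in 𝓝 t, ∀ e, ‖x s‖ ^ 2 • fderiv ℝ n s e = -(k s * ‖x s‖ ^ 2) • fderiv ℝ x s e
      - α • (⟪x s, n s⟫ • fderiv ℝ x s e + ⟪x s, fderiv ℝ x s e⟫ • n s
        - ⟪fderiv ℝ x s e, n s⟫ • x s)) (e f : E) :
    ‖x t‖ ^ 4 • (fderiv ℝ k t f • fderiv ℝ x t e - fderiv ℝ k t e • fderiv ℝ x t f) =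
      (-(α * (α + 2))) •
        ((‖x t‖ ^ 2 * ⟪fderiv ℝ x t f, n t⟫ - ⟪x t, n t⟫ * ⟪x t, fderiv ℝ x t f⟫) • fderiv ℝ x t e
        - (‖x t‖ ^ 2 * ⟪fderiv ℝ x t e, n t⟫ - ⟪x t, n t⟫ * ⟪x t, fderiv ℝ x t e⟫) • fderiv ℝ x t f
        + (⟪x t, fderiv ℝ x t f⟫ * ⟪fderiv ℝ x t e, n t⟫
          - ⟪x t, fderiv ℝ x t e⟫ * ⟪fderiv ℝ x t f, n t⟫) • x t) := by
  have key : ∀ e f, (2 * ⟪x t, fderiv ℝ x t f⟫) • fderiv ℝ n t e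
      + ‖x t‖ ^ 2 • fderiv ℝ (fderiv ℝ n) t f e =
      -(fderiv ℝ k t f * ‖x t‖ ^ 2 + k t * (2 * ⟪x t, fderiv ℝ x t f⟫)) • fderiv ℝ x t e
      - (k t * ‖x t‖ ^ 2) • fderiv ℝ (fderiv ℝ x) t f e
      - α • ((⟪x t, fderiv ℝ n t f⟫ + ⟪fderiv ℝ x t f, n t⟫) • fderiv ℝ x t e
        + ⟪x t, n t⟫ • fderiv ℝ (fderiv ℝ x) t f e
        + (⟪x t, fderiv ℝ (fderiv ℝ x) t f e⟫ + ⟪fderiv ℝ x t f, fderiv ℝ x t e⟫) • n t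
        + ⟪x t, fderiv ℝ x t e⟫ • fderiv ℝ n t f
        - (⟪fderiv ℝ x t e, fderiv ℝ n t f⟫ + ⟪fderiv ℝ (fderiv ℝ x) t f e, n t⟫) • x t
        - ⟪fderiv ℝ x t e, n t⟫ • fderiv ℝ x t f) := by
    intro e f
    have dx := (hx.differentiableAt two_ne_zero).hasDerivAt_line f
    have dn := (hn.differentiableAt two_ne_zero).hasDerivAt_line f
    have dX := hasDerivAt_fderiv_apply_line hx e f
    have dN := hasDerivAt_fderiv_apply_line hn e f
    have dk := hk.hasDerivAt_line f
    have h1 := dx.norm_sq.smul dN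
    have h2 := ((dk.mul dx.norm_sq).neg.smul dX).sub ((((dx.inner ℝ dn).smul dX).add
      ((dx.inner ℝ dX).smul dn)).sub ((dX.inner ℝ dn).smul dx) |>.const_smul α)
    have h3 := h1.unique (h2.congr_of_eventuallyEq ((h.line f).mono fun r hr => hr e))
    simp only [zero_smul, add_zero, Pi.mul_apply, Pi.neg_apply] at h3
    rw [add_comm] at h3
    rw [h3]
    module
  have he := h.self_of_nhds e
  have hf := h.self_of_nhds f
  have s1 := (hn.isSymmSndFDerivAt (by simp)).eq e f
  have s2 := (hx.isSymmSndFDerivAt (by simp)).eq e f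
  have k1 := key e f
  have k2 := key f e
  rw [s1, s2] at k2
  generalize fderiv ℝ (fderiv ℝ n) t f e = N2 at k1 k2
  generalize fderiv ℝ (fderiv ℝ x) t f e = X2 at k1 k2
  generalize fderiv ℝ x t e = X at *
  generalize fderiv ℝ x t f = Y at *
  generalize fderiv ℝ n t e = Ne at *
  generalize fderiv ℝ n t f = Nf at *
  generalize fderiv ℝ k t e = ke at *
  generalize fderiv ℝ k t f = kf at *
  refine ext_inner_left ℝ fun v => ?_
  have i1 := congrArg (fun z => ⟪v, z⟫) k1
  have i2 := congrArg (fun z => ⟪v, z⟫) k2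
  have j1 := congrArg (fun z => ⟪v, z⟫) he
  have j2 := congrArg (fun z => ⟪v, z⟫) hf
  have l1 := congrArg (fun z => ⟪x t, z⟫) he
  have l2 := congrArg (fun z => ⟪x t, z⟫) hf
  have m1 := congrArg (fun z => ⟪Y, z⟫) he
  have m2 := congrArg (fun z => ⟪X, z⟫) hf
  simp only [inner_add_right, inner_sub_right, inner_smul_right, real_inner_self_eq_norm_sq,
    real_inner_comm X Y, real_inner_comm X (x t), real_inner_comm Y (x t)]
    at i1 i2 j1 j2 l1 l2 m1 m2 ⊢
  linear_combination ‖x t‖ ^ 2 * (i1 - i2) - (2 - α) * ⟪Y, x t⟫ * j1 + (2 - α) * ⟪X, x t⟫ * j2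
    - α * ⟪v, X⟫ * l2 + α * ⟪v, Y⟫ * l1 + α * ⟪v, x t⟫ * m2 - α * ⟪v, x t⟫ * m1

/-- Both Codazzi equations hold for a common functional, with no regularity assumed on the
principal curvature, as soon as the flat factor is not critical. -/
lemma exists_codazzi {F G : Type*} [NormedAddCommGroup F] [InnerProductSpace ℝ F]
    [NormedAddCommGroup G] [InnerProductSpace ℝ G] {α : ℝ} {x n : E → F} {y w : E → G} {t e₀ : E}
    (hx : ContDiffAt ℝ 2 x t) (hn : ContDiffAt ℝ 2 n t) (hy : ContDiffAt ℝ 2 y t)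
    (hw : ContDiffAt ℝ 2 w t) (he₀ : fderiv ℝ y t e₀ ≠ 0)
    (h : ∀ᶠ s in 𝓝 t, ∃ κ : ℝ, ∀ e, fderiv ℝ w s e = -κ • fderiv ℝ y s e ∧
      ‖x s‖ ^ 2 • fderiv ℝ n s e = -(κ * ‖x s‖ ^ 2) • fderiv ℝ x s e
        - α • (⟪x s, n s⟫ • fderiv ℝ x s e + ⟪x s, fderiv ℝ x s e⟫ • n s
          - ⟪fderiv ℝ x s e, n s⟫ • x s)) :
    ∃ k : E → ℝ, (∀ e f, k f • fderiv ℝ y t e = k e • fderiv ℝ y t f) ∧ ∀ e f,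
      ‖x t‖ ^ 4 • (k f • fderiv ℝ x t e - k e • fderiv ℝ x t f) = (-(α * (α + 2))) •
        ((‖x t‖ ^ 2 * ⟪fderiv ℝ x t f, n t⟫ - ⟪x t, n t⟫ * ⟪x t, fderiv ℝ x t f⟫) • fderiv ℝ x t e
        - (‖x t‖ ^ 2 * ⟪fderiv ℝ x t e, n t⟫ - ⟪x t, n t⟫ * ⟪x t, fderiv ℝ x t e⟫) • fderiv ℝ x t f
        + (⟪x t, fderiv ℝ x t f⟫ * ⟪fderiv ℝ x t e, n t⟫
          - ⟪x t, fderiv ℝ x t e⟫ * ⟪fderiv ℝ x t f, n t⟫) • x t) := by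
  let k : E → ℝ := fun s => -(⟪fderiv ℝ w s e₀, fderiv ℝ y s e₀⟫ /
    ⟪fderiv ℝ y s e₀, fderiv ℝ y s e₀⟫)
  have hdy : DifferentiableAt ℝ (fun s => fderiv ℝ y s e₀) t :=
    ((hy.fderiv_right (m := 1) (by norm_num)).differentiableAt one_ne_zero).clm_apply
      (differentiableAt_const _)
  have hdw : DifferentiableAt ℝ (fun s => fderiv ℝ w s e₀) t :=
    ((hw.fderiv_right (m := 1) (by norm_num)).differentiableAt one_ne_zero).clm_apply
      (differentiableAt_const _)
  have hk : DifferentiableAt ℝ k t := by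
    simp only [k, div_eq_mul_inv]
    exact ((hdw.inner ℝ hdy).fun_mul
      ((hdy.inner ℝ hdy).fun_inv (inner_self_ne_zero.2 he₀))).fun_neg
  have hev : ∀ᶠ s in 𝓝 t, ∀ e, fderiv ℝ w s e = -(k s) • fderiv ℝ y s e ∧
      ‖x s‖ ^ 2 • fderiv ℝ n s e = -(k s * ‖x s‖ ^ 2) • fderiv ℝ x s e
        - α • (⟪x s, n s⟫ • fderiv ℝ x s e + ⟪x s, fderiv ℝ x s e⟫ • n s
          - ⟪fderiv ℝ x s e, n s⟫ • x s) := by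
    filter_upwards [h, hdy.continuousAt.eventually_ne he₀] with s ⟨κ, hκ⟩ hne
    have hne' := inner_self_ne_zero (𝕜 := ℝ).2 hne
    have hkκ : k s = κ := by
      simp only [k, (hκ e₀).1, inner_smul_left, conj_trivial]
      field_simp
    rwa [hkκ]
  exact ⟨fderiv ℝ k t, codazzi_flat hy hw hk (hev.mono fun s hs e => (hs e).1),
    codazzi_cone hx hn hk (hev.mono fun s hs e => (hs e).2)⟩

/-- Incompatibility of the Codazzi equations with a normal `(n, w)` that has both a nonzero
spherical part and a nonzero part in the span of the radial and flat directions. -/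
lemma codazzi_dichotomy {F G : Type*} [NormedAddCommGroup F] [InnerProductSpace ℝ F]
    [NormedAddCommGroup G] [InnerProductSpace ℝ G] {α l : ℝ} (hα : 0 < α) (hl : 0 < l)
    {x n : F} {w : G} (hx : x ≠ 0) (k : F × G → ℝ)
    (hu : ∃ u : F, u ≠ 0 ∧ ⟪x, u⟫ = 0 ∧ ⟪u, n⟫ = 0) {v₀ : G} (hv₀ : v₀ ≠ 0)
    (hflat : ∀ X Y : F × G, l * ⟪n, X.1⟫ + ⟪w, X.2⟫ = 0 → l * ⟪n, Y.1⟫ + ⟪w, Y.2⟫ = 0 →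
      k Y • X.2 = k X • Y.2)
    (hcone : ∀ X Y : F × G, l * ⟪n, X.1⟫ + ⟪w, X.2⟫ = 0 → l * ⟪n, Y.1⟫ + ⟪w, Y.2⟫ = 0 →
      ‖x‖ ^ 4 • (k Y • X.1 - k X • Y.1) = (-(α * (α + 2))) •
        ((‖x‖ ^ 2 * ⟪Y.1, n⟫ - ⟪x, n⟫ * ⟪x, Y.1⟫) • X.1
        - (‖x‖ ^ 2 * ⟪X.1, n⟫ - ⟪x, n⟫ * ⟪x, X.1⟫) • Y.1
        + (⟪x, Y.1⟫ * ⟪X.1, n⟫ - ⟪x, X.1⟫ * ⟪Y.1, n⟫) • x)) :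
    ‖x‖ ^ 2 • n = ⟪x, n⟫ • x ∨ (⟪x, n⟫ = 0 ∧ w = 0) := by
  by_contra! hcon
  obtain ⟨hns, hN⟩ := hcon
  obtain ⟨u, hu0, hxu, hun⟩ := hu
  have hρ : 0 < ‖x‖ ^ 2 := by positivity
  set b := ⟪x, n⟫ with hb
  set ns := ‖x‖ ^ 2 • n - b • x with hns_def
  have hns0 : ns ≠ 0 := sub_ne_zero.2 hns
  have hnsx : ⟪ns, x⟫ = 0 := by
    rw [hns_def, inner_sub_left, inner_smul_left, inner_smul_left, real_inner_self_eq_norm_sq,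
      real_inner_comm]
    simp [← hb]; ring
  set d := ⟪n, ns⟫ with hd
  have hnn : ⟪ns, ns⟫ = ‖x‖ ^ 2 * d := by
    nth_rw 1 [hns_def]
    rw [inner_sub_left, inner_smul_left, inner_smul_left, real_inner_comm ns x, hnsx]
    simp [hd]
  have hns_pos : 0 < ⟪ns, ns⟫ := real_inner_self_pos.2 hns0
  have hdpos : 0 < d := by
    rw [hnn] at hns_pos
    exact pos_of_mul_pos_right hns_pos hρ.le
  have hpair : ∀ v : F, ‖x‖ ^ 2 * ⟪v, n⟫ - b * ⟪x, v⟫ = ⟪v, ns⟫ := fun v => by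
    rw [hns_def, inner_sub_right, inner_smul_right, inner_smul_right, real_inner_comm x v]
  have hkX : k (u, 0) = 0 := by
    have := hflat (u, 0) (-(⟪w, v₀⟫ / (l * d)) • ns, v₀) (by simp [real_inner_comm u n, hun])
      (by
        rw [inner_smul_right, ← hd]
        field_simp
        ring)
    exact (smul_eq_zero.1 (this.symm.trans (smul_zero _))).resolve_right hv₀
  have hc : 0 < α * (α + 2) := by positivity
  have hk : ∀ Y : F × G, l * ⟪n, Y.1⟫ + ⟪w, Y.2⟫ = 0 →
      ‖x‖ ^ 4 * k Y = -(α * (α + 2)) * ⟪Y.1, ns⟫ := by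
    intro Y hY
    have := hcone (u, 0) Y (by simp [real_inner_comm u n, hun]) hY
    simp only [hpair, hkX, hxu, hun, smul_smul, mul_zero, zero_smul, sub_zero, add_zero,
      zero_mul] at this
    exact smul_left_injective ℝ hu0 this
  have hZ : ∀ (Y : F × G) (a : ℝ) (v : G), l * ⟪n, Y.1⟫ + ⟪w, Y.2⟫ = 0 → ⟪Y.1, ns⟫ ≠ 0 →
      l * ⟪n, a • x⟫ + ⟪w, v⟫ = 0 → a = 0 ∧ v = 0 := by
    intro Y a v hY hYn hZ
    have hkY : k Y ≠ 0 := fun h => by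
      have := hk Y hY
      rw [h, mul_zero, eq_comm, mul_eq_zero] at this
      rcases this with h | h
      · linarith
      · exact hYn h
    have hkZ : k (a • x, v) = 0 := by
      have := hk (a • x, v) hZ
      rw [inner_smul_left, real_inner_comm, hnsx, mul_zero, mul_zero] at this
      exact (mul_eq_zero.1 this).resolve_left (by positivity)
    constructor
    · have := hcone (a • x, v) Y hZ hY
      have e1 : ⟪a • x, n⟫ = a * b := by rw [inner_smul_left, ← hb]; simp
      have e2 : ⟪x, a • x⟫ = a * ‖x‖ ^ 2 := by rw [inner_smul_right, real_inner_self_eq_norm_sq]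
      have e3 : (‖x‖ ^ 4 * k Y * a) • x = (0 : ℝ) • x := by
        simp only [hkZ, e1, e2] at this
        refine Eq.trans ?_ (this.trans ?_) <;> module
      simpa [hkY, hx] using smul_left_injective ℝ hx e3
    · have := hflat (a • x, v) Y hZ hY
      simpa [hkZ, hkY] using this
  by_cases hb0 : b = 0
  · have hw := hN hb0
    have hw' : 0 < ‖w‖ ^ 2 := by positivity
    have := (hZ (-(‖w‖ ^ 2 / (l * d)) • ns, w) 1 0 (by
        rw [inner_smul_right, ← hd, real_inner_self_eq_norm_sq]
        field_simp
        ring) (by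
        rw [inner_smul_left]
        have : 0 < ‖w‖ ^ 2 / (l * d) := by positivity
        simp only [map_neg, conj_trivial]
        exact mul_ne_zero (neg_ne_zero.2 this.ne') hns_pos.ne')
      (by simp [real_inner_comm x n, ← hb, hb0])).1
    exact one_ne_zero this
  · have := (hZ (ns - (d / b) • x, 0) (-(⟪w, v₀⟫ / (l * b))) v₀ (by
        rw [inner_sub_right, inner_smul_right, real_inner_comm x n, ← hb, ← hd]
        field_simp
        simp) (by
        rw [inner_sub_left, inner_smul_left, real_inner_comm ns x, hnsx]
        simpa using hns_pos.ne')
      (by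
        rw [inner_smul_right, real_inner_comm x n, ← hb]
        field_simp
        ring)).2
    exact hv₀ this

/-- A set that is locally a regular level set of a smooth function. -/
def IsLevelHypersurface (S : Set E) : Prop :=
  ∀ P ∈ S, ∃ (V : Set E) (F : E → ℝ),
    IsOpen V ∧ P ∈ V ∧ ContDiffOn ℝ (⊤ : ℕ∞) F V ∧
    S ∩ V = {z ∈ V | F z = 0} ∧ ∀ z ∈ V, fderiv ℝ F z ≠ 0

lemma fderiv_mem_tangentConeAt {S : Set E} {φ : E → E} {t : E} (hφ : DifferentiableAt ℝ φ t)
    (hS : ∀ᶠ s in 𝓝 t, φ s ∈ S) (e : E) : fderiv ℝ φ t e ∈ tangentConeAt ℝ S (φ t) := by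
  have h : HasFDerivWithinAt φ (fderiv ℝ φ t) {s | φ s ∈ S} t := hφ.hasFDerivAt.hasFDerivWithinAt
  refine tangentConeAt_mono (Set.image_subset_iff.2 fun s hs => hs) (h.mapsTo_tangent_cone ?_)
  rw [tangentConeAt_of_mem_nhds hS]
  trivial

namespace IsLevelHypersurface

variable {S : Set E}

lemma exists_parametrization [CompleteSpace E] (hS : IsLevelHypersurface S) {P : E} (hP : P ∈ S) :
    ∃ (L : E →L[ℝ] ℝ) (φ : E → E), L ≠ 0 ∧ ContDiffAt ℝ 2 φ 0 ∧ φ 0 = P ∧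
      (∀ᶠ t in 𝓝 0, φ t ∈ S) ∧ (∀ X, L X = 0 → fderiv ℝ φ 0 X = X) ∧
      ∀ U ∈ 𝓝 (0 : E), ∀ᶠ z in 𝓝 P, z ∈ S → z ∈ φ '' U := by
  obtain ⟨V, F, hVo, hPV, hF, hSV, hF'⟩ := hS P hP
  have hmem : ∀ z ∈ V, z ∈ S ↔ F z = 0 := fun z hz => by
    have : z ∈ S ∩ V ↔ z ∈ {z ∈ V | F z = 0} := by rw [hSV]
    simpa [hz] using this
  have hFP : ContDiffAt ℝ 2 F P :=
    (hF.contDiffAt (hVo.mem_nhds hPV)).of_le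
      (show ((2 : ℕ∞) : WithTop ℕ∞) ≤ _ from WithTop.coe_le_coe.2 le_top)
  obtain ⟨φ, h1, h2, h3, h4, h5⟩ :=
    exists_levelSet_parametrization hFP ((hmem P hPV).1 hP) (hF' P hPV)
  refine ⟨fderiv ℝ F P, φ, hF' P hPV, h1, h2, ?_, h4, ?_⟩
  · have : ∀ᶠ t in 𝓝 0, φ t ∈ V :=
      h1.continuousAt.eventually_mem (hVo.mem_nhds (by rwa [h2]))
    filter_upwards [h3, this] with t ht htV using (hmem _ htV).2 ht
  · intro U hU
    filter_upwards [h5 U hU, hVo.mem_nhds hPV] with z hz hzV hzS using hz ((hmem z hzV).1 hzS)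

/-- If a nonzero functional `g` vanishes on the tangent directions, a parametrization can be chosen
whose derivative at the base point fixes the kernel of `g`. -/
lemma exists_parametrization_of_normal [CompleteSpace E] (hS : IsLevelHypersurface S) {P : E}
    (hP : P ∈ S) {g : E →L[ℝ] ℝ} (hg : g ≠ 0) (hgS : ∀ X ∈ tangentConeAt ℝ S P, g X = 0) :
    ∃ φ : E → E, ContDiffAt ℝ 2 φ 0 ∧ φ 0 = P ∧ (∀ᶠ t in 𝓝 0, φ t ∈ S) ∧
      ∀ X, g X = 0 → fderiv ℝ φ 0 X = X := by
  obtain ⟨L, φ, hL, h1, h2, h3, h4, -⟩ := hS.exists_parametrization hP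
  refine ⟨φ, h1, h2, h3, fun X hX => h4 X ?_⟩
  have hker : ∀ Y, L Y = 0 → g Y = 0 := fun Y hY => by
    have := fderiv_mem_tangentConeAt (h1.differentiableAt two_ne_zero) h3 Y
    rw [h4 Y hY, h2] at this
    exact hgS Y this
  by_contra hLX
  refine hg (ContinuousLinearMap.ext fun Y => ?_)
  have := hker (Y - (L Y / L X) • X) (by simp [hLX])
  simpa [hX] using this

lemma mem_tangentConeAt_of_normal [CompleteSpace E] (hS : IsLevelHypersurface S) {P : E}
    (hP : P ∈ S) {g : E →L[ℝ] ℝ} (hg : g ≠ 0) (hgS : ∀ X ∈ tangentConeAt ℝ S P, g X = 0)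
    {X : E} (hX : g X = 0) : X ∈ tangentConeAt ℝ S P := by
  obtain ⟨φ, h1, h2, h3, h4⟩ := hS.exists_parametrization_of_normal hP hg hgS
  have := fderiv_mem_tangentConeAt (h1.differentiableAt two_ne_zero) h3 X
  rwa [h4 X hX, h2] at this

/-- A function whose tangential derivatives vanish is constant on a connected hypersurface. -/
lemma apply_eq_of_fderiv_eq_zero [CompleteSpace E] (hS : IsLevelHypersurface S)
    (hconn : IsPreconnected S) {G : Type*} [NormedAddCommGroup G] [NormedSpace ℝ G] {f : E → G}
    (hf : ∀ P ∈ S, DifferentiableAt ℝ f P)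
    (hf' : ∀ P ∈ S, ∀ X ∈ tangentConeAt ℝ S P, fderiv ℝ f P X = 0) :
    ∀ P ∈ S, ∀ Q ∈ S, f P = f Q := by
  have hloc : IsLocallyConstant (fun z : S => f z) := by
    refine (IsLocallyConstant.iff_eventually_eq _).2 fun ⟨P, hP⟩ => ?_
    obtain ⟨L, φ, -, h1, h2, h3, -, h5⟩ := hS.exists_parametrization hP
    have hev : ∀ᶠ t in 𝓝 0, DifferentiableAt ℝ φ t ∧ ∀ᶠ s in 𝓝 t, φ s ∈ S :=
      ((h1.eventually (by simp)).mono fun t ht => ht.differentiableAt two_ne_zero).and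
        h3.eventually_nhds
    obtain ⟨ε, hε, hball⟩ := Metric.eventually_nhds_iff_ball.1 hev
    have hder : ∀ t ∈ Metric.ball (0 : E) ε, HasFDerivAt (f ∘ φ) (0 : E →L[ℝ] G) t := by
      intro t ht
      obtain ⟨hd, hs⟩ := hball t ht
      have hts := hs.self_of_nhds
      refine ((hf _ hts).hasFDerivAt.comp t hd.hasFDerivAt).congr_fderiv ?_
      ext e
      exact hf' _ hts _ (fderiv_mem_tangentConeAt hd hs e)
    have hconst : ∀ t ∈ Metric.ball (0 : E) ε, f (φ t) = f P := by
      intro t ht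
      have := (convex_ball (0 : E) ε).is_const_of_fderivWithin_eq_zero (𝕜 := ℝ) (f := f ∘ φ)
        (fun s hs => (hder s hs).differentiableAt.differentiableWithinAt)
        (fun s hs => by
          rw [fderivWithin_of_isOpen Metric.isOpen_ball hs, (hder s hs).fderiv])
        ht (Metric.mem_ball_self hε)
      simpa [h2] using this
    have := h5 _ (Metric.ball_mem_nhds 0 hε)
    filter_upwards [continuous_subtype_val.continuousAt.eventually this] with ⟨z, hz⟩ hzφ
    obtain ⟨t, ht, rfl⟩ := hzφ hz
    exact hconst t ht
  intro P hP Q hQ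
  have : PreconnectedSpace S := Subtype.preconnectedSpace hconn
  exact hloc.apply_eq_of_preconnectedSpace ⟨P, hP⟩ ⟨Q, hQ⟩

end IsLevelHypersurface
end

section

open Filter Topology

/-- An umbilical hypersurface `S` of `(M₀, g)` with unit normal `N`. -/
structure IsGrushinUmbilical (α : ℝ) (p q : ℕ) (S : Set (GVec p q)) (N : GVec p q → GVec p q) :
    Prop where
  fst_ne_zero : ∀ P ∈ S, P.1 ≠ 0
  isPreconnected : IsPreconnected S
  isLevelHypersurface : IsLevelHypersurface S
  contDiffAt : ∀ P ∈ S, ContDiffAt ℝ 2 N P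
  gMet_self : ∀ P ∈ S, gMet α p q P.1 (N P) (N P) = 1
  gMet_tangent : ∀ P ∈ S, ∀ X ∈ tangentConeAt ℝ S P, gMet α p q P.1 (N P) X = 0
  umbilical : ∀ P ∈ S, ∃ κ : ℝ, ∀ X ∈ tangentConeAt ℝ S P,
    fderiv ℝ N P X + gammaMap α p q P.1 X (N P) = (-κ) • X

lemma exists_ne_zero_inner_eq_zero {p : ℕ} (hp : 3 ≤ p) (x n : EuclideanSpace ℝ (Fin p)) :
    ∃ u : EuclideanSpace ℝ (Fin p), u ≠ 0 ∧ ⟪x, u⟫ = 0 ∧ ⟪u, n⟫ = 0 := by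
  let K : Submodule ℝ (EuclideanSpace ℝ (Fin p)) := Submodule.span ℝ {x, n}
  have hK : K ≠ ⊤ := fun h => by
    have h1 : Module.finrank ℝ K ≤ 2 := by
      have := finrank_span_finset_le_card (R := ℝ) ({x, n} : Finset (EuclideanSpace ℝ (Fin p)))
      rw [Finset.coe_pair] at this
      exact this.trans Finset.card_le_two
    rw [h, finrank_top, finrank_euclideanSpace_fin] at h1
    omega
  obtain ⟨u, hu, hu0⟩ := Submodule.exists_mem_ne_zero_of_ne_bot
    (fun h => hK (Submodule.orthogonal_eq_bot_iff.1 h))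
  refine ⟨u, hu0, (Submodule.mem_orthogonal _ _).1 hu x (Submodule.subset_span (by simp)), ?_⟩
  rw [real_inner_comm]
  exact (Submodule.mem_orthogonal _ _).1 hu n (Submodule.subset_span (by simp))

namespace IsGrushinUmbilical

variable {α : ℝ} {p q : ℕ} {S : Set (GVec p q)} {N : GVec p q → GVec p q}

lemma apply_ne_zero (h : IsGrushinUmbilical α p q S N) {P : GVec p q} (hP : P ∈ S) : N P ≠ 0 := by
  intro h0
  have := h.gMet_self P hP
  simp [gMet, h0] at this

/-- The linear functional `g(N P, ·)`. -/
def normalFunctional (α : ℝ) (N : GVec p q → GVec p q) (P : GVec p q) : GVec p q →L[ℝ] ℝ :=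
  ((α + 1) ^ 2 * ‖P.1‖ ^ (2 * α)) • (innerSL ℝ (N P).1).comp (ContinuousLinearMap.fst ℝ _ _)
    + (innerSL ℝ (N P).2).comp (ContinuousLinearMap.snd ℝ _ _)

lemma normalFunctional_apply (P X : GVec p q) :
    normalFunctional α N P X = gMet α p q P.1 (N P) X := by
  simp [normalFunctional, gMet]

lemma normalFunctional_ne_zero (h : IsGrushinUmbilical α p q S N) {P : GVec p q} (hP : P ∈ S) :
    normalFunctional α N P ≠ 0 := fun h0 => by
  have := h.gMet_self P hP
  rw [← normalFunctional_apply, h0] at this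
  simp at this

lemma normalFunctional_tangent (h : IsGrushinUmbilical α p q S N) {P : GVec p q} (hP : P ∈ S) :
    ∀ X ∈ tangentConeAt ℝ S P, normalFunctional α N P X = 0 := fun X hX => by
  rw [normalFunctional_apply]
  exact h.gMet_tangent P hP X hX

lemma mem_tangentConeAt (h : IsGrushinUmbilical α p q S N) {P X : GVec p q} (hP : P ∈ S)
    (hX : gMet α p q P.1 (N P) X = 0) : X ∈ tangentConeAt ℝ S P :=
  h.isLevelHypersurface.mem_tangentConeAt_of_normal hP (h.normalFunctional_ne_zero hP)
    (h.normalFunctional_tangent hP) (by rwa [normalFunctional_apply])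

lemma hasFDerivAt (h : IsGrushinUmbilical α p q S N) {P : GVec p q} (hP : P ∈ S) :
    HasFDerivAt N (fderiv ℝ N P) P :=
  ((h.contDiffAt P hP).differentiableAt two_ne_zero).hasFDerivAt

/-- The first component of the umbilical equation, cleared of denominators. -/
lemma umbilical_fst {P X : GVec p q} (hP : P.1 ≠ 0) {κ : ℝ}
    (hκ : fderiv ℝ N P X + gammaMap α p q P.1 X (N P) = (-κ) • X) :
    ‖P.1‖ ^ 2 • (fderiv ℝ N P X).1 = -(κ * ‖P.1‖ ^ 2) • X.1
      - α • (⟪P.1, (N P).1⟫ • X.1 + ⟪P.1, X.1⟫ • (N P).1 - ⟪X.1, (N P).1⟫ • P.1) := by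
  have hρ : ‖P.1‖ ^ 2 ≠ 0 := by simpa using hP
  have h1 : (fderiv ℝ N P X).1 + (α * ‖P.1‖ ^ (-(2:ℝ))) • (⟪P.1, (N P).1⟫ • X.1
      + ⟪P.1, X.1⟫ • (N P).1 - ⟪X.1, (N P).1⟫ • P.1) = (-κ) • X.1 := congrArg Prod.fst hκ
  rw [Real.rpow_neg (norm_nonneg _), Real.rpow_two] at h1
  rw [eq_sub_of_add_eq h1, smul_sub, smul_smul, smul_smul, mul_left_comm,
    mul_inv_cancel₀ hρ, mul_one]
  congr 2
  ring

lemma umbilical_snd {P X : GVec p q} {κ : ℝ}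
    (hκ : fderiv ℝ N P X + gammaMap α p q P.1 X (N P) = (-κ) • X) :
    (fderiv ℝ N P X).2 = -κ • X.2 := by
  have h1 : (fderiv ℝ N P X).2 + 0 = (-κ) • X.2 := congrArg Prod.snd hκ
  rwa [add_zero] at h1

/-- The umbilical equations read in a parametrization. -/
lemma eventually_umbilical (h : IsGrushinUmbilical α p q S N) {φ : GVec p q → GVec p q}
    (hφ : ContDiffAt ℝ 2 φ 0) (hφS : ∀ᶠ t in 𝓝 0, φ t ∈ S) :
    ∀ᶠ t in 𝓝 0, ∃ κ : ℝ, ∀ e,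
      fderiv ℝ (fun t => (N (φ t)).2) t e = -κ • fderiv ℝ (fun t => (φ t).2) t e ∧
      ‖(φ t).1‖ ^ 2 • fderiv ℝ (fun t => (N (φ t)).1) t e =
        -(κ * ‖(φ t).1‖ ^ 2) • fderiv ℝ (fun t => (φ t).1) t e
        - α • (⟪(φ t).1, (N (φ t)).1⟫ • fderiv ℝ (fun t => (φ t).1) t e
          + ⟪(φ t).1, fderiv ℝ (fun t => (φ t).1) t e⟫ • (N (φ t)).1
          - ⟪fderiv ℝ (fun t => (φ t).1) t e, (N (φ t)).1⟫ • (φ t).1) := by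
  filter_upwards [hφS.eventually_nhds, hφ.eventually (by simp)] with t htS htd'
  have htd := (htd'.differentiableAt two_ne_zero).hasFDerivAt
  have htS' := htS.self_of_nhds
  have hN : HasFDerivAt (fun t => N (φ t)) _ t := (h.hasFDerivAt htS').comp t htd
  obtain ⟨κ, hκ⟩ := h.umbilical _ htS'
  refine ⟨κ, fun e => ?_⟩
  have hum := hκ _ (fderiv_mem_tangentConeAt htd.differentiableAt htS e)
  rw [htd.fst.fderiv, htd.snd.fderiv, hN.fst.fderiv, hN.snd.fderiv]
  exact ⟨umbilical_snd hum, umbilical_fst (h.fst_ne_zero _ htS') hum⟩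

lemma exists_gMet_eq_zero (hq : 1 ≤ q) {x : EuclideanSpace ℝ (Fin p)} {U : GVec p q}
    (hl : 0 < (α + 1) ^ 2 * ‖x‖ ^ (2 * α)) (hU : U.1 ≠ 0) :
    ∃ e : GVec p q, gMet α p q x U e = 0 ∧ e.2 ≠ 0 := by
  refine ⟨(-(⟪U.2, EuclideanSpace.single ⟨0, hq⟩ 1⟫ / ((α + 1) ^ 2 * ‖x‖ ^ (2 * α) * ‖U.1‖ ^ 2)) •
    U.1, EuclideanSpace.single ⟨0, hq⟩ 1), ?_, by simp⟩
  have : 0 < ‖U.1‖ := norm_pos_iff.2 hU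
  simp only [gMet, inner_smul_right, real_inner_self_eq_norm_sq]
  generalize (α + 1) ^ 2 * ‖x‖ ^ (2 * α) = l at *
  field_simp
  ring

lemma dichotomy (hα : 0 < α) (hp : 3 ≤ p) (hq : 1 ≤ q) (h : IsGrushinUmbilical α p q S N)
    {P : GVec p q} (hP : P ∈ S) :
    ‖P.1‖ ^ 2 • (N P).1 = ⟪P.1, (N P).1⟫ • P.1 ∨ (⟪P.1, (N P).1⟫ = 0 ∧ (N P).2 = 0) := by
  by_cases hn0 : (N P).1 = 0
  · left; simp [hn0]
  have hx0 := h.fst_ne_zero P hP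
  have hl : 0 < (α + 1) ^ 2 * ‖P.1‖ ^ (2 * α) := by positivity
  obtain ⟨e₀, he₀, he₀v⟩ := exists_gMet_eq_zero hq hl hn0
  obtain ⟨φ, hφ, rfl, hφS, hφ'⟩ := h.isLevelHypersurface.exists_parametrization_of_normal hP
    (h.normalFunctional_ne_zero hP) (h.normalFunctional_tangent hP)
  simp only [normalFunctional_apply] at hφ'
  have hNφ : ContDiffAt ℝ 2 (fun t => N (φ t)) 0 := (h.contDiffAt _ hP).comp 0 hφ
  have hφd := (hφ.differentiableAt two_ne_zero).hasFDerivAt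
  have hdx : ∀ e, fderiv ℝ (fun t => (φ t).1) 0 e = (fderiv ℝ φ 0 e).1 := fun e => by
    rw [hφd.fst.fderiv]; rfl
  have hdy : ∀ e, fderiv ℝ (fun t => (φ t).2) 0 e = (fderiv ℝ φ 0 e).2 := fun e => by
    rw [hφd.snd.fderiv]; rfl
  obtain ⟨k, hflat, hcone⟩ := exists_codazzi (α := α) (e₀ := e₀) (contDiffAt_fst.comp 0 hφ)
    (contDiffAt_fst.comp 0 hNφ) (contDiffAt_snd.comp 0 hφ) (contDiffAt_snd.comp 0 hNφ)
    (by
      change fderiv ℝ (fun t => (φ t).2) 0 e₀ ≠ 0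
      rwa [hdy, hφ' _ he₀])
    (h.eventually_umbilical hφ hφS)
  refine codazzi_dichotomy hα hl hx0 k (exists_ne_zero_inner_eq_zero hp _ _) he₀v
    (fun X Y hX hY => ?_) (fun X Y hX hY => ?_)
  · have : k Y • fderiv ℝ (fun t => (φ t).2) 0 X = k X • fderiv ℝ (fun t => (φ t).2) 0 Y :=
      hflat X Y
    rwa [hdy, hdy, hφ' X hX, hφ' Y hY] at this
  · have hX' : fderiv ℝ (fun t => (φ t).1) 0 X = X.1 := by rw [hdx, hφ' X hX]
    have hY' : fderiv ℝ (fun t => (φ t).1) 0 Y = Y.1 := by rw [hdx, hφ' Y hY]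
    rw [← hX', ← hY']
    exact hcone X Y

/-- Functions agreeing on `S` have the same tangential derivatives. -/
lemma _root_.HasFDerivAt.eq_on_tangentConeAt {E G : Type*} [NormedAddCommGroup E] [NormedSpace ℝ E]
    [NormedAddCommGroup G] [NormedSpace ℝ G] {S : Set E} {f f₁ : E → G} {f' f₁' : E →L[ℝ] G} {P : E}
    (hf : HasFDerivAt f f' P) (hf₁ : HasFDerivAt f₁ f₁' P) (hP : P ∈ S) (h : Set.EqOn f f₁ S)
    {X : E} (hX : X ∈ tangentConeAt ℝ S P) : f' X = f₁' X :=
  (hf.hasFDerivWithinAt (s := S)).unique_on (hf₁.hasFDerivWithinAt.congr h (h hP)) hX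

lemma of_tangential (hα : 0 < α) (hq : 1 ≤ q) (h : IsGrushinUmbilical α p q S N) (hne : S.Nonempty)
    (hN : ∀ P ∈ S, ⟪P.1, (N P).1⟫ = 0 ∧ (N P).2 = 0) :
    ∃ a : EuclideanSpace ℝ (Fin p), a ≠ 0 ∧ ∀ z ∈ S, ⟪a, z.1⟫ = 0 := by
  obtain ⟨v₀, hv₀⟩ : ∃ v₀ : EuclideanSpace ℝ (Fin q), v₀ ≠ 0 :=
    ⟨EuclideanSpace.single ⟨0, hq⟩ 1, by simp⟩
  let f : GVec p q → EuclideanSpace ℝ (Fin p) := fun z => (‖z.1‖ ^ 2) ^ (α / 2) • (N z).1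
  have hρ : ∀ P ∈ S, 0 < ‖P.1‖ ^ 2 := fun P hP => by
    have := norm_pos_iff.2 (h.fst_ne_zero P hP)
    positivity
  have hn0 : ∀ P ∈ S, (N P).1 ≠ 0 := fun P hP h0 =>
    h.apply_ne_zero hP (Prod.ext h0 (hN P hP).2)
  have hfd : ∀ P ∈ S, HasFDerivAt f _ P := fun P hP =>
    (((hasFDerivAt_fst (𝕜 := ℝ) (p := P)).norm_sq).rpow_const
      (p := α / 2) (Or.inl (hρ P hP).ne')).smul (h.hasFDerivAt hP).fst
  have hconst := h.isLevelHypersurface.apply_eq_of_fderiv_eq_zero h.isPreconnected (f := f)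
    (fun P hP => (hfd P hP).differentiableAt) (by
      intro P hP X hX
      have hx0 := h.fst_ne_zero P hP
      have hρP := hρ P hP
      obtain ⟨hxn, hw⟩ := hN P hP
      obtain ⟨κ, hκ⟩ := h.umbilical P hP
      have hκ0 : κ = 0 := by
        have hT : ((0, v₀) : GVec p q) ∈ tangentConeAt ℝ S P :=
          h.mem_tangentConeAt hP (by simp [gMet, hw])
        have h1 := (h.hasFDerivAt hP).snd.eq_on_tangentConeAt (hasFDerivAt_const 0 P) hP
          (fun z hz => (hN z hz).2) hT
        have h2 := congrArg Prod.snd (hκ _ hT)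
        simp only [ContinuousLinearMap.comp_apply, ContinuousLinearMap.coe_snd',
          zero_apply] at h1
        simpa [gammaMap, h1, hv₀] using h2
      have hun : ⟪X.1, (N P).1⟫ = 0 := by
        have := h.gMet_tangent P hP X hX
        have hl : (α + 1) ^ 2 * ‖P.1‖ ^ (2 * α) ≠ 0 := by positivity
        rw [gMet, hw, inner_zero_left, add_zero] at this
        rw [real_inner_comm]
        exact (mul_eq_zero.1 this).resolve_left hl
      have hder := umbilical_fst hx0 (hκ X hX)
      rw [hκ0, hxn, hun] at hder
      have hder' : (fderiv ℝ N P X).1 = -((α * (‖P.1‖ ^ 2)⁻¹ * ⟪P.1, X.1⟫) • (N P).1) := by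
        rw [← inv_smul_smul₀ hρP.ne' (fderiv ℝ N P X).1, hder]
        module
      have : fderiv ℝ f P X = (‖P.1‖ ^ 2) ^ (α / 2) • (fderiv ℝ N P X).1
          + (α / 2 * (‖P.1‖ ^ 2) ^ (α / 2 - 1) * (2 * ⟪P.1, X.1⟫)) • (N P).1 := by
        rw [(hfd P hP).fderiv]
        simp
      rw [this, hder', Real.rpow_sub_one hρP.ne']
      module)
  obtain ⟨P, hP⟩ := hne
  refine ⟨f P, smul_ne_zero (Real.rpow_pos_of_pos (hρ P hP) _).ne' (hn0 P hP), fun z hz => ?_⟩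
  rw [hconst P hP z hz, inner_smul_left, real_inner_comm, (hN z hz).1, mul_zero]

lemma of_radial (hα : 0 < α) (hp : 3 ≤ p) (h : IsGrushinUmbilical α p q S N) (hne : S.Nonempty)
    (hN : ∀ P ∈ S, ‖P.1‖ ^ 2 • (N P).1 = ⟪P.1, (N P).1⟫ • P.1) :
    (∃ (b : EuclideanSpace ℝ (Fin q)) (c : ℝ), 0 < c ∧
        ∀ z ∈ S, ‖z.1‖ ^ (2 * (α + 1)) + ‖z.2 - b‖ ^ 2 = c ^ 2) ∨
    (∃ a : EuclideanSpace ℝ (Fin q), a ≠ 0 ∧ ∃ c : ℝ, ∀ z ∈ S, ⟪a, z.2⟫ = c) := by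
  let s : GVec p q → ℝ := fun z => ⟪z.1, (N z).1⟫ / ‖z.1‖ ^ 2
  have hρ : ∀ P ∈ S, 0 < ‖P.1‖ ^ 2 := fun P hP => by
    have := norm_pos_iff.2 (h.fst_ne_zero P hP)
    positivity
  have hNs : ∀ P ∈ S, (N P).1 = s P • P.1 := fun P hP => by
    rw [← inv_smul_smul₀ (hρ P hP).ne' (N P).1, hN P hP, smul_smul, inv_mul_eq_div]
  have hsd : ∀ P ∈ S, DifferentiableAt ℝ s P := fun P hP => by
    have h1 : DifferentiableAt ℝ (fun z : GVec p q => ⟪z.1, (N z).1⟫) P :=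
      differentiableAt_fst.inner ℝ (h.hasFDerivAt hP).fst.differentiableAt
    have h2 : DifferentiableAt ℝ (fun z : GVec p q => ‖z.1‖ ^ 2) P :=
      differentiableAt_fst.norm_sq ℝ
    simpa only [s, div_eq_mul_inv] using h1.fun_mul (h2.fun_inv (hρ P hP).ne')
  have hder : ∀ P ∈ S, ∀ X ∈ tangentConeAt ℝ S P,
      fderiv ℝ s P X = 0 ∧ (fderiv ℝ N P X).2 = ((1 + α) * s P) • X.2 := by
    intro P hP
    obtain ⟨κ, hκ⟩ := h.umbilical P hP
    have hρP := (hρ P hP).ne'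
    have heq : ∀ X ∈ tangentConeAt ℝ S P,
        fderiv ℝ s P X • P.1 + ((1 + α) * s P) • X.1 = -κ • X.1 := fun X hX => by
      have h1 := (h.hasFDerivAt hP).fst.eq_on_tangentConeAt
        ((hsd P hP).hasFDerivAt.smul hasFDerivAt_fst) hP hNs hX
      have h1' : (fderiv ℝ N P X).1 = s P • X.1 + fderiv ℝ s P X • P.1 := by simpa using h1
      have h2 := umbilical_fst (h.fst_ne_zero P hP) (hκ X hX)
      rw [h1', hNs P hP, inner_smul_right, inner_smul_right, real_inner_self_eq_norm_sq,
        real_inner_comm P.1 X.1] at h2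
      refine smul_right_injective _ hρP ?_
      simp only [smul_add]
      rw [← sub_eq_zero] at h2 ⊢
      rw [← h2]
      module
    obtain ⟨u, hu0, hxu, -⟩ := exists_ne_zero_inner_eq_zero hp P.1 0
    have hκs : -κ = (1 + α) * s P := by
      have := heq (u, 0) (h.mem_tangentConeAt hP (by simp [gMet, hNs P hP, inner_smul_left, hxu]))
      have := congrArg (fun z => ⟪z, u⟫) this
      simp only [inner_add_left, inner_smul_left, hxu, conj_trivial, mul_zero, zero_add] at this
      exact (mul_right_cancel₀ (inner_self_ne_zero.2 hu0) this).symm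
    intro X hX
    constructor
    · have := heq X hX
      rw [hκs, add_eq_right] at this
      exact (smul_eq_zero.1 this).resolve_right (h.fst_ne_zero P hP)
    · rw [← hκs]
      exact umbilical_snd (hκ X hX)
  obtain ⟨P₀, hP₀⟩ := hne
  have hs := fun z hz => h.isLevelHypersurface.apply_eq_of_fderiv_eq_zero h.isPreconnected hsd
    (fun P hP X hX => (hder P hP X hX).1) z hz P₀ hP₀
  have hfd : ∀ P ∈ S, HasFDerivAt (fun z => (N z).2 - ((1 + α) * s P₀) • z.2) _ P := fun P hP =>
    (h.hasFDerivAt hP).snd.sub (hasFDerivAt_snd.const_smul ((1 + α) * s P₀))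
  have hw := fun z hz => h.isLevelHypersurface.apply_eq_of_fderiv_eq_zero h.isPreconnected
    (fun P hP => (hfd P hP).differentiableAt) (fun P hP X hX => by
      rw [(hfd P hP).fderiv]
      simp [(hder P hP X hX).2, hs P hP]) z hz P₀ hP₀
  by_cases hs0 : s P₀ = 0
  · right
    simp only [hs0, mul_zero, zero_smul, sub_zero] at hw
    have hn : ∀ z ∈ S, (N z).1 = 0 := fun z hz => by rw [hNs z hz, hs z hz, hs0, zero_smul]
    refine ⟨(N P₀).2, fun h0 => h.apply_ne_zero hP₀ (Prod.ext (hn P₀ hP₀) h0), ⟪(N P₀).2, P₀.2⟫,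
      fun z hz => ?_⟩
    refine h.isLevelHypersurface.apply_eq_of_fderiv_eq_zero h.isPreconnected
      (f := (innerSL ℝ (N P₀).2).comp (ContinuousLinearMap.snd ℝ (EuclideanSpace ℝ (Fin p)) _))
      (fun P _ => ContinuousLinearMap.differentiableAt _) (fun P hP X hX => ?_) z hz P₀ hP₀
    have := h.gMet_tangent P hP X hX
    rw [ContinuousLinearMap.fderiv]
    simpa [gMet, hn P hP, hw P hP] using this
  · left
    have hc : (1 + α) * s P₀ ≠ 0 := mul_ne_zero (by positivity) hs0
    refine ⟨P₀.2 - ((1 + α) * s P₀)⁻¹ • (N P₀).2, |((1 + α) * s P₀)⁻¹|, by positivity,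
      fun z hz => ?_⟩
    have hz0 := h.fst_ne_zero z hz
    have h1 := h.gMet_self z hz
    have h2 : (N z).2 = ((1 + α) * s P₀) • (z.2 - (P₀.2 - ((1 + α) * s P₀)⁻¹ • (N P₀).2)) := by
      have := hw z hz
      rw [smul_sub, smul_sub, smul_inv_smul₀ hc, ← sub_eq_zero]
      rw [← sub_eq_zero] at this
      rw [← this]
      module
    have h3 : ‖z.1‖ ^ (2 * (α + 1)) = ‖z.1‖ ^ (2 * α) * ‖z.1‖ ^ 2 := by
      rw [mul_add, Real.rpow_add (norm_pos_iff.2 hz0)]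
      simp
    rw [gMet, hNs z hz, hs z hz, h2, real_inner_self_eq_norm_sq, real_inner_self_eq_norm_sq,
      norm_smul, norm_smul, mul_pow, mul_pow, Real.norm_eq_abs, Real.norm_eq_abs, sq_abs,
      sq_abs] at h1
    rw [h3, sq_abs, inv_pow]
    refine eq_inv_of_mul_eq_one_left ?_
    linear_combination h1

end IsGrushinUmbilical

end

/-- classification of connected umbilical hypersurfaces of `(M₀, g)`, `p ≥ 3`. -/
theorem grushin_umbilical_classification
    (α : ℝ) (hα : 0 < α) (p q : ℕ) (hp : 3 ≤ p) (hq : 1 ≤ q)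
    (S : Set (GVec p q)) (hS : S ⊆ GM0 p q) (hconn : IsConnected S)
    -- `S` is a smooth hypersurface: locally a regular level set of a smooth function
    (hhyp : ∀ P ∈ S, ∃ (V : Set (GVec p q)) (F : GVec p q → ℝ),
      IsOpen V ∧ P ∈ V ∧ ContDiffOn ℝ (⊤ : ℕ∞) F V ∧
      S ∩ V = {z ∈ V | F z = 0} ∧ ∀ z ∈ V, fderiv ℝ F z ≠ 0)
    -- `N` is a smooth unit normal field along `S` (with respect to `g`)
    (N : GVec p q → GVec p q) (W : Set (GVec p q)) (hW : IsOpen W) (hSW : S ⊆ W)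
    (hNsmooth : ContDiffOn ℝ (⊤ : ℕ∞) N W)
    (hNunit : ∀ P ∈ S, gMet α p q P.1 (N P) (N P) = 1)
    (hNnormal : ∀ P ∈ S, ∀ X ∈ tangentConeAt ℝ S P, gMet α p q P.1 (N P) X = 0)
    -- `S` is umbilical: `∇_X N = -κ(P) X` on tangent vectors
    (humb : ∀ P ∈ S, ∃ κ : ℝ, ∀ X ∈ tangentConeAt ℝ S P,
      fderiv ℝ N P X + gammaMap α p q P.1 X (N P) = (-κ) • X) :
    -- (A1) homogeneous sphere, or (A2) plane `⟨a,y⟩ = c`, or (B) plane `⟨a,x⟩ = 0`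
    (∃ (b : EuclideanSpace ℝ (Fin q)) (c : ℝ), 0 < c ∧
        ∀ z ∈ S, ‖z.1‖ ^ (2 * (α + 1)) + ‖z.2 - b‖ ^ 2 = c ^ 2) ∨
    (∃ a : EuclideanSpace ℝ (Fin q), a ≠ 0 ∧ ∃ c : ℝ, ∀ z ∈ S, ⟪a, z.2⟫ = c) ∨
    (∃ a : EuclideanSpace ℝ (Fin p), a ≠ 0 ∧ ∀ z ∈ S, ⟪a, z.1⟫ = 0) := by
  have h : IsGrushinUmbilical α p q S N :=
    { fst_ne_zero := hS
      isPreconnected := hconn.isPreconnected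
      isLevelHypersurface := hhyp
      contDiffAt := fun P hP => (hNsmooth.contDiffAt (hW.mem_nhds (hSW hP))).of_le
        (show ((2 : ℕ∞) : WithTop ℕ∞) ≤ _ from WithTop.coe_le_coe.2 le_top)
      gMet_self := hNunit
      gMet_tangent := hNnormal
      umbilical := humb }
  have hcont : Continuous fun z : S => N z :=
    (hNsmooth.continuousOn.mono hSW).domRestrict
  let A : Set S := {z | ‖z.1.1‖ ^ 2 • (N z).1 = ⟪z.1.1, (N z).1⟫ • z.1.1}
  let B : Set S := {z | ⟪z.1.1, (N z).1⟫ = 0 ∧ (N z).2 = 0}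
  have hx : Continuous fun z : S => z.1.1 := continuous_fst.comp continuous_subtype_val
  have hn : Continuous fun z : S => (N z).1 := continuous_fst.comp hcont
  have hw : Continuous fun z : S => (N z).2 := continuous_snd.comp hcont
  have hA : IsClosed A := isClosed_eq ((hx.norm.pow 2).smul hn) ((hx.inner (𝕜 := ℝ) hn).smul hx)
  have hB : IsClosed B :=
    (isClosed_eq (hx.inner (𝕜 := ℝ) hn) continuous_const).inter (isClosed_eq hw continuous_const)
  have hAB : Aᶜ = B := by
    ext ⟨z, hz⟩
    refine ⟨fun hzA => (h.dichotomy hα hp hq hz).resolve_left hzA, fun ⟨hb, hw⟩ hzA => ?_⟩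
    have hz0 : z.1 ≠ 0 := hS hz
    have hzA' : ‖z.1‖ ^ 2 • (N z).1 = ⟪z.1, (N z).1⟫ • z.1 := hzA
    simp only [hb, zero_smul, smul_eq_zero] at hzA'
    exact h.apply_ne_zero hz (Prod.ext (hzA'.resolve_left (by simpa using hz0)) hw)
  have hclopen : IsClopen A := ⟨hA, by rw [← isClosed_compl_iff, hAB]; exact hB⟩
  have : PreconnectedSpace S := Subtype.preconnectedSpace hconn.isPreconnected
  rcases isClopen_iff.1 hclopen with hempty | huniv
  · have hBu : B = Set.univ := by rw [← hAB, hempty, Set.compl_empty]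
    refine Or.inr (Or.inr (h.of_tangential hα hq hconn.nonempty fun P hP => ?_))
    have : (⟨P, hP⟩ : S) ∈ B := hBu ▸ Set.mem_univ _
    exact this
  · refine or_assoc.1 (Or.inl (h.of_radial hα hp hconn.nonempty fun P hP => ?_))
    have : (⟨P, hP⟩ : S) ∈ A := huniv ▸ Set.mem_univ _
    exact this

end
end
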